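/- Let X be a complex Banach space of dimension at least 2 and let J be a Jordan algebra of compact operators on X (a linear subspace of B(X), closed under the Jordan product {A,B} = AB + BA, all of whose elements are compact). If J has submultiplicative spectrum, i.e. σ(AB) ⊆ {αβ : α ∈ σ(A), β ∈ σ(B)} for all A, B ∈ J, then J is reducible: there exists a closed subspace M of X with M ≠ {0} and M ≠ X such that A(M) ⊆ M for every A ∈ J. -/

import Mathlib

open Filter Topology

section SpectrumPerturbation

variable {A : Type*} [NormedRing A] [NormedAlgebra ℂ A] [CompleteSpace A]

/-- A point of the spectrum enclosed by a circle in the resolvent set survives small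
perturbations inside that circle. -/
theorem spectrum_eventually_exists_mem_closedBall {T : A} {l : ℂ} {r : ℝ} (hr : 0 < r)
    (hl : l ∈ spectrum ℂ T) (hs : ∀ z ∈ Metric.sphere l r, z ∉ spectrum ℂ T) :
    ∀ᶠ S in 𝓝 T, ∃ m ∈ spectrum ℂ S, ‖m - l‖ ≤ r := by
  have hcont : ∀ z ∈ Metric.sphere l r,
      ContinuousAt (fun p : A × ℂ => resolvent p.1 p.2) (T, z) := by
    intro z hz
    have hu : IsUnit (algebraMap ℂ A z - T) := by
      have := hs z hz
      rwa [spectrum.mem_iff, not_not] at this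
    obtain ⟨u, hu⟩ := hu
    have h1 := NormedRing.inverse_continuousAt u
    have h2 : ContinuousAt (fun p : A × ℂ => algebraMap ℂ A p.2 - p.1) (T, z) := by
      have := (algebraMapCLM ℂ A).continuous
      exact ((this.comp continuous_snd).sub continuous_fst).continuousAt
    rw [hu] at h1
    exact ContinuousAt.comp (f := fun p : A × ℂ => algebraMap ℂ A p.2 - p.1) h1 h2
  have hcomp : IsCompact (Metric.sphere l r) := isCompact_sphere l r
  obtain ⟨C, hC⟩ : ∃ C : ℝ, ∀ z ∈ Metric.sphere l r, ‖resolvent T z‖ ≤ C := by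
    refine hcomp.exists_bound_of_continuousOn (f := fun z => resolvent T z) ?_
    intro z hz
    have h2 : ContinuousAt (fun w : ℂ => (T, w)) z := by fun_prop
    exact (ContinuousAt.comp (f := fun w : ℂ => (T, w)) (hcont z hz) h2).continuousWithinAt
  have hev : ∀ᶠ S in 𝓝 T, ∀ z ∈ Metric.sphere l r,
      IsUnit (algebraMap ℂ A z - S) ∧ ‖resolvent S z‖ < C + 1 := by
    refine hcomp.eventually_forall_of_forall_eventually
        (P := fun S z => IsUnit (algebraMap ℂ A z - S) ∧ ‖resolvent S z‖ < C + 1) ?_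
    intro z hz
    have h1 := (hcont z hz).norm
    have h3 : ∀ᶠ p in 𝓝 (T, z), IsUnit (algebraMap ℂ A p.2 - p.1) := by
      have hu : IsUnit (algebraMap ℂ A z - T) := by
        have := hs z hz
        rwa [spectrum.mem_iff, not_not] at this
      have h2 : ContinuousAt (fun p : A × ℂ => algebraMap ℂ A p.2 - p.1) (T, z) := by
        have := (algebraMapCLM ℂ A).continuous
        exact ((this.comp continuous_snd).sub continuous_fst).continuousAt
      exact h2.eventually (Units.isOpen.mem_nhds hu)
    exact h3.and (h1.eventually_lt_const (by have := hC z hz; simp only; linarith))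
  have hC0 : 0 ≤ C := by
    obtain ⟨z, hz⟩ := (NormedSpace.sphere_nonempty (x := l) (r := r)).mpr hr.le
    exact (norm_nonneg _).trans (hC z hz)
  have hnear : ∀ᶠ S in 𝓝 T, ‖S - T‖ < (C + 1)⁻¹ := by
    have : ContinuousAt (fun S : A => ‖S - T‖) T := by fun_prop
    exact this.eventually_lt_const (by simp; positivity)
  filter_upwards [hev, hnear] with S hS hST
  by_contra! hno
  have hball : ∀ z ∈ Metric.closedBall l r, z ∈ resolventSet ℂ S := by
    intro z hz
    by_contra hzs
    have := hno z hzs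
    rw [mem_closedBall_iff_norm] at hz
    linarith
  have hd : DiffContOnCl ℂ (resolvent S) (Metric.ball l r) := by
    refine DifferentiableOn.diffContOnCl ?_
    intro z hz
    rw [closure_ball l hr.ne'] at hz
    exact (spectrum.hasDerivAt_resolvent_const_left
        (hball z hz)).differentiableAt.differentiableWithinAt
  have hmax : ‖resolvent S l‖ ≤ C + 1 := by
    refine Complex.norm_le_of_forall_mem_frontier_norm_le Metric.isBounded_ball hd ?_
      (subset_closure (Metric.mem_ball_self hr))
    intro z hz
    rw [frontier_ball l hr.ne'] at hz
    exact (hS z hz).2.le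
  have hlu : IsUnit (algebraMap ℂ A l - S) := hball l (Metric.mem_closedBall_self hr.le)
  obtain ⟨u, hu⟩ := hlu
  have hinv : resolvent S l = ↑u⁻¹ := by
    rw [resolvent, ← hu, Ring.inverse_unit]
  apply spectrum.mem_iff.mp hl
  rcases subsingleton_or_nontrivial A with hA | hA
  · exact ⟨1, Subsingleton.elim _ _⟩
  have : ‖(algebraMap ℂ A l - T) - u‖ < ‖(↑u⁻¹ : A)‖⁻¹ := by
    rw [hu]
    have h0 : 0 < ‖(↑u⁻¹ : A)‖ := Units.norm_pos u⁻¹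
    have : algebraMap ℂ A l - T - (algebraMap ℂ A l - S) = S - T := by abel
    rw [this]
    refine hST.trans_le ?_
    rw [hinv] at hmax
    gcongr
  exact ⟨Units.ofNearby u _ this, rfl⟩

end SpectrumPerturbation

section Quotient

variable {X : Type*} [NormedAddCommGroup X] [NormedSpace ℂ X]

/-- The operator induced on a quotient by an operator leaving the subspace invariant. -/
noncomputable def quotientMapCLM (Y : Submodule ℂ X) (b : X →L[ℂ] X) (hb : ∀ x ∈ Y, b x ∈ Y) :
    X ⧸ Y →L[ℂ] X ⧸ Y :=
  Y.liftQL (Y.mkQL ∘L b) fun x hx => by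
    simpa using hb x hx

@[simp]
theorem quotientMapCLM_mk (Y : Submodule ℂ X) (b : X →L[ℂ] X) (hb : ∀ x ∈ Y, b x ∈ Y) (x : X) :
    quotientMapCLM Y b hb (Submodule.Quotient.mk x) = Submodule.Quotient.mk (b x) := rfl

theorem IsCompactOperator.quotientMapCLM {Y : Submodule ℂ X} {b : X →L[ℂ] X}
    (hc : IsCompactOperator b) (hb : ∀ x ∈ Y, b x ∈ Y) :
    IsCompactOperator (quotientMapCLM Y b hb) := by
  obtain ⟨K, hK, hKb⟩ := hc.clm_comp Y.mkQL
  refine ⟨K, hK, ?_⟩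
  have hopen : IsOpenMap Y.mkQL := Y.isOpenQuotientMap_mkQL.isOpenMap
  have := hopen.image_mem_nhds hKb
  rw [map_zero] at this
  refine mem_of_superset this ?_
  rintro _ ⟨x, hx, rfl⟩
  exact hx

end Quotient

section Riesz

variable {X : Type*} [NormedAddCommGroup X] [NormedSpace ℂ X]

theorem finiteDimensional_of_isCompactOperator_eq_smul {κ : X →L[ℂ] X} (hκ : IsCompactOperator κ)
    {a : ℂ} (ha : a ≠ 0) {N : Submodule ℂ X} (hN : IsClosed (N : Set X))
    (h : ∀ x ∈ N, κ x = a • x) : FiniteDimensional ℂ N := by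
  have hmap : ∀ x ∈ N, κ x ∈ N := fun x hx => by rw [h x hx]; exact N.smul_mem _ hx
  have h1 : IsCompactOperator ((κ : X →ₗ[ℂ] X).restrict hmap) :=
    IsCompactOperator.restrict (f := (κ : X →ₗ[ℂ] X)) hκ hmap hN
  have h2 := h1.smul (a⁻¹)
  apply FiniteDimensional.of_isCompactOperator_id (𝕜 := ℂ)
  have h3 : (id : N → N) = a⁻¹ • ⇑((κ : X →ₗ[ℂ] X).restrict hmap) := by
    funext x
    apply Subtype.ext
    simp [LinearMap.restrict_apply, h x x.2, ha]
  rw [h3]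
  exact h2

/-- Up to a compact operator, powers of `κ - a` are scalar. -/
theorem exists_isCompactOperator_sub_pow {κ : X →L[ℂ] X} (hκ : IsCompactOperator κ) (a : ℂ)
    (n : ℕ) : ∃ l : X →L[ℂ] X, IsCompactOperator l ∧
      (κ - algebraMap ℂ _ a) ^ n = l + algebraMap ℂ _ ((-a) ^ n) := by
  induction n with
  | zero => exact ⟨0, isCompactOperator_zero, by simp⟩
  | succ n ih =>
    obtain ⟨l, hl, h⟩ := ih
    refine ⟨(l + algebraMap ℂ _ ((-a) ^ n)) * κ + (-a) • l, ?_, ?_⟩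
    · exact (hκ.clm_comp (l + algebraMap ℂ _ ((-a) ^ n))).add (hl.smul (-a))
    · rw [pow_succ, h]
      simp only [Algebra.algebraMap_eq_smul_one, mul_sub, mul_smul_comm, mul_one, pow_succ,
        smul_add, smul_smul]
      module

theorem finiteDimensional_ker_sub_pow {κ : X →L[ℂ] X} (hκ : IsCompactOperator κ) {a : ℂ}
    (ha : a ≠ 0) (n : ℕ) :
    FiniteDimensional ℂ ((κ - algebraMap ℂ _ a) ^ n : X →L[ℂ] X).ker := by
  obtain ⟨l, hl, h⟩ := exists_isCompactOperator_sub_pow hκ a n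
  refine finiteDimensional_of_isCompactOperator_eq_smul hl (a := -(-a) ^ n)
    (by simp [ha]) (ContinuousLinearMap.isClosed_ker _) ?_
  intro x hx
  have : (l + algebraMap ℂ (X →L[ℂ] X) ((-a) ^ n)) x = 0 := by rw [← h]; exact hx
  simp only [Algebra.algebraMap_eq_smul_one, add_apply, smul_apply,
    one_apply_eq_self] at this
  rw [neg_smul]; exact eq_neg_of_add_eq_zero_left this

/-- Finite ascent: the kernels of the powers of `κ - a` stabilise. -/
theorem exists_ker_sub_pow_stable {κ : X →L[ℂ] X} (hκ : IsCompactOperator κ) {a : ℂ}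
    (ha : a ≠ 0) : ∃ m : ℕ, ∀ x : X, ((κ - algebraMap ℂ _ a) ^ (m + 1)) x = 0 →
      ((κ - algebraMap ℂ _ a) ^ m) x = 0 := by
  set T : X →L[ℂ] X := κ - algebraMap ℂ _ a with hT
  by_contra! hno
  have key : ∀ n : ℕ, ∃ x : X, (T ^ (n + 1)) x = 0 ∧ ‖x‖ ≤ 3 ∧
      ∀ y, (T ^ n) y = 0 → 1 ≤ ‖x - y‖ := by
    intro n
    let E := (T ^ (n + 1) : X →L[ℂ] X).ker
    let F : Submodule ℂ E := (T ^ n : X →L[ℂ] X).ker.comap E.subtype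
    have hF : IsClosed (F : Set E) :=
      (ContinuousLinearMap.isClosed_ker (T ^ n)).preimage continuous_subtype_val
    obtain ⟨x, hx1, hx2⟩ := hno n
    obtain ⟨x0, h0, h1⟩ := riesz_lemma_of_norm_lt (𝕜 := ℂ) (c := 2) (by norm_num) (R := 3)
      (by norm_num) hF ⟨⟨x, hx1⟩, hx2⟩
    refine ⟨x0, x0.2, h0, fun y hy => ?_⟩
    have hy' : y ∈ E := by
      change (T ^ (n + 1)) y = 0
      rw [pow_succ', mul_apply_eq_comp, hy, map_zero]
    exact h1 ⟨y, hy'⟩ hy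
  choose x hx1 hx2 hx3 using key
  have hker : ∀ m n : ℕ, m ≤ n → ∀ y, (T ^ m) y = 0 → (T ^ n) y = 0 := by
    intro m n hmn y hy
    obtain ⟨k, rfl⟩ := Nat.exists_eq_add_of_le' hmn
    rw [pow_add, mul_apply_eq_comp, hy, map_zero]
  have hsep : ∀ m n : ℕ, m < n → ‖a‖ ≤ ‖κ (x n) - κ (x m)‖ := by
    intro m n hmn
    have hκT : ∀ y, κ y = T y + a • y := by
      intro y; simp [hT, Algebra.algebraMap_eq_smul_one]
    have h1 : (T ^ n) (a⁻¹ • (κ (x m) - T (x n))) = 0 := by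
      rw [map_smul, map_sub, hκT (x m), map_add, map_smul, hker (m+1) n hmn _ (hx1 m)]
      have h2 : (T ^ n) (T (x m)) = 0 := by
        rw [← mul_apply_eq_comp, ← pow_succ]
        exact hker (m + 1) (n + 1) (by lia) _ (hx1 m)
      have h3 : (T ^ n) (T (x n)) = 0 := by
        rw [← mul_apply_eq_comp, ← pow_succ]
        exact hx1 n
      rw [h2, h3]; simp
    have h4 := hx3 n _ h1
    have h5 : κ (x n) - κ (x m) = a • (x n - a⁻¹ • (κ (x m) - T (x n))) := by
      rw [smul_sub, smul_smul, mul_inv_cancel₀ ha, one_smul, hκT (x n)]; abel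
    rw [h5, norm_smul]
    nlinarith [norm_nonneg a]
  obtain ⟨K, hK, hKs⟩ := IsCompactOperator.image_closedBall_subset_compact (f := (κ : X →ₗ[ℂ] X))
      hκ 3
  have hmem : ∀ n, κ (x n) ∈ K := fun n => hKs ⟨x n, by simpa using hx2 n, rfl⟩
  obtain ⟨z, -, φ, hφ, hlim⟩ := hK.tendsto_subseq hmem
  have hc := hlim.cauchySeq
  rw [Metric.cauchySeq_iff] at hc
  obtain ⟨N, hN⟩ := hc ‖a‖ (by positivity)
  have := hN (N+1) (by lia) N le_rfl
  rw [dist_eq_norm] at this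
  have h2 := hsep _ _ (hφ (Nat.lt_succ_self N))
  simp only [Function.comp, Nat.succ_eq_add_one] at this h2
  linarith

/-- Riesz: a power `S` of `κ - a` admits a group inverse with finite rank defect. -/
theorem exists_groupInverse_sub_pow [CompleteSpace X] {κ : X →L[ℂ] X} (hκ : IsCompactOperator κ)
    {a : ℂ}
    (ha : a ≠ 0) : ∃ (m : ℕ) (v : X →L[ℂ] X), (κ - algebraMap ℂ _ a) ^ (m + 1) * v =
        v * (κ - algebraMap ℂ _ a) ^ (m + 1) ∧
      (κ - algebraMap ℂ _ a) ^ (m + 1) * v * (κ - algebraMap ℂ _ a) ^ (m + 1) =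
        (κ - algebraMap ℂ _ a) ^ (m + 1) ∧
      FiniteDimensional ℂ (1 - (κ - algebraMap ℂ _ a) ^ (m + 1) * v : X →L[ℂ] X).range := by
  obtain ⟨m, hm⟩ := exists_ker_sub_pow_stable hκ ha
  set T : X →L[ℂ] X := κ - algebraMap ℂ _ a with hT
  have hm1 : ∀ x, (T ^ (m + 1)) (T x) = 0 → (T ^ (m + 1)) x = 0 := by
    intro x hx
    rw [← mul_apply_eq_comp, ← pow_succ, pow_succ', mul_apply_eq_comp] at hx
    have h1 := hm (T x) (by
      rw [← mul_apply_eq_comp, ← pow_succ, pow_succ', mul_apply_eq_comp]; exact hx)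
    rw [← mul_apply_eq_comp, ← pow_succ] at h1
    exact h1
  set S : X →L[ℂ] X := T ^ (m + 1) with hS
  set N : Submodule ℂ X := S.ker with hN
  have hNc : IsClosed (N : Set X) := ContinuousLinearMap.isClosed_ker S
  have hκS : Commute κ S := by
    have : Commute κ T := (Commute.refl κ).sub_right (Algebra.commutes a κ).symm
    exact this.pow_right _
  have hκN : ∀ x ∈ N, κ x ∈ N := by
    intro x hx
    change S (κ x) = 0
    have hx' : S x = 0 := hx
    rw [← mul_apply_eq_comp, ← hκS.eq, mul_apply_eq_comp, hx', map_zero]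
  have hTS : Commute T S := (Commute.refl T).pow_right _
  have hTN : ∀ x ∈ N, T x ∈ N := by
    intro x hx
    change S (T x) = 0
    have hx' : S x = 0 := hx
    rw [← mul_apply_eq_comp, ← hTS.eq, mul_apply_eq_comp, hx', map_zero]
  have hSN : ∀ x ∈ N, S x ∈ N := by
    intro x hx
    have hx' : S x = 0 := hx
    rw [hx']; exact N.zero_mem
  set κQ := quotientMapCLM N κ hκN
  set TQ := quotientMapCLM N T hTN
  set SQ := quotientMapCLM N S hSN
  have hκQ : IsCompactOperator κQ := hκ.quotientMapCLM hκN
  have hTQ : κQ - algebraMap ℂ _ a = TQ := by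
    ext x
    obtain ⟨x, rfl⟩ := Submodule.Quotient.mk_surjective _ x
    simp only [κQ, TQ, sub_apply, quotientMapCLM_mk, Algebra.algebraMap_eq_smul_one, smul_apply,
      one_apply_eq_self, hT, Submodule.Quotient.mk_sub, Submodule.Quotient.mk_smul]
  have hunit : IsUnit TQ := by
    rcases hκQ.hasEigenvalue_or_mem_resolventSet ha with h | h
    · exfalso
      obtain ⟨x, hx⟩ := h.exists_hasEigenvector
      obtain ⟨x, rfl⟩ := Submodule.Quotient.mk_surjective _ x
      apply hx.2
      have h1 := hx.apply_eq_smul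
      have h2 : TQ (Submodule.Quotient.mk x) = 0 := by
        rw [← hTQ, sub_apply, Algebra.algebraMap_eq_smul_one, smul_apply, one_apply_eq_self]
        exact sub_eq_zero.mpr h1
      rw [quotientMapCLM_mk, Submodule.Quotient.mk_eq_zero] at h2
      rw [Submodule.Quotient.mk_eq_zero]
      exact hm1 x h2
    · rw [spectrum.mem_resolventSet_iff] at h
      rw [← hTQ, ← neg_sub]
      exact h.neg
  have hSQ : SQ = TQ ^ (m + 1) := by
    have : ∀ n : ℕ, ∀ x : X, (TQ ^ n) (Submodule.Quotient.mk x) =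
        Submodule.Quotient.mk ((T ^ n) x) := by
      intro n
      induction n with
      | zero => intro x; simp
      | succ n ih => intro x; rw [pow_succ, pow_succ, mul_apply_eq_comp, mul_apply_eq_comp,
          quotientMapCLM_mk, ih]
    ext x
    obtain ⟨x, rfl⟩ := Submodule.Quotient.mk_surjective _ x
    rw [this, quotientMapCLM_mk]
  obtain ⟨u, hu⟩ : IsUnit SQ := hSQ ▸ hunit.pow _
  set σ : X ⧸ N →L[ℂ] X := N.liftQL S (le_refl _) with hσ
  have hσmk : ∀ x : X, σ (N.mkQL x) = S x := fun x => rfl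
  have hπσ : ∀ y, N.mkQL (σ y) = SQ y := by
    intro y
    obtain ⟨y, rfl⟩ := Submodule.Quotient.mk_surjective _ y
    rfl
  have hπS : ∀ x, N.mkQL (S x) = SQ (N.mkQL x) := fun x => rfl
  have hSσ : ∀ y, S (σ y) = σ (SQ y) := by
    intro y
    rw [← hσmk, hπσ]
  have e1 : ∀ y, SQ ((↑u⁻¹ : X ⧸ N →L[ℂ] X ⧸ N) y) = y := by
    intro y; rw [← hu, ← mul_apply_eq_comp, Units.mul_inv]; rfl
  have e2 : ∀ y, (↑u⁻¹ : X ⧸ N →L[ℂ] X ⧸ N) (SQ y) = y := by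
    intro y; rw [← hu, ← mul_apply_eq_comp, Units.inv_mul]; rfl
  set w : X ⧸ N →L[ℂ] X ⧸ N := ↑u⁻¹
  set v : X →L[ℂ] X := σ ∘L w ∘L w ∘L N.mkQL with hv
  have hSv : ∀ x, (S * v) x = σ (w (N.mkQL x)) := by
    intro x
    change S (σ (w (w (N.mkQL x)))) = _
    rw [hSσ, e1]
  refine ⟨m, v, ?_, ?_, ?_⟩
  · ext x
    rw [hSv]
    change _ = σ (w (w (N.mkQL (S x))))
    rw [hπS, e2]
  · ext x
    rw [mul_apply_eq_comp, hSv, hπS, e2, hσmk]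
  · have hfd : FiniteDimensional ℂ N := finiteDimensional_ker_sub_pow hκ ha (m + 1)
    refine Submodule.finiteDimensional_of_le (S₂ := N) ?_
    rintro _ ⟨x, rfl⟩
    change S ((1 - S * v) x) = 0
    rw [sub_apply, one_apply_eq_self, map_sub, hSv, hSσ, e1, hσmk, sub_self]

end Riesz

section Growth

variable {A : Type*} [NormedRing A]

/-- The powers of `a` grow at most like the powers of `r`. -/
def PowGrowth (a : A) (r : ℝ) : Prop := ∃ C : ℝ, ∀ n : ℕ, ‖a ^ n‖ ≤ C * r ^ n

theorem PowGrowth.add {a b : A} {r s : ℝ} (ha : PowGrowth a r) (hb : PowGrowth b s)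
    (hab : Commute a b) : PowGrowth (a + b) (r + s) := by
  obtain ⟨C, hC⟩ := ha
  obtain ⟨D, hD⟩ := hb
  have hD0 : 0 ≤ D := by simpa using (norm_nonneg _).trans (hD 0)
  refine ⟨C * D * (‖(1 : A)‖ + 1), fun n => ?_⟩
  rw [hab.add_pow', add_pow, Finset.mul_sum, Finset.Nat.sum_antidiagonal_eq_sum_range_succ_mk]
  refine norm_sum_le_of_le _ fun i hi => ?_
  have h1 : ‖a ^ i * b ^ (n - i)‖ ≤ C * r ^ i * (D * s ^ (n - i)) :=
    (norm_mul_le _ _).trans (mul_le_mul (hC _) (hD _) (norm_nonneg _)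
      ((norm_nonneg _).trans (hC _)))
  have h0 := (norm_nonneg _).trans h1
  calc ‖n.choose i • (a ^ i * b ^ (n - i))‖ ≤ n.choose i * ‖a ^ i * b ^ (n - i)‖ := norm_nsmul_le
    _ ≤ n.choose i * (C * r ^ i * (D * s ^ (n - i))) := by gcongr
    _ ≤ n.choose i * (C * r ^ i * (D * s ^ (n - i))) * (‖(1 : A)‖ + 1) := by
      apply le_mul_of_one_le_right (by positivity); linarith [norm_nonneg (1 : A)]
    _ = C * D * (‖(1 : A)‖ + 1) * (r ^ i * s ^ (n - i) * n.choose i) := by ring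

theorem PowGrowth.mul {a b : A} {r s : ℝ} (ha : PowGrowth a r) (hb : PowGrowth b s)
    (hab : Commute a b) : PowGrowth (a * b) (r * s) := by
  obtain ⟨C, hC⟩ := ha
  obtain ⟨D, hD⟩ := hb
  refine ⟨C * D, fun n => ?_⟩
  rw [hab.mul_pow, mul_pow]
  calc _ ≤ ‖a ^ n‖ * ‖b ^ n‖ := norm_mul_le _ _
    _ ≤ (C * r ^ n) * (D * s ^ n) := mul_le_mul (hC _) (hD _) (norm_nonneg _)
      ((norm_nonneg _).trans (hC _))
    _ = _ := by ring

theorem PowGrowth.mono {a : A} {r s : ℝ} (ha : PowGrowth a r) (hr : 0 ≤ r) (hrs : r ≤ s) :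
    PowGrowth a s := by
  obtain ⟨C, hC⟩ := ha
  have hC0 : 0 ≤ C := by simpa using (norm_nonneg _).trans (hC 0)
  exact ⟨C, fun n => (hC n).trans (by gcongr)⟩

theorem powGrowth_norm (a : A) : PowGrowth a ‖a‖ := by
  refine ⟨‖(1 : A)‖ + 1, fun n => ?_⟩
  rcases n.eq_zero_or_pos with rfl | hn
  · simp
  · calc ‖a ^ n‖ ≤ ‖a‖ ^ n := norm_pow_le' a hn
      _ ≤ (‖(1 : A)‖ + 1) * ‖a‖ ^ n := le_mul_of_one_le_left (by positivity) (by simp)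

theorem PowGrowth.pow {a : A} {r : ℝ} (ha : PowGrowth a r) (k : ℕ) : PowGrowth (a ^ k) (r ^ k) := by
  obtain ⟨C, hC⟩ := ha
  exact ⟨C, fun n => by rw [← pow_mul, ← pow_mul]; exact hC _⟩

theorem powGrowth_of_pow_eq_zero {a : A} {m : ℕ} (h : a ^ m = 0) {r : ℝ} (hr : 0 < r) :
    PowGrowth a r := by
  refine ⟨∑ i ∈ Finset.range m, ‖a ^ i‖ / r ^ i, fun n => ?_⟩
  rcases lt_or_ge n m with hn | hn
  · rw [← div_le_iff₀ (by positivity)]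
    exact Finset.single_le_sum (f := fun i => ‖a ^ i‖ / r ^ i) (fun i _ => by positivity)
      (Finset.mem_range.mpr hn)
  · rw [pow_eq_zero_of_le hn h, norm_zero]
    exact mul_nonneg (Finset.sum_nonneg fun i _ => by positivity) (by positivity)

theorem PowGrowth.smul [NormedAlgebra ℂ A] {a : A} {r : ℝ} (ha : PowGrowth a r) (c : ℂ) :
    PowGrowth (c • a) (‖c‖ * r) := by
  obtain ⟨C, hC⟩ := ha
  refine ⟨C, fun n => ?_⟩
  rw [smul_pow, norm_smul, norm_pow, mul_pow]
  calc _ ≤ ‖c‖ ^ n * (C * r ^ n) := by gcongr; exact hC n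
    _ = _ := by ring

theorem PowGrowth.one_add_pow_sub_one {a : A} {r : ℝ} (ha : PowGrowth a r) (hr : 0 ≤ r) (N : ℕ) :
    PowGrowth ((1 + a) ^ N - 1) ((1 + r) ^ N - 1) := by
  induction N with
  | zero => simpa using powGrowth_norm (0 : A)
  | succ N ih =>
    have h1 : PowGrowth (1 : A) 1 := ⟨‖(1 : A)‖, fun n => by simp⟩
    have h2 : PowGrowth (1 + a) (1 + r) := h1.add ha (Commute.one_left a)
    have hc0 : Commute (1 + a) a := (Commute.one_left a).add_left (Commute.refl a)
    have hc : Commute ((1 + a) ^ N - 1) (1 + a) :=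
      ((Commute.refl _).pow_left N).sub_left (Commute.one_left _)
    have hN : (1 : ℝ) ≤ (1 + r) ^ N := one_le_pow₀ (by linarith)
    have h3 := (ih.mul h2 hc).add ha
      (((hc0.pow_left N).sub_left (Commute.one_left _)).mul_left hc0)
    convert h3 using 1
    · rw [pow_succ]; noncomm_ring
    · ring

theorem powGrowth_of_spectrum [NormedAlgebra ℂ A] [CompleteSpace A] {a : A} {r : ℝ} (hr : 0 < r)
    (h : ∀ z ∈ spectrum ℂ a, ‖z‖ < r) : ∃ s, 0 < s ∧ s < r ∧ PowGrowth a s := by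
  have hrad : spectralRadius ℂ a < ENNReal.ofReal r := by
    rcases (spectrum ℂ a).eq_empty_or_nonempty with he | hne
    · rw [spectralRadius, he]; simpa using hr
    · refine spectrum.spectralRadius_lt_of_forall_lt_of_nonempty (r := r.toNNReal) hne ?_
      intro z hz
      rw [← NNReal.coe_lt_coe, Real.coe_toNNReal _ hr.le]
      exact h z hz
  obtain ⟨s, hs1, hs2⟩ := exists_between hrad
  have hsr : s.toReal < r := by
    rw [← ENNReal.toReal_ofReal hr.le]
    exact (ENNReal.toReal_lt_toReal hs2.ne_top ENNReal.ofReal_ne_top).mpr hs2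
  have hs0 : 0 < s.toReal := ENNReal.toReal_pos (ne_bot_of_gt hs1) hs2.ne_top
  refine ⟨s.toReal, hs0, hsr, ?_⟩
  have hev := (spectrum.pow_nnnorm_pow_one_div_tendsto_nhds_spectralRadius a).eventually_lt_const
      hs1
  obtain ⟨m, hm⟩ := eventually_atTop.mp hev
  refine ⟨∑ i ∈ Finset.range (m + 1), ‖a ^ i‖ / s.toReal ^ i + 1, fun n => ?_⟩
  have hsum : 0 ≤ ∑ i ∈ Finset.range (m + 1), ‖a ^ i‖ / s.toReal ^ i :=
    Finset.sum_nonneg fun i _ => by positivity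
  rcases lt_or_ge n (m + 1) with hn | hn
  · rw [← div_le_iff₀ (by positivity)]
    have := Finset.single_le_sum (f := fun i => ‖a ^ i‖ / s.toReal ^ i)
      (fun i _ => by positivity) (Finset.mem_range.mpr hn)
    linarith
  · have h1 := hm n (by lia)
    have hn0 : (0 : ℝ) < n := by norm_cast; lia
    have h2 : (‖a ^ n‖₊ : ENNReal) ≤ s ^ n := by
      have h3 := ENNReal.rpow_le_rpow h1.le hn0.le
      rw [← ENNReal.rpow_mul, one_div, inv_mul_cancel₀ hn0.ne', ENNReal.rpow_one,
        ENNReal.rpow_natCast] at h3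
      exact h3
    have h4 := ENNReal.toReal_mono (by simp [hs2.ne_top]) h2
    rw [ENNReal.toReal_pow] at h4
    simp only [ENNReal.coe_toReal, coe_nnnorm] at h4
    nlinarith [pow_pos hs0 n]

end Growth

section RieszIdempotent

variable {X : Type*} [NormedAddCommGroup X] [NormedSpace ℂ X] [CompleteSpace X]

theorem exists_riesz_idempotent {κ : X →L[ℂ] X} (hκ : IsCompactOperator κ) {a : ℂ}
    (ha : a ≠ 0) : ∃ (m : ℕ) (p V : X →L[ℂ] X), p * p = p ∧
      FiniteDimensional ℂ p.range ∧ (κ - algebraMap ℂ _ a) ^ m * p = 0 ∧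
      V * (κ - algebraMap ℂ _ a) = 1 - p ∧ (κ - algebraMap ℂ _ a) * V = 1 - p ∧
      V * p = 0 ∧ p * V = 0 ∧
      ∀ b, Commute b κ → Commute b p := by
  obtain ⟨m, v, h1, h2, h3⟩ := exists_groupInverse_sub_pow hκ ha
  set T : X →L[ℂ] X := κ - algebraMap ℂ _ a with hT
  set S := T ^ (m + 1) with hS
  obtain ⟨q, hq⟩ : ∃ q, q = S * v := ⟨_, rfl⟩
  rw [← hq] at h1 h2 h3
  have hqq : q * q = q := by
    calc q * q = q * S * v := by rw [mul_assoc, ← hq]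
      _ = q := by rw [h2, hq]
  have hSq : S * q = S := by rw [h1, ← mul_assoc, ← hq, h2]
  have hqS : q * S = S := h2
  have hcomm : ∀ b, Commute b κ → Commute b q := by
    intro b hb
    have hbS : Commute b S := (hb.sub_right (Algebra.commutes a b).symm).pow_right _
    have e1 : (1 - q) * b * q = 0 := by
      calc (1 - q) * b * q = (1 - q) * (b * S) * v := by rw [mul_assoc _ (b * S), mul_assoc b,
            ← hq, mul_assoc]
        _ = (S - q * S) * b * v := by rw [hbS.eq]; noncomm_ring
        _ = 0 := by rw [hqS]; simp
    have e2 : q * b * (1 - q) = 0 := by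
      calc q * b * (1 - q) = v * (b * S) * (1 - q) := by rw [hbS.eq, ← mul_assoc, ← h1]
        _ = v * b * (S - S * q) := by noncomm_ring
        _ = 0 := by rw [hSq]; simp
    have e3 : b * q = q * b * q := by
      rw [sub_mul, sub_mul, one_mul, sub_eq_zero] at e1; exact e1
    have e4 : q * b = q * b * q := by
      rw [mul_sub, mul_one, sub_eq_zero] at e2; exact e2
    exact e3.trans e4.symm
  have hTκ : Commute T κ := ((Commute.refl κ).sub_right (Algebra.commutes a κ).symm).symm
  have hTq : T * q = q * T := hcomm T hTκ
  have hTm : T ^ m * q = q * T ^ m := (show Commute T q from hTq).pow_left m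
  obtain ⟨V, hV⟩ : ∃ V, V = q * T ^ m * v * q := ⟨_, rfl⟩
  obtain ⟨L, hL⟩ : ∃ L, L = q * v * T ^ m * q := ⟨_, rfl⟩
  have hTV : T * V = q := by
    calc T * V = T * q * T ^ m * v * q := by rw [hV]; noncomm_ring
      _ = q * (T * T ^ m) * v * q := by rw [hTq]; noncomm_ring
      _ = q * (S * v) * q := by rw [← pow_succ', ← hS]; noncomm_ring
      _ = q := by rw [← hq, hqq, hqq]
  have hLT : L * T = q := by
    calc L * T = q * v * T ^ m * (q * T) := by rw [hL]; noncomm_ring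
      _ = q * v * (T ^ m * T) * q := by rw [← hTq]; noncomm_ring
      _ = q * (v * S) * q := by rw [← pow_succ, ← hS]; noncomm_ring
      _ = q := by rw [← h1, hqq, hqq]
  have hqV : q * V = V := by rw [hV]; simp only [← mul_assoc]; rw [hqq]
  have hVq : V * q = V := by rw [hV, mul_assoc _ q q, hqq]
  have hLq : L * q = L := by rw [hL, mul_assoc _ q q, hqq]
  have hVL : V = L := by
    calc V = L * T * V := by rw [hLT, hqV]
      _ = L := by rw [mul_assoc, hTV, hLq]
  refine ⟨m + 1, 1 - q, V, ?_, h3, ?_, ?_, ?_, ?_, ?_, ?_⟩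
  · rw [mul_sub, sub_mul, sub_mul, hqq]; simp
  · rw [← hS, mul_sub, hSq, mul_one, sub_self]
  · rw [hVL, hLT]; simp
  · rw [hTV]; simp
  · rw [mul_sub, hVq]; simp
  · rw [sub_mul, hqV]; simp
  · intro b hb
    exact (Commute.one_right b).sub_right (hcomm b hb)

/-- The spectral projection of a compact operator at a nonzero point. -/
theorem exists_spectral_idempotent {κ : X →L[ℂ] X} (hκ : IsCompactOperator κ) {a : ℂ}
    (ha : a ≠ 0) : ∃ (m : ℕ) (p : X →L[ℂ] X), p * p = p ∧
      FiniteDimensional ℂ p.range ∧ (κ - algebraMap ℂ _ a) ^ m * p = 0 ∧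
      (∀ c l : ℂ, l ∈ spectrum ℂ ((κ - algebraMap ℂ _ c) * (1 - p)) → l ≠ 0 →
        l + c ∈ spectrum ℂ κ ∧ l + c ≠ a) ∧
      ∀ b, Commute b κ → Commute b p := by
  obtain ⟨m, p, V, hpp, hfd, hnil, hVT, hTV, hVp, hpV, hcomm⟩ := exists_riesz_idempotent hκ ha
  refine ⟨m, p, hpp, hfd, hnil, ?_, hcomm⟩
  intro c l hl hl0
  have hκp : κ * p = p * κ := hcomm κ (Commute.refl κ)
  have hid : algebraMap ℂ (X →L[ℂ] X) l - (κ - algebraMap ℂ _ c) * (1 - p) =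
      l • p + (algebraMap ℂ _ (l + c) - κ) * (1 - p) := by
    simp only [Algebra.algebraMap_eq_smul_one, mul_sub, sub_mul, mul_one, smul_mul_assoc, one_mul,
      add_smul, add_mul]
    abel
  by_contra hcon
  rw [spectrum.mem_iff, hid] at hl
  apply hl
  have hpq : p * (1 - p) = 0 := by rw [mul_sub, hpp]; simp
  have hqp : (1 - p) * p = 0 := by rw [sub_mul, hpp]; simp
  have hqq : (1 - p) * (1 - p) = 1 - p := by rw [mul_sub, hqp]; simp
  by_cases h : l + c = a
  · rw [h]
    set T := κ - algebraMap ℂ (X →L[ℂ] X) a with hT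
    have e : algebraMap ℂ (X →L[ℂ] X) a - κ = -T := by rw [hT]; abel
    have hTp : T * p = p * T := by
      rw [hT, sub_mul, mul_sub, hκp, Algebra.commutes a p]
    rw [e]
    have e1 : (l • p + -T * (1 - p)) * (l⁻¹ • p - V) = 1 := by
      have : T * (1 - p) * V = 1 - p := by
        rw [mul_assoc, sub_mul 1 p V, hpV, one_mul, sub_zero, hTV]
      rw [add_mul, mul_sub, mul_sub, smul_mul_smul_comm, hpp, smul_mul_assoc, hpV, mul_smul_comm,
        neg_mul, neg_mul, mul_assoc, hqp, neg_mul, this]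
      simp [hl0]
    have e2 : (l⁻¹ • p - V) * (l • p + -T * (1 - p)) = 1 := by
      have h3 : p * (-T * (1 - p)) = 0 := by
        rw [neg_mul, mul_neg, ← mul_assoc, ← hTp, mul_assoc, hpq]; simp
      have h4 : V * (-T * (1 - p)) = -(1 - p) := by
        rw [neg_mul, mul_neg, ← mul_assoc, hVT, hqq]
      rw [sub_mul, mul_add, mul_add, smul_mul_smul_comm, hpp, smul_mul_assoc, h3, mul_smul_comm,
        hVp, h4]
      simp [hl0]
    exact ⟨⟨_, _, e1, e2⟩, rfl⟩
  · have h' : l + c ∉ spectrum ℂ κ := fun h' => hcon ⟨h', h⟩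
    rw [spectrum.mem_iff, not_not] at h'
    obtain ⟨u, hu⟩ := h'
    rw [← hu]
    have hup : (u : X →L[ℂ] X) * p = p * u := by
      rw [hu, sub_mul, mul_sub, hκp, Algebra.commutes _ p]
    set w : X →L[ℂ] X := ↑u⁻¹ with hw
    have huw : (u : X →L[ℂ] X) * w = 1 := Units.mul_inv u
    have hwu : w * (u : X →L[ℂ] X) = 1 := Units.inv_mul u
    have hwp : w * p = p * w := by
      calc w * p = w * (p * u) * w := by rw [mul_assoc, mul_assoc, huw, mul_one]
        _ = (w * u) * p * w := by rw [← hup]; noncomm_ring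
        _ = p * w := by rw [hwu, one_mul]
    have e1 : (l • p + u * (1 - p)) * (l⁻¹ • p + w * (1 - p)) = 1 := by
      have h1 : (u : X →L[ℂ] X) * (1 - p) * (w * (1 - p)) = 1 - p := by
        have : (1 - p) * w = w * (1 - p) := by rw [mul_sub, sub_mul, hwp]; simp
        rw [mul_assoc, ← mul_assoc (1 - p) w, this, mul_assoc w, hqq, ← mul_assoc, huw, one_mul]
      have h2 : p * (w * (1 - p)) = 0 := by rw [← mul_assoc, ← hwp, mul_assoc, hpq, mul_zero]
      rw [add_mul, mul_add, mul_add, smul_mul_smul_comm, hpp, smul_mul_assoc, h2, h1, mul_smul_comm,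
        mul_assoc, hqp]
      simp [hl0]
    have e2 : (l⁻¹ • p + w * (1 - p)) * (l • p + u * (1 - p)) = 1 := by
      have h1 : w * (1 - p) * ((u : X →L[ℂ] X) * (1 - p)) = 1 - p := by
        have : (1 - p) * (u : X →L[ℂ] X) = u * (1 - p) := by rw [mul_sub, sub_mul, hup]; simp
        rw [mul_assoc, ← mul_assoc (1 - p) _, this, mul_assoc _ _ (1 - p), hqq, ← mul_assoc, hwu,
          one_mul]
      have h2 : p * ((u : X →L[ℂ] X) * (1 - p)) = 0 := by
        rw [← mul_assoc, ← hup, mul_assoc, hpq, mul_zero]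
      rw [add_mul, mul_add, mul_add, smul_mul_smul_comm, hpp, smul_mul_assoc, h2, h1, mul_smul_comm,
        mul_assoc, hqp]
      simp [hl0]
    exact ⟨⟨_, _, e1, e2⟩, rfl⟩

end RieszIdempotent

section FiniteRank

variable {X : Type*} [NormedAddCommGroup X] [NormedSpace ℂ X]

/-- Bounded operators with finite-dimensional range. -/
def IsFiniteRank (T : X →L[ℂ] X) : Prop := FiniteDimensional ℂ T.range

theorem isFiniteRank_zero : IsFiniteRank (0 : X →L[ℂ] X) := by
  have : (0 : X →L[ℂ] X).range = ⊥ := by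
    rw [eq_bot_iff]; rintro _ ⟨x, rfl⟩; simp
  unfold IsFiniteRank
  rw [this]; infer_instance

theorem IsFiniteRank.add {S T : X →L[ℂ] X} (hS : IsFiniteRank S) (hT : IsFiniteRank T) :
    IsFiniteRank (S + T) := by
  unfold IsFiniteRank at *
  refine Submodule.finiteDimensional_of_le (S₂ := S.range ⊔ T.range) ?_
  rintro _ ⟨x, rfl⟩
  exact Submodule.add_mem_sup ⟨x, rfl⟩ ⟨x, rfl⟩

theorem IsFiniteRank.smul {S : X →L[ℂ] X} (hS : IsFiniteRank S) (c : ℂ) :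
    IsFiniteRank (c • S) := by
  unfold IsFiniteRank at *
  refine Submodule.finiteDimensional_of_le (S₂ := S.range) ?_
  rintro _ ⟨x, rfl⟩
  exact ⟨c • x, by simp⟩

theorem IsFiniteRank.neg {S : X →L[ℂ] X} (hS : IsFiniteRank S) : IsFiniteRank (-S) := by
  simpa using hS.smul (-1)

theorem IsFiniteRank.sub {S T : X →L[ℂ] X} (hS : IsFiniteRank S) (hT : IsFiniteRank T) :
    IsFiniteRank (S - T) := by
  rw [sub_eq_add_neg]; exact hS.add hT.neg

theorem IsFiniteRank.mul_left {S : X →L[ℂ] X} (hS : IsFiniteRank S) (T : X →L[ℂ] X) :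
    IsFiniteRank (T * S) := by
  unfold IsFiniteRank at *
  refine Submodule.finiteDimensional_of_le (S₂ := S.range.map (T : X →ₗ[ℂ] X)) ?_
  rintro _ ⟨x, rfl⟩
  exact ⟨S x, ⟨x, rfl⟩, rfl⟩

theorem IsFiniteRank.mul_right {S : X →L[ℂ] X} (hS : IsFiniteRank S) (T : X →L[ℂ] X) :
    IsFiniteRank (S * T) := by
  unfold IsFiniteRank at *
  refine Submodule.finiteDimensional_of_le (S₂ := S.range) ?_
  rintro _ ⟨x, rfl⟩
  exact ⟨T x, rfl⟩

end FiniteRank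

section CompactSpectrum

variable {X : Type*} [NormedAddCommGroup X] [NormedSpace ℂ X] [CompleteSpace X]

theorem exists_eigenvector {κ : X →L[ℂ] X} (hκ : IsCompactOperator κ) {z : ℂ} (hz : z ≠ 0)
    (h : z ∈ spectrum ℂ κ) : ∃ x, x ≠ 0 ∧ κ x = z • x := by
  have := (hκ.hasEigenvalue_iff_mem_spectrum hz).mpr h
  obtain ⟨x, hx⟩ := this.exists_hasEigenvector
  exact ⟨x, hx.2, hx.apply_eq_smul⟩

omit [CompleteSpace X] in
theorem mem_spectrum_of_eigenvector {T : X →L[ℂ] X} {z : ℂ} {x : X} (hx : x ≠ 0)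
    (h : T x = z • x) : z ∈ spectrum ℂ T := by
  rw [spectrum.mem_iff]
  rintro ⟨u, hu⟩
  apply hx
  have h1 : (u : X →L[ℂ] X) x = 0 := by
    rw [hu, sub_apply, Algebra.algebraMap_eq_smul_one, smul_apply, one_apply_eq_self, h, sub_self]
  calc x = ((↑u⁻¹ : X →L[ℂ] X) * u) x := by rw [Units.inv_mul]; rfl
    _ = 0 := by rw [mul_apply_eq_comp, h1, map_zero]

/-- Nonzero points of the spectrum of a compact operator are isolated. -/
theorem exists_isolating_radius {κ : X →L[ℂ] X} (hκ : IsCompactOperator κ) {a : ℂ} (ha : a ≠ 0) :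
    ∃ r > 0, ∀ z ∈ spectrum ℂ κ, z ≠ a → r ≤ ‖z - a‖ := by
  obtain ⟨m, p, hpp, hfd, hnil, hspec, hcomm⟩ := exists_spectral_idempotent hκ ha
  have hκp : κ * p = p * κ := hcomm κ (Commute.refl κ)
  have ha' : a ∉ spectrum ℂ (κ * (1 - p)) := by
    intro h
    have := (hspec 0 a (by simpa using h) ha).2
    simp at this
  have hopen : IsOpen (spectrum ℂ (κ * (1 - p)))ᶜ := (spectrum.isClosed _).isOpen_compl
  obtain ⟨r, hr, hball⟩ := Metric.isOpen_iff.mp hopen a ha'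
  refine ⟨min r ‖a‖, lt_min hr (by positivity), fun z hz hza => ?_⟩
  by_contra! hlt
  have hz0 : z ≠ 0 := by
    rintro rfl
    have := hlt.trans_le (min_le_right _ _)
    simp at this
  obtain ⟨x, hx, hxz⟩ := exists_eigenvector hκ hz0 hz
  have hpx : κ (p x) = z • p x := by
    rw [← mul_apply_eq_comp, hκp, mul_apply_eq_comp, hxz, map_smul]
  have hpow : ∀ n : ℕ, ((κ - algebraMap ℂ _ a) ^ n) (p x) = (z - a) ^ n • p x := by
    intro n
    induction n with
    | zero => simp
    | succ n ih =>
      rw [pow_succ, mul_apply_eq_comp, sub_apply, hpx, Algebra.algebraMap_eq_smul_one, smul_apply,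
        one_apply_eq_self, ← sub_smul, map_smul, ← Algebra.algebraMap_eq_smul_one, ih, smul_smul,
        pow_succ']
  have h0 : (z - a) ^ m • p x = 0 := by
    rw [← hpow, ← mul_apply_eq_comp, hnil]; rfl
  have hpx0 : p x = 0 := (smul_eq_zero.mp h0).resolve_left (pow_ne_zero _ (sub_ne_zero.mpr hza))
  have : z ∈ spectrum ℂ (κ * (1 - p)) := by
    refine mem_spectrum_of_eigenvector hx ?_
    rw [mul_apply_eq_comp, sub_apply, hpx0, one_apply_eq_self, sub_zero, hxz]
  refine hball ?_ this
  rw [Metric.mem_ball, dist_eq_norm]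
  exact hlt.trans_le (min_le_left _ _)

theorem finite_spectrum_norm_ge {κ : X →L[ℂ] X} (hκ : IsCompactOperator κ) {η : ℝ} (hη : 0 < η) :
    {z ∈ spectrum ℂ κ | η ≤ ‖z‖}.Finite := by
  by_contra hinf
  have hK : IsCompact {z ∈ spectrum ℂ κ | η ≤ ‖z‖} :=
    (spectrum.isCompact κ).inter_right (isClosed_le continuous_const continuous_norm)
  obtain ⟨a, haK, hacc⟩ := Set.Infinite.exists_accPt_of_subset_isCompact hinf hK subset_rfl
  have ha0 : a ≠ 0 := by rintro rfl; have := haK.2; simp at this; linarith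
  obtain ⟨r, hr, h⟩ := exists_isolating_radius hκ ha0
  rw [accPt_iff_nhds] at hacc
  obtain ⟨y, ⟨hy1, hy2⟩, hy3⟩ := hacc _ (Metric.ball_mem_nhds a hr)
  rw [Metric.mem_ball, dist_eq_norm] at hy1
  linarith [h y hy2.1 hy3]

theorem exists_idempotent_avoiding {κ : X →L[ℂ] X} (hκ : IsCompactOperator κ) (F : Finset ℂ)
    (hF : ∀ a ∈ F, a ≠ 0) : ∃ e : X →L[ℂ] X, e * e = e ∧ IsFiniteRank e ∧
      (∀ b, Commute b κ → Commute b e) ∧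
      ∀ z ∈ spectrum ℂ (κ * (1 - e)), z ≠ 0 → z ∈ spectrum ℂ κ ∧ z ∉ F := by
  classical
  induction F using Finset.induction_on with
  | empty => exact ⟨0, by simp, isFiniteRank_zero, fun b _ => Commute.zero_right b,
    by simpa using fun z hz _ => hz⟩
  | insert a F ha ih =>
    obtain ⟨e, hee, hfr, hcomm, hspec⟩ := ih fun b hb => hF b (Finset.mem_insert_of_mem hb)
    have hκe : Commute κ e := hcomm κ (Commute.refl κ)
    have hκ1 : IsCompactOperator (κ * (1 - e) : X →L[ℂ] X) := hκ.comp_clm (1 - e)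
    obtain ⟨m, p, hpp, hfd, hnil, hsp, hpc⟩ := exists_spectral_idempotent hκ1
      (hF a (Finset.mem_insert_self a F))
    have hb1 : ∀ b, Commute b κ → Commute b p := fun b hb =>
      hpc b (hb.mul_right ((Commute.one_right b).sub_right (hcomm b hb)))
    have hpe : Commute p e := hcomm p (hb1 κ (Commute.refl κ)).symm
    refine ⟨1 - (1 - e) * (1 - p), ?_, ?_, ?_, ?_⟩
    · have h1 : (1 - e) * (1 - p) * ((1 - e) * (1 - p)) = (1 - e) * (1 - p) := by
        have hc : (1 - p) * (1 - e) = (1 - e) * (1 - p) :=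
          ((Commute.one_left _).sub_left ((Commute.one_right _).sub_right hpe)).eq
        have hp1 : (1 - p) * (1 - p) = 1 - p := by rw [mul_sub, sub_mul, sub_mul, hpp]; simp
        have he1 : (1 - e) * (1 - e) = 1 - e := by rw [mul_sub, sub_mul, sub_mul, hee]; simp
        calc _ = (1 - e) * ((1 - p) * (1 - e)) * (1 - p) := by noncomm_ring
          _ = ((1 - e) * (1 - e)) * ((1 - p) * (1 - p)) := by rw [hc]; noncomm_ring
          _ = _ := by rw [hp1, he1]
      generalize (1 - e) * (1 - p) = q at h1 ⊢
      rw [mul_sub, sub_mul, sub_mul, h1]; simp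
    · have : 1 - (1 - e) * (1 - p) = e + (1 - e) * p := by noncomm_ring
      rw [this]
      exact hfr.add (IsFiniteRank.mul_left hfd _)
    · intro b hb
      exact (Commute.one_right b).sub_right
          (((Commute.one_right b).sub_right (hcomm b hb)).mul_right
        ((Commute.one_right b).sub_right (hb1 b hb)))
    · intro z hz hz0
      rw [sub_sub_cancel, ← mul_assoc] at hz
      have h1 := hsp 0 z (by simpa using hz) hz0
      rw [add_zero] at h1
      have h2 := hspec z h1.1 hz0
      exact ⟨h2.1, by simp [h2.2, h1.2]⟩

/-- Up to a finite-rank spectral projection a compact operator is as small as desired. -/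
theorem exists_idempotent_powGrowth {κ : X →L[ℂ] X} (hκ : IsCompactOperator κ) {η : ℝ}
    (hη : 0 < η) : ∃ e : X →L[ℂ] X, e * e = e ∧ IsFiniteRank e ∧
      (∀ b, Commute b κ → Commute b e) ∧ PowGrowth (κ * (1 - e)) η := by
  obtain ⟨e, h1, h2, h3, h4⟩ := exists_idempotent_avoiding hκ
      (finite_spectrum_norm_ge hκ hη).toFinset
    (by
      intro a ha
      rw [Set.Finite.mem_toFinset] at ha
      rintro rfl
      have := ha.2
      simp at this; linarith)
  refine ⟨e, h1, h2, h3, ?_⟩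
  obtain ⟨s, hs0, hs, hg⟩ := powGrowth_of_spectrum (a := κ * (1 - e)) hη (by
    intro z hz
    by_cases hz0 : z = 0
    · simpa [hz0] using hη
    have := h4 z hz hz0
    rw [Set.Finite.mem_toFinset] at this
    by_contra! hge
    exact this.2 ⟨this.1, hge⟩)
  exact hg.mono hs0.le hs.le

/-- Nonzero spectral points of a compact operator survive small perturbations. -/
theorem eventually_exists_spectrum_near {κ : X →L[ℂ] X} (hκ : IsCompactOperator κ) {a : ℂ}
    (ha : a ≠ 0) (h : a ∈ spectrum ℂ κ) {ε : ℝ} (hε : 0 < ε) :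
    ∀ᶠ S in 𝓝 κ, ∃ m ∈ spectrum ℂ S, ‖m - a‖ ≤ ε := by
  obtain ⟨r, hr, hiso⟩ := exists_isolating_radius hκ ha
  have hpos : 0 < min ε (r / 2) := lt_min hε (by positivity)
  refine (spectrum_eventually_exists_mem_closedBall (r := min ε (r / 2)) hpos h ?_).mono ?_
  · intro z hz hzs
    rw [mem_sphere_iff_norm] at hz
    have hza : z ≠ a := by rintro rfl; simp at hz; linarith
    have := hiso z hzs hza
    have := min_le_right ε (r / 2)
    linarith
  · rintro S ⟨m, hm, h⟩
    exact ⟨m, hm, h.trans (min_le_left _ _)⟩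

/-- Submultiplicativity of the spectrum passes to norm closures, up to zero. -/
theorem spectrum_mul_of_mem_closure {J : Set (X →L[ℂ] X)}
    (hc : ∀ A ∈ J, IsCompactOperator A)
    (hs : ∀ A ∈ J, ∀ B ∈ J, ∀ mu ∈ spectrum ℂ (A * B),
      ∃ α ∈ spectrum ℂ A, ∃ β ∈ spectrum ℂ B, mu = α * β)
    {A B : X →L[ℂ] X} (hA : A ∈ closure J) (hB : B ∈ closure J) {mu : ℂ}
    (hmu : mu ∈ spectrum ℂ (A * B)) (hmu0 : mu ≠ 0) :
    ∃ α ∈ spectrum ℂ A, ∃ β ∈ spectrum ℂ B, mu = α * β := by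
  obtain ⟨u, huJ, hu⟩ := mem_closure_iff_seq_limit.mp hA
  obtain ⟨v, hvJ, hv⟩ := mem_closure_iff_seq_limit.mp hB
  have hAc : IsCompactOperator A := isCompactOperator_of_tendsto hu
    (Eventually.of_forall fun n => hc _ (huJ n))
  have hABc : IsCompactOperator (A * B : X →L[ℂ] X) := hAc.comp_clm B
  have huv : Tendsto (fun n => u n * v n) atTop (𝓝 (A * B)) := hu.mul hv
  have hex : ∀ k : ℕ, ∃ n ≥ k, ∃ m ∈ spectrum ℂ (u n * v n), ‖m - mu‖ ≤ 1 / ((k : ℝ) + 1) := by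
    intro k
    have := (huv.eventually (eventually_exists_spectrum_near hABc hmu0 hmu
      (ε := 1 / ((k : ℝ) + 1)) (by positivity))).and (eventually_ge_atTop k)
    obtain ⟨n, ⟨m, hm, hmn⟩, hk⟩ := this.exists
    exact ⟨n, hk, m, hm, hmn⟩
  choose n hn m hm hmn using hex
  have hntop : Tendsto n atTop atTop := tendsto_atTop_mono hn tendsto_id
  choose α hα β hβ hαβ using fun k => hs _ (huJ (n k)) _ (hvJ (n k)) _ (hm k)
  have hmlim : Tendsto m atTop (𝓝 mu) := by
    rw [tendsto_iff_norm_sub_tendsto_zero]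
    exact squeeze_zero (fun _ => norm_nonneg _) hmn tendsto_one_div_add_atTop_nhds_zero_nat
  have hbdd : ∀ w : ℕ → X →L[ℂ] X, ∀ W, Tendsto w atTop (𝓝 W) → ∀ γ : ℕ → ℂ,
      (∀ k, γ k ∈ spectrum ℂ (w (n k))) → ∃ R, ∀ k, γ k ∈ Metric.closedBall (0 : ℂ) R := by
    intro w W hw γ hγ
    obtain ⟨R, hR⟩ := hw.norm.bddAbove_range
    refine ⟨R * ‖(1 : X →L[ℂ] X)‖, fun k => ?_⟩
    rw [mem_closedBall_zero_iff]
    refine (spectrum.norm_le_norm_mul_of_mem (hγ k)).trans ?_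
    gcongr
    exact hR ⟨n k, rfl⟩
  have hclosed : ∀ w : ℕ → X →L[ℂ] X, ∀ W, Tendsto w atTop (𝓝 W) → ∀ γ : ℕ → ℂ, ∀ g,
      (∀ k, γ k ∈ spectrum ℂ (w k)) → Tendsto γ atTop (𝓝 g) → g ∈ spectrum ℂ W := by
    intro w W hw γ g hγ hg
    rw [spectrum.mem_iff]
    intro hunit
    have hlim : Tendsto (fun k => algebraMap ℂ (X →L[ℂ] X) (γ k) - w k) atTop
        (𝓝 (algebraMap ℂ _ g - W)) :=
      (((algebraMapCLM ℂ (X →L[ℂ] X)).continuous.tendsto g).comp hg).sub hw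
    obtain ⟨k, hk⟩ := (hlim.eventually (Units.isOpen.mem_nhds hunit)).exists
    exact hγ k hk
  obtain ⟨R1, hR1⟩ := hbdd u A hu α hα
  obtain ⟨R2, hR2⟩ := hbdd v B hv β hβ
  obtain ⟨a, -, φ, hφ, ha⟩ := (isCompact_closedBall (0 : ℂ) R1).tendsto_subseq hR1
  obtain ⟨b, -, ψ, hψ, hb⟩ := (isCompact_closedBall (0 : ℂ) R2).tendsto_subseq (fun k => hR2 (φ k))
  have hsub : Tendsto (fun k => φ (ψ k)) atTop atTop := hφ.tendsto_atTop.comp hψ.tendsto_atTop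
  have ha' := ha.comp hψ.tendsto_atTop
  refine ⟨a, hclosed _ A (hu.comp (hntop.comp hsub)) _ a (fun k => hα (φ (ψ k))) ha',
    b, hclosed _ B (hv.comp (hntop.comp hsub)) _ b (fun k => hβ (φ (ψ k))) hb, ?_⟩
  refine tendsto_nhds_unique (hmlim.comp hsub) ?_
  refine (ha'.mul hb).congr fun k => ?_
  exact (hαβ _).symm

end CompactSpectrum

section Words

variable {ι : Type*} {R : Type*} [Monoid R]

/-- The product of the letters of a word. -/
def wordProd (a : ι → R) (w : List ι) : R := (w.map a).prod

@[simp] theorem wordProd_nil (a : ι → R) : wordProd a [] = 1 := rfl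

@[simp] theorem wordProd_cons (a : ι → R) (i : ι) (w : List ι) :
    wordProd a (i :: w) = a i * wordProd a w := by simp [wordProd]

@[simp] theorem wordProd_append (a : ι → R) (v w : List ι) :
    wordProd a (v ++ w) = wordProd a v * wordProd a w := by simp [wordProd]

theorem exists_word_ends {w : List ι} (hw : 2 ≤ w.length) :
    ∃ x y, ∃ m : List ι, w = x :: (m ++ [y]) := by
  match w with
  | [] => simp at hw
  | x :: t =>
    have ht : t ≠ [] := by rintro rfl; simp at hw
    exact ⟨x, t.getLast ht, t.dropLast, by rw [List.dropLast_append_getLast ht]⟩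

end Words

section Precompact

variable {X : Type*} [NormedAddCommGroup X] [NormedSpace ℂ X]

theorem totallyBounded_mul_mul {a b : X →L[ℂ] X} (ha : IsCompactOperator a)
    (hb : IsCompactOperator b) (D : ℝ) :
    TotallyBounded ((fun T : X →L[ℂ] X => a * T * b) '' {T | ‖T‖ ≤ D}) := by
  refine Metric.totallyBounded_of_finite_discretization fun ε hε => ?_
  obtain ⟨Kb, hKb, hKbs⟩ := IsCompactOperator.image_closedBall_subset_compact
    (f := (b : X →ₗ[ℂ] X)) hb 1
  obtain ⟨δ, hδ, hδε⟩ : ∃ δ > 0, 2 * (‖a‖ * (|D| * δ)) + 2 * δ < ε := by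
    refine ⟨ε / (2 * (2 * (‖a‖ * |D|) + 2)), by positivity, ?_⟩
    have h0 : 0 < 2 * (‖a‖ * |D|) + 2 := by positivity
    have : 2 * (‖a‖ * (|D| * (ε / (2 * (2 * (‖a‖ * |D|) + 2))))) +
      2 * (ε / (2 * (2 * (‖a‖ * |D|) + 2))) = ε / 2 := by field_simp
    linarith
  obtain ⟨s, -, hsf, hs⟩ := Metric.finite_approx_of_totallyBounded hKb.totallyBounded δ hδ
  obtain ⟨Rad, hRad⟩ := hsf.isBounded.exists_norm_le
  obtain ⟨Ka, hKa, hKas⟩ := IsCompactOperator.image_closedBall_subset_compact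
    (f := (a : X →ₗ[ℂ] X)) ha (|D| * |Rad|)
  obtain ⟨t, -, htf, ht⟩ := Metric.finite_approx_of_totallyBounded hKa.totallyBounded δ hδ
  have hnet : ∀ T : {T : X →L[ℂ] X | ‖T‖ ≤ D}, ∀ y : s, ∃ z : t, ‖a (T.1 y) - z‖ < δ := by
    intro T y
    have hT : ‖T.1‖ ≤ |D| := T.2.trans (le_abs_self D)
    have h1 : ‖T.1 y‖ ≤ |D| * |Rad| := (T.1.le_opNorm _).trans
      (mul_le_mul hT ((hRad y y.2).trans (le_abs_self _)) (norm_nonneg _) (abs_nonneg _))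
    have h2 : a (T.1 y) ∈ Ka := hKas ⟨T.1 y, by simpa using h1, rfl⟩
    obtain ⟨z, hz, hz2⟩ := Set.mem_iUnion₂.mp (ht h2)
    exact ⟨⟨z, hz⟩, by simpa [dist_eq_norm] using hz2⟩
  choose F hF using hnet
  have : Fintype s := hsf.fintype
  have : Fintype t := htf.fintype
  classical
  choose G hG1 hG2 using fun S : ((fun T : X →L[ℂ] X => a * T * b) '' {T | ‖T‖ ≤ D}) => S.2
  refine ⟨s → t, inferInstance, fun S => F ⟨G S, hG1 S⟩, fun S S' hSS' => ?_⟩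
  have hest : ∀ x : X, ‖x‖ ≤ 1 → ‖(S.1 - S'.1) x‖ ≤ 2 * (‖a‖ * (|D| * δ)) + 2 * δ := by
    intro x hx
    have h2 : b x ∈ Kb := hKbs ⟨x, by simpa using hx, rfl⟩
    obtain ⟨y, hy, hy2⟩ := Set.mem_iUnion₂.mp (hs h2)
    rw [Metric.mem_ball, dist_eq_norm] at hy2
    have e1 := hF ⟨G S, hG1 S⟩ ⟨y, hy⟩
    have e2 := hF ⟨G S', hG1 S'⟩ ⟨y, hy⟩
    have e0 := congrFun hSS' ⟨y, hy⟩
    simp only at e0 e1 e2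
    rw [e0] at e1
    have e3 : ∀ T : X →L[ℂ] X, ‖T‖ ≤ D → ‖a (T (b x - y))‖ ≤ ‖a‖ * (|D| * δ) := by
      intro T hT
      refine (a.le_opNorm _).trans ?_
      gcongr
      exact (T.le_opNorm _).trans
        (mul_le_mul (hT.trans (le_abs_self D)) hy2.le (norm_nonneg _) (abs_nonneg _))
    have e4 := e3 _ (hG1 S)
    have e5 := e3 _ (hG1 S')
    have : (S.1 - S'.1) x = a (G S (b x - y)) - a (G S' (b x - y)) +
        ((a (G S y) - F ⟨G S', hG1 S'⟩ ⟨y, hy⟩) - (a (G S' y) - F ⟨G S', hG1 S'⟩ ⟨y, hy⟩)) := by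
      have h1 : S.1 x = a (G S (b x)) := by rw [← hG2 S]; rfl
      have h2 : S'.1 x = a (G S' (b x)) := by rw [← hG2 S']; rfl
      rw [sub_apply, h1, h2]
      simp only [map_sub]; abel
    rw [this]
    refine (norm_add_le _ _).trans ?_
    have := norm_sub_le (a (G S (b x - y))) (a (G S' (b x - y)))
    have := norm_sub_le (a (G S y) - F ⟨G S', hG1 S'⟩ ⟨y, hy⟩)
      (a (G S' y) - F ⟨G S', hG1 S'⟩ ⟨y, hy⟩ : X)
    linarith
  rw [dist_eq_norm]
  refine lt_of_le_of_lt (ContinuousLinearMap.opNorm_le_of_unit_norm (by positivity) ?_) hδε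
  exact fun x hx => hest x hx.le

variable [CompleteSpace X]

theorem exists_isCompact_mul_mul {ι : Type*} [Finite ι] {a : ι → X →L[ℂ] X}
    (ha : ∀ i, IsCompactOperator (a i)) (D : ℝ) :
    ∃ K : Set (X →L[ℂ] X), IsCompact K ∧ ∀ x y T, ‖T‖ ≤ D → a x * T * a y ∈ K := by
  refine ⟨⋃ p : ι × ι, closure ((fun T : X →L[ℂ] X => a p.1 * T * a p.2) '' {T | ‖T‖ ≤ D}),
    isCompact_iUnion fun p => ?_, fun x y T hT => ?_⟩
  · exact (totallyBounded_mul_mul (ha p.1) (ha p.2) D).closure.isCompact_of_isClosed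
      isClosed_closure
  · exact Set.mem_iUnion.mpr ⟨(x, y), subset_closure ⟨T, hT, rfl⟩⟩

end Precompact

section BoundedWords

theorem Ultrafilter.exists_eventually_eq {α β : Type*} [Finite β] (U : Ultrafilter α) (f : α → β) :
    ∃ b, ∀ᶠ x in U, f x = b := by
  have h : (⋃ b ∈ (Set.univ : Set β), f ⁻¹' {b}) ∈ U := by
    have : (⋃ b ∈ (Set.univ : Set β), f ⁻¹' {b}) = Set.univ := by ext x; simp
    rw [this]; exact Filter.univ_mem
  obtain ⟨b, -, hb⟩ := (Ultrafilter.finite_biUnion_mem_iff Set.finite_univ).mp h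
  exact ⟨b, hb⟩

theorem IsCompact.exists_tendsto_ultrafilter {α β : Type*} [TopologicalSpace β] {K : Set β}
    (hK : IsCompact K) (U : Ultrafilter α) {f : α → β} (h : ∀ᶠ x in U, f x ∈ K) :
    ∃ y ∈ K, Tendsto f U (𝓝 y) :=
  hK.ultrafilter_le_nhds (U.map f) (le_principal_iff.mpr h)

theorem exists_limit_word {ι : Type*} [Finite ι] (W : ℕ → List ι) (hW : ∀ n, (W n).length = n) :
    ∃ i : ℕ → ι, ∀ n, ∃ N v, W N = (List.range' 0 n).map i ++ v := by
  have h1 : ∀ k : ℕ, ∃ o, ∀ᶠ n in hyperfilter ℕ, (W n)[k]? = o :=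
    fun k => (hyperfilter ℕ).exists_eventually_eq _
  choose o ho using h1
  have hlarge : ∀ k, ∀ᶠ n in (hyperfilter ℕ : Filter ℕ), k < n := fun k =>
    Nat.hyperfilter_le_atTop (eventually_gt_atTop k)
  have h2 : ∀ k, ∃ i, o k = some i := by
    intro k
    obtain ⟨n, hn, hk⟩ := ((ho k).and (hlarge k)).exists
    refine ⟨(W n)[k]'(by rw [hW]; exact hk), ?_⟩
    rw [← hn]; exact List.getElem?_eq_getElem _
  choose i hi using h2
  refine ⟨i, fun n => ?_⟩
  have h3 : ∀ᶠ N in (hyperfilter ℕ : Filter ℕ), ∀ k ∈ Finset.range n, (W N)[k]? = o k :=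
    (Filter.eventually_all_finset _).mpr fun k _ => ho k
  obtain ⟨N, hN, hk⟩ := (h3.and (hlarge n)).exists
  refine ⟨N, (W N).drop n, ?_⟩
  have : (W N).take n = (List.range' 0 n).map i := by
    refine List.ext_getElem? fun k => ?_
    rw [List.getElem?_take]
    split_ifs with hkn
    · rw [hN k (by simpa using hkn), hi]
      simp [hkn]
    · simp [not_lt.mp hkn]
  rw [← this, List.take_append_drop]

variable {X : Type*} [NormedAddCommGroup X] [NormedSpace ℂ X] [CompleteSpace X]

omit [CompleteSpace X] in
theorem one_mem_spectrum_of_idempotent {q : X →L[ℂ] X} (hq : q * q = q) (h0 : q ≠ 0) :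
    (1 : ℂ) ∈ spectrum ℂ q := by
  obtain ⟨x, hx⟩ : ∃ x, q x ≠ 0 := by
    by_contra! h
    exact h0 (ContinuousLinearMap.ext h)
  refine mem_spectrum_of_eigenvector hx ?_
  rw [one_smul, ← mul_apply_eq_comp, hq]

theorem false_of_bounded_words {ι : Type*} [Finite ι] {a : ι → X →L[ℂ] X}
    (ha : ∀ i, IsCompactOperator (a i))
    (hqn : ∀ w ≠ [], spectrum ℂ (wordProd a w) ⊆ {0}) {C : ℝ} (hC : ∀ w, ‖wordProd a w‖ ≤ C)
    {c : ℝ} (hc : 0 < c) (hlow : ∀ n, ∃ w : List ι, w.length = n ∧ c ≤ ‖wordProd a w‖) : False := by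
  choose W hW hWc using hlow
  obtain ⟨i, hi⟩ := exists_limit_word W hW
  have hCpos : 0 < C := by
    have := hWc 0
    exact lt_of_lt_of_le hc (this.trans (hC _))
  obtain ⟨s, hs⟩ : ∃ s : ℕ → ℕ → X →L[ℂ] X, ∀ m n, s m n = wordProd a ((List.range' m n).map i) :=
    ⟨_, fun _ _ => rfl⟩
  have hadd : ∀ m k n, s m (k + n) = s m k * s (m + k) n := by
    intro m k n
    rw [hs, hs, hs, ← wordProd_append, ← List.map_append, List.range'_append_1]
  have hsC : ∀ m n, ‖s m n‖ ≤ C := fun m n => by rw [hs]; exact hC _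
  have h0 : ∀ n, c / C ≤ ‖s 0 n‖ := by
    intro n
    obtain ⟨N, v, hN⟩ := hi n
    have h1 := hWc N
    rw [hN, wordProd_append, ← hs] at h1
    rw [div_le_iff₀ hCpos]
    exact h1.trans ((norm_mul_le _ _).trans (by gcongr; exact hC v))
  have hlow' : ∀ m n, c / C / C ≤ ‖s m n‖ := by
    intro m n
    have h1 := h0 (m + n)
    rw [hadd, zero_add] at h1
    rw [div_le_iff₀ hCpos, mul_comm]
    exact h1.trans ((norm_mul_le _ _).trans (by gcongr; exact hsC 0 m))
  obtain ⟨K, hK, hKm⟩ := exists_isCompact_mul_mul ha C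
  have hsK : ∀ m n, 2 ≤ n → s m n ∈ K := by
    intro m n hn
    obtain ⟨x, y, v, hv⟩ := exists_word_ends (w := (List.range' m n).map i) (by simpa using hn)
    rw [hs, hv, wordProd_cons, wordProd_append, ← mul_assoc]
    simpa using hKm x y (wordProd a v) (hC v)
  have hlarge : ∀ k, ∀ᶠ n in (hyperfilter ℕ : Filter ℕ), k ≤ n := fun k =>
    Nat.hyperfilter_le_atTop (eventually_ge_atTop k)
  have hq : ∀ m, ∃ q ∈ K, Tendsto (fun n => s m (n - m)) (hyperfilter ℕ) (𝓝 q) := by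
    intro m
    refine hK.exists_tendsto_ultrafilter _ ?_
    filter_upwards [hlarge (m + 2)] with n hn
    exact hsK m _ (by omega)
  choose q hqK hqlim using hq
  obtain ⟨Q, hQK, hQ⟩ : ∃ Q ∈ K, Tendsto q (hyperfilter ℕ) (𝓝 Q) :=
    hK.exists_tendsto_ultrafilter _ (Filter.Eventually.of_forall hqK)
  have h1 : ∀ m m', m ≤ m' → q m = s m (m' - m) * q m' := by
    intro m m' hm
    refine tendsto_nhds_unique (hqlim m) (((hqlim m').const_mul (s m (m' - m))).congr' ?_)
    filter_upwards [hlarge m'] with n hn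
    have := hadd m (m' - m) (n - m')
    rw [show m' - m + (n - m') = n - m by omega, show m + (m' - m) = m' by omega] at this
    exact this.symm
  have h2 : ∀ m, q m = q m * Q := by
    intro m
    refine tendsto_nhds_unique tendsto_const_nhds (((hqlim m).mul hQ).congr' ?_)
    filter_upwards [hlarge m] with n hn
    exact (h1 m n hn).symm
  have h3 : Q * Q = Q :=
    tendsto_nhds_unique (hQ.mul_const Q) (hQ.congr h2)
  have hqlow : ∀ m, c / C / C ≤ ‖q m‖ := fun m =>
    ge_of_tendsto (hqlim m).norm (Filter.Eventually.of_forall fun n => hlow' m _)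
  have hQ0 : Q ≠ 0 := by
    have : c / C / C ≤ ‖Q‖ := ge_of_tendsto hQ.norm (Filter.Eventually.of_forall hqlow)
    rw [← norm_pos_iff]
    exact lt_of_lt_of_le (by positivity) this
  have hcomp : ∀ w : List ι, w ≠ [] → IsCompactOperator (wordProd a w : X →L[ℂ] X) := by
    intro w hw
    obtain ⟨x, t, rfl⟩ := List.exists_cons_of_ne_nil hw
    rw [wordProd_cons]
    exact (ha x).comp_clm (wordProd a t)
  have hclosed : IsClosed {T : X →L[ℂ] X | IsCompactOperator T} :=
      isClosed_setOfPred_isCompactOperator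
  have hne : ∀ m n, m < n → (List.range' m (n - m)).map i ≠ [] := by
    intro m n h; simp; omega
  have hqc : ∀ m, IsCompactOperator (q m) := fun m =>
    hclosed.mem_of_tendsto (hqlim m) (by
      filter_upwards [hlarge (m + 1)] with n hn
      rw [hs]; exact hcomp _ (hne m n hn))
  have hQc : IsCompactOperator Q :=
    hclosed.mem_of_tendsto hQ (Filter.Eventually.of_forall hqc)
  have hnear := eventually_exists_spectrum_near hQc one_ne_zero
    (one_mem_spectrum_of_idempotent h3 hQ0) (ε := 1 / 2) (by norm_num)
  obtain ⟨m, hm⟩ := (hQ.eventually (eventually_eventually_nhds.mpr hnear)).exists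
  obtain ⟨n, hn, hmn⟩ := (((hqlim m).eventually hm).and (hlarge (m + 1))).exists
  obtain ⟨z, hz, hz1⟩ := hn
  rw [hs] at hz
  have hz0 : z = 0 := hqn _ (hne m n hmn) hz
  rw [hz0] at hz1
  norm_num at hz1

end BoundedWords

section UnboundedWords

variable {X : Type*} [NormedAddCommGroup X] [NormedSpace ℂ X]

theorem wordProd_mem {ι : Type*} {a : ι → X →L[ℂ] X} {Z : Submodule ℂ X}
    (hZ : ∀ i, ∀ x ∈ Z, a i x ∈ Z) (w : List ι) {x : X} (hx : x ∈ Z) : wordProd a w x ∈ Z := by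
  induction w with
  | nil => simpa using hx
  | cons i w ih => rw [wordProd_cons, mul_apply_eq_comp]; exact hZ _ _ ih

theorem exists_near_of_length_mul {ι : Type*} {a : ι → X →L[ℂ] X} {Z : Submodule ℂ X}
    (hZ : ∀ i, ∀ x ∈ Z, a i x ∈ Z) {n : ℕ} {θ : ℝ} (hθ : 0 ≤ θ)
    (h : ∀ w : List ι, w.length = n → ∀ x, ∃ z ∈ Z, ‖wordProd a w x - z‖ ≤ θ * ‖x‖) (j : ℕ) :
    ∀ w : List ι, w.length = n * j → ∀ x, ∃ z ∈ Z, ‖wordProd a w x - z‖ ≤ θ ^ j * ‖x‖ := by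
  induction j with
  | zero =>
    intro w hw x
    obtain rfl : w = [] := by simpa using hw
    exact ⟨0, Z.zero_mem, by simp⟩
  | succ j ih =>
    intro w hw x
    obtain ⟨z₂, hz₂, h₂⟩ := ih (w.drop n) (by rw [List.length_drop, hw, Nat.mul_succ]; omega) x
    obtain ⟨z₁, hz₁, h₁⟩ := h (w.take n) (by rw [List.length_take, hw, Nat.mul_succ]; omega)
      (wordProd a (w.drop n) x - z₂)
    refine ⟨z₁ + wordProd a (w.take n) z₂, Z.add_mem hz₁ (wordProd_mem hZ _ hz₂), ?_⟩
    have : wordProd a w x - (z₁ + wordProd a (w.take n) z₂) =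
        wordProd a (w.take n) (wordProd a (w.drop n) x - z₂) - z₁ := by
      conv_lhs => rw [← List.take_append_drop n w]
      rw [wordProd_append, mul_apply_eq_comp, map_sub]; abel_nf
      simp
    rw [this]
    calc _ ≤ _ := h₁
      _ ≤ θ * (θ ^ j * ‖x‖) := by gcongr
      _ = _ := by ring

theorem exists_norm_wordProd_le {ι : Type*} [Finite ι] (a : ι → X →L[ℂ] X) (l : ℕ) :
    ∃ C, ∀ w : List ι, w.length ≤ l → ‖wordProd a w‖ ≤ C := by
  obtain ⟨C, hC⟩ := ((List.finite_length_le ι l).image fun w => ‖wordProd a w‖).bddAbove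
  exact ⟨C, fun w hw => hC ⟨w, hw, rfl⟩⟩

theorem exists_weighted_maximizer {ι : Type*} [Finite ι] [Nontrivial X] {a : ι → X →L[ℂ] X}
    (hG : ∀ r > 1, ∃ C, ∀ w, ‖wordProd a w‖ ≤ C * r ^ w.length) {t : ℝ} (ht0 : 0 < t)
    (ht1 : t < 1) :
    ∃ w, ∀ v, t ^ v.length * ‖wordProd a v‖ ≤ t ^ w.length * ‖wordProd a w‖ := by
  obtain ⟨r, hr1, hr2⟩ := exists_between ((one_lt_inv₀ ht0).mpr ht1)
  obtain ⟨C, hC⟩ := hG r hr1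
  have htr0 : 0 ≤ t * r := by positivity
  have htr : t * r < 1 := by
    rw [lt_inv_comm₀ (by positivity) ht0] at hr2
    calc t * r < r⁻¹ * r := by gcongr
      _ = 1 := inv_mul_cancel₀ (by positivity)
  have hlim : Tendsto (fun n : ℕ => C * (t * r) ^ n) atTop (𝓝 (C * 0)) :=
    (tendsto_pow_atTop_nhds_zero_of_lt_one htr0 htr).const_mul C
  rw [mul_zero] at hlim
  obtain ⟨N, hN⟩ := eventually_atTop.mp (hlim.eventually (gt_mem_nhds one_pos))
  obtain ⟨w, -, hw⟩ := Set.exists_max_image {w : List ι | w.length ≤ N}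
    (fun v => t ^ v.length * ‖wordProd a v‖) (List.finite_length_le ι N) ⟨[], by simp⟩
  refine ⟨w, fun v => ?_⟩
  rcases le_or_gt v.length N with h | h
  · exact hw v h
  · have h1 := hw [] (by simp)
    simp only [List.length_nil, pow_zero, wordProd_nil, norm_one, mul_one] at h1
    refine le_trans ?_ h1
    calc _ ≤ t ^ v.length * (C * r ^ v.length) := by gcongr; exact hC v
      _ = C * (t * r) ^ v.length := by rw [mul_pow]; ring
      _ ≤ 1 := (hN _ h.le).le

variable [CompleteSpace X]

theorem false_of_unbounded_words {ι : Type*} [Finite ι] {a : ι → X →L[ℂ] X}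
    (ha : ∀ i, IsCompactOperator (a i))
    (hG : ∀ r > 1, ∃ C, ∀ w, ‖wordProd a w‖ ≤ C * r ^ w.length)
    (hunb : ∀ C, ∃ w, C < ‖wordProd a w‖)
    (hmin : ∀ Z : Submodule ℂ X, IsClosed (Z : Set X) → (∀ i, ∀ x ∈ Z, a i x ∈ Z) → Z ≠ ⊥ →
      ∃ (n : ℕ) (θ : ℝ), 0 ≤ θ ∧ θ < 1 ∧ ∀ w : List ι, w.length = n → ∀ x, ∃ z ∈ Z,
        ‖wordProd a w x - z‖ ≤ θ * ‖x‖) : False := by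
  have hnt : Nontrivial X := by
    by_contra h
    rw [not_nontrivial_iff_subsingleton] at h
    obtain ⟨w, hw⟩ := hunb 0
    rw [norm_pos_iff] at hw
    exact hw (ContinuousLinearMap.ext fun x => Subsingleton.elim _ _)
  obtain ⟨t, ht0, ht1, htl⟩ : ∃ t : ℕ → ℝ, (∀ k, 0 < t k) ∧ (∀ k, t k < 1) ∧
      Tendsto t atTop (𝓝 1) := by
    obtain ⟨u, -, hu, hul⟩ := exists_seq_strictMono_tendsto' (show (0 : ℝ) < 1 by norm_num)
    exact ⟨u, fun k => (hu k).1, fun k => (hu k).2, hul⟩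
  choose w hw using fun k => exists_weighted_maximizer hG (ht0 k) (ht1 k)
  have hUle : (hyperfilter ℕ : Filter ℕ) ≤ atTop := Nat.hyperfilter_le_atTop
  have hinf : Tendsto (fun k => ‖wordProd a (w k)‖) atTop atTop := by
    rw [tendsto_atTop]
    intro M
    obtain ⟨v, hv⟩ := hunb M
    have h1 : Tendsto (fun k => t k ^ v.length * ‖wordProd a v‖) atTop
        (𝓝 (1 ^ v.length * ‖wordProd a v‖)) := (htl.pow _).mul_const _
    rw [one_pow, one_mul] at h1
    filter_upwards [h1.eventually (lt_mem_nhds hv)] with k hk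
    exact (hk.le.trans (hw k v)).trans
      (mul_le_of_le_one_left (norm_nonneg _) (pow_le_one₀ (ht0 k).le (ht1 k).le))
  have hlen : ∀ l, ∀ᶠ k in (hyperfilter ℕ : Filter ℕ), l ≤ (w k).length := by
    intro l
    obtain ⟨C, hC⟩ := exists_norm_wordProd_le a l
    filter_upwards [hUle (hinf.eventually (eventually_gt_atTop C))] with k hk
    by_contra! h
    exact absurd (hC _ h.le) (not_le.mpr hk)
  have hpos : ∀ k, 0 < ‖wordProd a (w k)‖ := by
    intro k
    have := hw k []
    simp only [List.length_nil, pow_zero, wordProd_nil, norm_one, mul_one] at this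
    by_contra! h
    have h0 := le_antisymm h (norm_nonneg _)
    rw [h0] at this; simp at this
    linarith
  have hsub : ∀ k v, v.length ≤ (w k).length → ‖wordProd a v‖ ≤ ‖wordProd a (w k)‖ := by
    intro k v hv
    have h1 := hw k v
    have h2 : t k ^ (w k).length ≤ t k ^ v.length :=
      pow_le_pow_of_le_one (ht0 k).le (ht1 k).le hv
    have h3 : 0 < t k ^ v.length := pow_pos (ht0 k) _
    exact le_of_mul_le_mul_left (h1.trans (by gcongr)) h3
  obtain ⟨c, hc⟩ : ∃ c : ℕ → ℂ, ∀ k, c k = ((‖wordProd a (w k)‖⁻¹ : ℝ) : ℂ) := ⟨_, fun _ => rfl⟩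
  have hcn : ∀ k, ‖c k‖ = ‖wordProd a (w k)‖⁻¹ := by
    intro k; rw [hc, Complex.norm_real, norm_inv, norm_norm]
  obtain ⟨K, hK, hKm⟩ := exists_isCompact_mul_mul ha 1
  have hmem : ∀ k v, 2 ≤ v.length → v.length ≤ (w k).length → c k • wordProd a v ∈ K := by
    intro k v h2 hv
    obtain ⟨x, y, m, rfl⟩ := exists_word_ends h2
    have : c k • wordProd a (x :: (m ++ [y])) = a x * (c k • wordProd a m) * a y := by
      simp [mul_assoc]
    rw [this]
    apply hKm
    rw [norm_smul, hcn, inv_mul_le_iff₀ (hpos k), mul_one]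
    exact hsub k m (by simp at hv; omega)
  obtain ⟨T, -, hT⟩ := hK.exists_tendsto_ultrafilter (hyperfilter ℕ)
    (f := fun k => c k • wordProd a (w k)) (by
      filter_upwards [hlen 2] with k hk
      exact hmem k _ hk le_rfl)
  have hTn : ‖T‖ = 1 := by
    refine tendsto_nhds_unique hT.norm (tendsto_const_nhds.congr fun k => ?_)
    rw [norm_smul, hcn, inv_mul_cancel₀ (hpos k).ne']
  have hcut : ∀ l, ∃ (P : X →L[ℂ] X) (R : List ι), R.length = l ∧ T = P * wordProd a R ∧
      ∀ u, ‖P * wordProd a u‖ ≤ 1 := by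
    intro l
    have : Finite {v : List ι // v.length ≤ l} := (List.finite_length_le ι l).to_subtype
    obtain ⟨⟨R, hRl⟩, hR⟩ := (hyperfilter ℕ).exists_eventually_eq
      (fun k => (⟨(w k).drop ((w k).length - l), by simp; omega⟩ : {v : List ι // v.length ≤ l}))
    simp only [Subtype.mk.injEq] at hR
    obtain ⟨P, -, hP⟩ := hK.exists_tendsto_ultrafilter (hyperfilter ℕ)
      (f := fun k => c k • wordProd a ((w k).take ((w k).length - l))) (by
        filter_upwards [hlen (l + 2)] with k hk
        exact hmem k _ (by simp; omega) (by simp))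
    refine ⟨P, R, ?_, ?_, fun u => ?_⟩
    · obtain ⟨k, hk, hk2⟩ := (hR.and (hlen l)).exists
      rw [← hk]; simp; omega
    · refine tendsto_nhds_unique hT ((hP.mul_const _).congr' ?_)
      filter_upwards [hR] with k hk
      rw [← hk, smul_mul_assoc, ← wordProd_append, List.take_append_drop]
    · have htl' : Tendsto t (hyperfilter ℕ) (𝓝 1) := htl.mono_left hUle
      have h1 := (htl'.pow u.length).mul (hP.mul_const (wordProd a u)).norm
      rw [one_pow, one_mul] at h1
      refine le_of_tendsto_of_tendsto h1 (by simpa using htl'.pow l) ?_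
      filter_upwards [hlen l] with k hk
      have h2 := hw k ((w k).take ((w k).length - l) ++ u)
      have hlt : ((w k).take ((w k).length - l)).length = (w k).length - l := by simp
      rw [List.length_append, hlt, wordProd_append] at h2
      obtain ⟨d, hd⟩ := Nat.exists_eq_add_of_le hk
      rw [hd, show l + d - l = d by omega, pow_add, pow_add] at h2
      rw [hd, show l + d - l = d by omega, smul_mul_assoc, norm_smul, hcn]
      have h3 : 0 < t k ^ d := pow_pos (ht0 k) _
      have h4 : t k ^ u.length * ‖wordProd a ((w k).take d) * wordProd a u‖ ≤
          t k ^ l * ‖wordProd a (w k)‖ := by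
        refine le_of_mul_le_mul_left ?_ h3
        linarith [h2]
      rw [← mul_assoc, mul_comm (t k ^ u.length), mul_assoc, inv_mul_le_iff₀ (hpos k)]
      linarith
  obtain ⟨Z, hZ⟩ : ∃ Z, Z =
      (Submodule.span ℂ {y | ∃ u x, y = wordProd a u (T x)}).topologicalClosure :=
    ⟨_, rfl⟩
  have hZcl : IsClosed (Z : Set X) := hZ ▸ Submodule.isClosed_topologicalClosure _
  have hZgen : ∀ u x, wordProd a u (T x) ∈ Z := fun u x =>
    hZ ▸ Submodule.le_topologicalClosure _ (Submodule.subset_span ⟨u, x, rfl⟩)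
  have hZind : ∀ M : Submodule ℂ X, IsClosed (M : Set X) → (∀ u x, wordProd a u (T x) ∈ M) →
      Z ≤ M := by
    intro M hM h
    rw [hZ]
    refine Submodule.topologicalClosure_minimal _ (Submodule.span_le.mpr ?_) hM
    rintro _ ⟨u, x, rfl⟩; exact h u x
  have hZinv : ∀ i, ∀ x ∈ Z, a i x ∈ Z := by
    intro i
    refine hZind (Z.comap (a i : X →ₗ[ℂ] X)) (hZcl.preimage (a i).continuous) fun u x => ?_
    have := hZgen (i :: u) x
    rwa [wordProd_cons, mul_apply_eq_comp] at this
  have hZne : Z ≠ ⊥ := by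
    rintro rfl
    have : T = 0 := ContinuousLinearMap.ext fun x => by simpa using hZgen [] x
    rw [this] at hTn; simp at hTn
  obtain ⟨n, θ, hθ0, hθ1, hnθ⟩ := hmin Z hZcl hZinv hZne
  obtain ⟨j, hj⟩ := exists_pow_lt_of_lt_one (show (0 : ℝ) < 1 / 2 by norm_num) hθ1
  obtain ⟨P, R, hRl, hTP, hP1⟩ := hcut (n * j)
  have hker : ∀ z ∈ Z, P z = 0 := by
    refine hZind P.ker (ContinuousLinearMap.isClosed_ker _) fun u x => ?_
    have h0 : P * wordProd a u * T = 0 := by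
      have h1 : Tendsto (fun k => P * wordProd a u * (c k • wordProd a (w k))) (hyperfilter ℕ)
        (𝓝 (P * wordProd a u * T)) := hT.const_mul _
      refine tendsto_nhds_unique h1 (squeeze_zero_norm (a := fun k => ‖wordProd a (w k)‖⁻¹)
        (fun k => ?_) (hinf.inv_tendsto_atTop.mono_left hUle))
      rw [mul_smul_comm, norm_smul, hcn, mul_assoc, ← wordProd_append]
      exact mul_le_of_le_one_right (by positivity) (hP1 _)
    have := congrArg (fun S : X →L[ℂ] X => S x) h0
    simpa using this
  have hle : ‖T‖ ≤ 1 / 2 := by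
    refine ContinuousLinearMap.opNorm_le_bound _ (by norm_num) fun x => ?_
    obtain ⟨z, hz, hxz⟩ := exists_near_of_length_mul hZinv hθ0 hnθ j R hRl x
    have hPn : ‖P‖ ≤ 1 := by simpa using hP1 []
    calc ‖T x‖ = ‖P (wordProd a R x - z)‖ := by rw [map_sub, hker z hz, hTP]; simp
      _ ≤ 1 * (θ ^ j * ‖x‖) := (P.le_opNorm _).trans (by gcongr)
      _ ≤ 1 / 2 * ‖x‖ := by rw [one_mul]; gcongr
  rw [hTn] at hle; norm_num at hle

end UnboundedWords

section BergerWang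

variable {X : Type*} [NormedAddCommGroup X] [NormedSpace ℂ X]

/-- The operator induced by `w` on `X ⧸ Y` has norm at least one. -/
def IsFar (Y : Submodule ℂ X) (w : X →L[ℂ] X) : Prop :=
  ∀ θ < (1 : ℝ), ∃ x, ∀ y ∈ Y, θ * ‖x‖ < ‖w x - y‖

theorem IsFar.mono {Y Y' : Submodule ℂ X} {w : X →L[ℂ] X} (h : IsFar Y w) (hY : Y' ≤ Y) :
    IsFar Y' w := fun θ hθ => (h θ hθ).imp fun _ hx y hy => hx y (hY hy)

theorem exists_near_of_not_isFar {Y : Submodule ℂ X} {w : X →L[ℂ] X} (h : ¬ IsFar Y w) :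
    ∃ θ, 0 ≤ θ ∧ θ < 1 ∧ ∀ x, ∃ y ∈ Y, ‖w x - y‖ ≤ θ * ‖x‖ := by
  unfold IsFar at h
  push Not at h
  obtain ⟨θ, hθ, h⟩ := h
  refine ⟨max θ 0, le_max_right _ _, max_lt hθ one_pos, fun x => ?_⟩
  obtain ⟨y, hy, hxy⟩ := h x
  exact ⟨y, hy, hxy.trans (by gcongr; exact le_max_left _ _)⟩

theorem IsFar.topologicalClosure_sSup {w : X →L[ℂ] X} (hw : IsCompactOperator w)
    {c : Set (Submodule ℂ X)} (hc : IsChain (· ≤ ·) c) (hne : c.Nonempty)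
    (h : ∀ Y ∈ c, IsFar Y w) : IsFar (sSup c).topologicalClosure w := by
  by_contra hfar
  obtain ⟨θ, hθ0, hθ1, hx⟩ := exists_near_of_not_isFar hfar
  obtain ⟨K, hK, hKs⟩ := IsCompactOperator.image_closedBall_subset_compact
    (f := (w : X →ₗ[ℂ] X)) hw 1
  obtain ⟨δ, hδ, hδ1⟩ : ∃ δ > 0, θ + 3 * δ = 1 := ⟨(1 - θ) / 3, by linarith, by ring⟩
  have hcl : closure ((w : X →ₗ[ℂ] X) '' Metric.closedBall 0 1) ⊆ K :=
    closure_minimal hKs hK.isClosed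
  have hK' := hK.of_isClosed_subset isClosed_closure hcl
  have : Nonempty c := hne.to_subtype
  obtain ⟨⟨Y, hY⟩, hYK⟩ := hK'.elim_directed_cover
    (fun Y : c => ⋃ y ∈ Y.1, Metric.ball y (θ + 2 * δ))
    (fun Y => isOpen_biUnion fun y _ => Metric.isOpen_ball) (by
      intro z hz
      obtain ⟨_, ⟨x, hx1, rfl⟩, hzx⟩ := Metric.mem_closure_iff.mp hz δ hδ
      obtain ⟨y, hy, hxy⟩ := hx x
      obtain ⟨y', hy', hyy⟩ := Metric.mem_closure_iff.mp hy δ hδ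
      obtain ⟨Y, hYc, hyY⟩ := (Submodule.mem_sSup_of_directed hne hc.directedOn).mp hy'
      refine Set.mem_iUnion.mpr ⟨⟨Y, hYc⟩, Set.mem_iUnion₂.mpr ⟨y', hyY, ?_⟩⟩
      rw [Metric.mem_ball]
      have hx1' : ‖x‖ ≤ 1 := by simpa using hx1
      have h1 : dist (w x) y ≤ θ := by
        rw [dist_eq_norm]; exact hxy.trans (mul_le_of_le_one_right hθ0 hx1')
      have h2 := dist_triangle z (w x) y'
      have h3 := dist_triangle (w x) y y'
      have h4 : dist z (w x) < δ := hzx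
      linarith) (by
      intro Y Y'
      rcases hc.total Y.2 Y'.2 with h | h
      · exact ⟨Y', Set.biUnion_subset_biUnion_left h, subset_rfl⟩
      · exact ⟨Y, subset_rfl, Set.biUnion_subset_biUnion_left h⟩)
  obtain ⟨x, hx⟩ := h Y hY (θ + 2 * δ) (by linarith)
  have hx0 : 0 < ‖x‖ := by
    rw [norm_pos_iff]; rintro rfl
    simpa using hx 0 Y.zero_mem
  have hmem : w ((‖x‖⁻¹ : ℂ) • x) ∈ closure ((w : X →ₗ[ℂ] X) '' Metric.closedBall 0 1) := by
    refine subset_closure ⟨_, ?_, rfl⟩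
    simp [norm_smul, inv_mul_cancel₀ hx0.ne']
  obtain ⟨y, hy, hyx⟩ := Set.mem_iUnion₂.mp (hYK hmem)
  have h1 := hx ((‖x‖ : ℂ) • y) (Y.smul_mem _ hy)
  rw [Metric.mem_ball, dist_eq_norm] at hyx
  have hx0' : (‖x‖ : ℂ) ≠ 0 := by exact_mod_cast hx0.ne'
  have h2 : w x - (‖x‖ : ℂ) • y = (‖x‖ : ℂ) • (w ((‖x‖⁻¹ : ℂ) • x) - y) := by
    rw [smul_sub, map_smul, smul_smul, mul_inv_cancel₀ hx0', one_smul]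
  rw [h2, norm_smul, Complex.norm_real, norm_norm, mul_comm] at h1
  exact absurd (lt_of_mul_lt_mul_left h1 hx0.le) (not_lt.mpr hyx.le)

theorem exists_growth_lt_one {ι : Type*} [Finite ι] {a : ι → X →L[ℂ] X} {n : ℕ} (hn : 0 < n)
    {θ : ℝ} (hθ : θ < 1) (h : ∀ w : List ι, w.length = n → ‖wordProd a w‖ ≤ θ) :
    ∃ r, 0 < r ∧ r < 1 ∧ ∃ C, ∀ w : List ι, ‖wordProd a w‖ ≤ C * r ^ w.length := by
  obtain ⟨r, hr0, hr1, hrθ⟩ : ∃ r : ℝ, 0 < r ∧ r < 1 ∧ θ ≤ r ^ n := by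
    have h1 : Tendsto (fun r : ℝ => r ^ n) (𝓝[<] 1) (𝓝 (1 ^ n)) :=
      ((continuous_pow n).tendsto 1).mono_left nhdsWithin_le_nhds
    rw [one_pow] at h1
    have h2 : ∀ᶠ r : ℝ in 𝓝[<] 1, 0 < r :=
      nhdsWithin_le_nhds (lt_mem_nhds one_pos)
    obtain ⟨r, hr⟩ := ((h1.eventually (lt_mem_nhds hθ)).and (h2.and self_mem_nhdsWithin)).exists
    exact ⟨r, hr.2.1, hr.2.2, hr.1.le⟩
  obtain ⟨C, hC⟩ := exists_norm_wordProd_le a n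
  have hC0 : 0 ≤ C := (norm_nonneg _).trans (hC [] (by simp))
  refine ⟨r, hr0, hr1, C / r ^ n, fun w => ?_⟩
  induction hl : w.length using Nat.strong_induction_on generalizing w with
  | _ l ih =>
    rcases lt_or_ge l n with hln | hln
    · refine (hC w (by omega)).trans ?_
      rw [div_mul_eq_mul_div, le_div_iff₀ (by positivity)]
      gcongr ?_ * ?_
      exact pow_le_pow_of_le_one hr0.le hr1.le hln.le
    · have h1 := ih (l - n) (by omega) (w.drop n) (by simp [hl])
      have h2 := h (w.take n) (by simp; omega)
      rw [← List.take_append_drop n w, wordProd_append]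
      obtain ⟨d, rfl⟩ := Nat.exists_eq_add_of_le hln
      rw [show n + d - n = d by omega] at h1
      calc _ ≤ ‖wordProd a (w.take n)‖ * ‖wordProd a (w.drop n)‖ := norm_mul_le _ _
        _ ≤ r ^ n * (C / r ^ n * r ^ d) := by gcongr; exact h2.trans hrθ
        _ = _ := by rw [pow_add]; ring

end BergerWang

section BergerWang

variable {X : Type*} [NormedAddCommGroup X] [NormedSpace ℂ X]

theorem exists_uniform_near {ι : Type*} [Finite ι] {a : ι → X →L[ℂ] X} {Y : Submodule ℂ X} {n : ℕ}
    (h : ∀ w : List ι, w.length = n → ¬ IsFar Y (wordProd a w)) :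
    ∃ θ, 0 ≤ θ ∧ θ < 1 ∧ ∀ w : List ι, w.length = n → ∀ x, ∃ y ∈ Y,
      ‖wordProd a w x - y‖ ≤ θ * ‖x‖ := by
  choose! t ht0 ht1 ht using fun w hw => exists_near_of_not_isFar (h w hw)
  rcases Set.eq_empty_or_nonempty {w : List ι | w.length = n} with he | hne
  · exact ⟨0, le_rfl, one_pos, fun w hw => absurd (show w ∈ {w : List ι | w.length = n} from hw)
      (by rw [he]; exact Set.notMem_empty _)⟩
  · obtain ⟨w, hw, hmax⟩ := Set.exists_max_image _ t (List.finite_length_eq ι n) hne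
    refine ⟨t w, ht0 w hw, ht1 w hw, fun v hv x => ?_⟩
    obtain ⟨y, hy, hxy⟩ := ht v hv x
    exact ⟨y, hy, hxy.trans (by gcongr; exact hmax v hv)⟩

theorem wordProd_quotientMapCLM {ι : Type*} {a : ι → X →L[ℂ] X} {Y : Submodule ℂ X}
    (hY : ∀ i, ∀ x ∈ Y, a i x ∈ Y) (w : List ι) (x : X) :
    wordProd (fun i => quotientMapCLM Y (a i) (hY i)) w (Submodule.Quotient.mk x) =
      Submodule.Quotient.mk (wordProd a w x) := by
  induction w with
  | nil => simp
  | cons i w ih => rw [wordProd_cons, wordProd_cons, mul_apply_eq_comp, ih]; simp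

variable [CompleteSpace X]

theorem spectrum_quotient_subset {Y : Submodule ℂ X} [hYc : IsClosed (Y : Set X)]
    {T : X →L[ℂ] X} (hT : spectrum ℂ T ⊆ {0}) {S : X ⧸ Y →L[ℂ] X ⧸ Y} (hS : IsCompactOperator S)
    (h : ∀ x : X, S (Submodule.Quotient.mk x) = Submodule.Quotient.mk (T x)) :
    spectrum ℂ S ⊆ {0} := by
  intro z hz
  by_contra hz0
  rw [Set.mem_singleton_iff] at hz0
  obtain ⟨q, hq0, hq⟩ := exists_eigenvector hS hz0 hz
  obtain ⟨x, rfl⟩ := Submodule.Quotient.mk_surjective _ q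
  have hzn : 0 < ‖z‖ := norm_pos_iff.mpr hz0
  obtain ⟨s, hs0, hs1, C, hC⟩ := powGrowth_of_spectrum hzn (a := T) (by
    intro y hy; rw [hT hy]; simpa using hz0)
  have hpow : ∀ n : ℕ, Submodule.Quotient.mk ((T ^ n) x) =
      z ^ n • (Submodule.Quotient.mk x : X ⧸ Y) := by
    intro n
    induction n with
    | zero => simp
    | succ n ih => rw [pow_succ', mul_apply_eq_comp, ← h, ih, map_smul, hq, smul_smul, pow_succ]
  have hle : ∀ n : ℕ, ‖(Submodule.Quotient.mk x : X ⧸ Y)‖ ≤ C * ‖x‖ * (s / ‖z‖) ^ n := by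
    intro n
    have h1 : ‖z‖ ^ n * ‖(Submodule.Quotient.mk x : X ⧸ Y)‖ ≤ C * s ^ n * ‖x‖ := by
      rw [← norm_pow, ← norm_smul, ← hpow]
      refine (Submodule.Quotient.norm_mk_le _ _).trans (((T ^ n).le_opNorm x).trans ?_)
      gcongr; exact hC n
    rw [div_pow, mul_div_assoc', le_div_iff₀ (by positivity)]
    linarith
  have hlim : Tendsto (fun n : ℕ => C * ‖x‖ * (s / ‖z‖) ^ n) atTop (𝓝 (C * ‖x‖ * 0)) :=
    (tendsto_pow_atTop_nhds_zero_of_lt_one (by positivity) ((div_lt_one hzn).mpr hs1)).const_mul _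
  rw [mul_zero] at hlim
  exact hq0 (norm_le_zero_iff.mp (ge_of_tendsto' hlim hle))

theorem false_of_minimal {ι : Type*} [Finite ι] {a : ι → X →L[ℂ] X}
    (ha : ∀ i, IsCompactOperator (a i))
    (hqn : ∀ w ≠ [], spectrum ℂ (wordProd a w) ⊆ {0})
    (hG : ∀ r > 1, ∃ C, ∀ w, ‖wordProd a w‖ ≤ C * r ^ w.length)
    {c : ℝ} (hc : 0 < c) (hlow : ∀ n, ∃ w : List ι, w.length = n ∧ c ≤ ‖wordProd a w‖)
    (hmin : ∀ Z : Submodule ℂ X, IsClosed (Z : Set X) → (∀ i, ∀ x ∈ Z, a i x ∈ Z) → Z ≠ ⊥ →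
      ∃ (n : ℕ) (θ : ℝ), 0 ≤ θ ∧ θ < 1 ∧ ∀ w : List ι, w.length = n → ∀ x, ∃ z ∈ Z,
        ‖wordProd a w x - z‖ ≤ θ * ‖x‖) : False := by
  by_cases hb : ∃ C, ∀ w, ‖wordProd a w‖ ≤ C
  · obtain ⟨C, hC⟩ := hb
    exact false_of_bounded_words ha hqn hC hc hlow
  · push Not at hb
    exact false_of_unbounded_words ha hG hb hmin

theorem false_of_critical {ι : Type*} [Finite ι] {a : ι → X →L[ℂ] X}
    (ha : ∀ i, IsCompactOperator (a i))
    (hqn : ∀ w ≠ [], spectrum ℂ (wordProd a w) ⊆ {0})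
    (hG : ∀ r > 1, ∃ C, ∀ w, ‖wordProd a w‖ ≤ C * r ^ w.length)
    (hcrit : ∀ r, 0 < r → r < 1 → ¬ ∃ C, ∀ w, ‖wordProd a w‖ ≤ C * r ^ w.length) : False := by
  obtain ⟨F, hF⟩ : ∃ F : Set (Submodule ℂ X), ∀ Y, Y ∈ F ↔ IsClosed (Y : Set X) ∧
      (∀ i, ∀ x ∈ Y, a i x ∈ Y) ∧
      ∀ n > 0, ∃ w : List ι, w.length = n ∧ IsFar Y (wordProd a w) := ⟨{Y | _}, fun Y => Iff.rfl⟩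
  have hcomp : ∀ w : List ι, w ≠ [] → IsCompactOperator (wordProd a w : X →L[ℂ] X) := by
    intro w hw
    obtain ⟨x, t, rfl⟩ := List.exists_cons_of_ne_nil hw
    rw [wordProd_cons]
    exact (ha x).comp_clm (wordProd a t)
  have hbot : (⊥ : Submodule ℂ X) ∈ F := by
    refine (hF _).mpr ⟨by simp, fun i x hx => by simp [(Submodule.mem_bot ℂ).mp hx], fun n hn => ?_⟩
    by_contra! hno
    obtain ⟨θ, h0, h1, h⟩ := exists_uniform_near hno
    obtain ⟨r, hr0, hr1, hr⟩ := exists_growth_lt_one hn h1 fun w hw =>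
      ContinuousLinearMap.opNorm_le_bound _ h0 fun x => by
        obtain ⟨y, hy, hxy⟩ := h w hw x
        rwa [(Submodule.mem_bot ℂ).mp hy, sub_zero] at hxy
    exact hcrit r hr0 hr1 hr
  obtain ⟨Y, -, hYmax⟩ := zorn_le_nonempty₀ F (by
    intro c hcF hc Y₀ hY₀
    refine ⟨(sSup c).topologicalClosure, (hF _).mpr ⟨Submodule.isClosed_topologicalClosure _,
      fun i => ?_, fun n hn => ?_⟩, fun Y hY => (le_sSup hY).trans
          (Submodule.le_topologicalClosure _)⟩
    · have : (sSup c).topologicalClosure ≤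
          ((sSup c).topologicalClosure).comap (a i : X →ₗ[ℂ] X) := by
        refine Submodule.topologicalClosure_minimal _ (sSup_le fun Y hY x hx => ?_)
          ((Submodule.isClosed_topologicalClosure _).preimage (a i).continuous)
        exact Submodule.le_topologicalClosure _ (le_sSup hY (((hF Y).mp (hcF hY)).2.1 i x hx))
      exact this
    · by_contra! hno
      have h1 : ∀ w : List ι, w.length = n → ∃ Y ∈ c, ¬ IsFar Y (wordProd a w) := by
        intro w hw
        by_contra! hfar
        exact hno w hw (IsFar.topologicalClosure_sSup
          (hcomp w (by rintro rfl; simp at hw; omega)) hc ⟨_, hY₀⟩ hfar)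
      choose! y hyc hy using h1
      obtain ⟨Y, hYc, hYu⟩ : ∃ Y ∈ c, ∀ w : List ι, w.length = n → y w ≤ Y := by
        have : Nonempty c := ⟨⟨Y₀, hY₀⟩⟩
        have : Finite {w : List ι // w.length = n} := (List.finite_length_eq ι n).to_subtype
        obtain ⟨Y, hY⟩ := hc.directedOn.directed_val.finite_le
          fun w : {w : List ι // w.length = n} => (⟨y w, hyc w w.2⟩ : c)
        exact ⟨Y, Y.2, fun w hw => hY ⟨w, hw⟩⟩
      obtain ⟨w, hw, hwY⟩ := ((hF Y).mp (hcF hYc)).2.2 n hn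
      exact hy w hw (hwY.mono (hYu w hw))) _ hbot
  obtain ⟨hYcl, hYinv, hYfar⟩ := (hF Y).mp hYmax.1
  have hYcl' : IsClosed (Y : Set X) := hYcl
  obtain ⟨b, hb⟩ : ∃ b : ι → X ⧸ Y →L[ℂ] X ⧸ Y, b = fun i => quotientMapCLM Y (a i) (hYinv i) :=
    ⟨_, rfl⟩
  have hbw : ∀ w x, wordProd b w (Submodule.Quotient.mk x) =
      Submodule.Quotient.mk (wordProd a w x) := by
    rw [hb]; exact wordProd_quotientMapCLM hYinv
  have hbc : ∀ i, IsCompactOperator (b i) := fun i => by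
    rw [hb]; exact (ha i).quotientMapCLM (hYinv i)
  have hbcw : ∀ w : List ι, w ≠ [] → IsCompactOperator (wordProd b w : X ⧸ Y →L[ℂ] X ⧸ Y) := by
    intro w hw
    obtain ⟨x, t, rfl⟩ := List.exists_cons_of_ne_nil hw
    rw [wordProd_cons]
    exact (hbc x).comp_clm (wordProd b t)
  have hbn : ∀ w, ‖wordProd b w‖ ≤ ‖wordProd a w‖ := by
    intro w
    refine ContinuousLinearMap.opNorm_le_bound _ (norm_nonneg _) fun q => ?_
    refine le_of_forall_pos_le_add fun ε hε => ?_
    obtain ⟨δ, hδ, hδε⟩ : ∃ δ > 0, ‖wordProd a w‖ * δ ≤ ε :=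
      ⟨ε / (‖wordProd a w‖ + 1), by positivity, by
        rw [mul_div_assoc', div_le_iff₀ (by positivity)]; nlinarith⟩
    obtain ⟨x, rfl, hx⟩ := Submodule.Quotient.norm_mk_lt q hδ
    rw [hbw]
    calc _ ≤ ‖wordProd a w x‖ := Submodule.Quotient.norm_mk_le _ _
      _ ≤ ‖wordProd a w‖ * ‖x‖ := (wordProd a w).le_opNorm x
      _ ≤ ‖wordProd a w‖ * (‖(Submodule.Quotient.mk x : X ⧸ Y)‖ + δ) := by gcongr
      _ ≤ _ := by rw [mul_add]; gcongr
  have hlow : ∀ n > 0, ∃ w : List ι, w.length = n ∧ 1 / 2 ≤ ‖wordProd b w‖ := by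
    intro n hn
    obtain ⟨w, hw, hfar⟩ := hYfar n hn
    refine ⟨w, hw, ?_⟩
    obtain ⟨x, hx⟩ := hfar (1 / 2) (by norm_num)
    have hx0 : 0 < ‖x‖ := by
      rw [norm_pos_iff]; rintro rfl
      simpa using hx 0 Y.zero_mem
    by_contra! hlt
    have h1 : ‖wordProd b w (Submodule.Quotient.mk x)‖ < 1 / 2 * ‖x‖ := by
      refine lt_of_le_of_lt ((wordProd b w).le_opNorm _) ?_
      calc _ ≤ ‖wordProd b w‖ * ‖x‖ := by gcongr; exact Submodule.Quotient.norm_mk_le _ _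
        _ < _ := by gcongr
    rw [hbw] at h1
    obtain ⟨m, hm, hmlt⟩ := Submodule.Quotient.norm_mk_lt
      (Submodule.Quotient.mk (wordProd a w x) : X ⧸ Y) (sub_pos.mpr h1)
    have h2 : wordProd a w x - m ∈ Y := (Submodule.Quotient.eq Y).mp hm.symm
    have h3 := hx _ h2
    rw [sub_sub_cancel] at h3
    linarith
  refine false_of_minimal (a := b) (c := 1 / 2) hbc ?_ ?_ (by norm_num) ?_ ?_
  · intro w hw
    exact spectrum_quotient_subset (hqn w hw) (hbcw w hw) (hbw w)
  · intro r hr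
    obtain ⟨C, hC⟩ := hG r hr
    exact ⟨C, fun w => (hbn w).trans (hC w)⟩
  · intro n
    rcases n.eq_zero_or_pos with rfl | hn
    · refine ⟨[], rfl, ?_⟩
      obtain ⟨w, hw, hw2⟩ := hlow 1 one_pos
      have : Nontrivial (X ⧸ Y) := by
        by_contra h
        rw [not_nontrivial_iff_subsingleton] at h
        have : ‖wordProd b w‖ ≤ 0 := ContinuousLinearMap.opNorm_le_bound _ le_rfl fun x => by
          rw [Subsingleton.elim (wordProd b w x) 0]; simp
        linarith
      rw [wordProd_nil, norm_one]; norm_num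
    · exact hlow n hn
  · intro Z hZ hZinv hZne
    obtain ⟨Z', hZ'⟩ : ∃ Z' : Submodule ℂ X, Z' = Z.comap Y.mkQ := ⟨_, rfl⟩
    have hmem : ∀ x, x ∈ Z' ↔ (Submodule.Quotient.mk x : X ⧸ Y) ∈ Z := fun x => by rw [hZ']; rfl
    have hYZ : Y ≤ Z' := by
      intro x hx
      rw [hmem, (Submodule.Quotient.mk_eq_zero Y).mpr hx]
      exact Z.zero_mem
    have hnot : Z' ∉ F := by
      intro hZF
      have hle := hYmax.2 hZF hYZ
      apply hZne
      rw [eq_bot_iff]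
      intro q hq
      obtain ⟨x, rfl⟩ := Submodule.Quotient.mk_surjective _ q
      exact (Submodule.mem_bot ℂ).mpr
          ((Submodule.Quotient.mk_eq_zero Y).mpr (hle ((hmem x).mpr hq)))
    have hcl : IsClosed (Z' : Set X) := by
      rw [hZ']; exact hZ.preimage Y.mkQL.continuous
    have hinv : ∀ i, ∀ x ∈ Z', a i x ∈ Z' := by
      intro i x hx
      rw [hmem] at hx ⊢
      have := hZinv i _ hx
      rwa [hb, quotientMapCLM_mk] at this
    rw [hF] at hnot
    push Not at hnot
    obtain ⟨n, hn, hno⟩ := hnot hcl hinv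
    obtain ⟨θ, h0, h1, h⟩ := exists_uniform_near hno
    refine ⟨n, (θ + 1) / 2, by linarith, by linarith, fun w hw q => ?_⟩
    rcases eq_or_ne q 0 with rfl | hq
    · exact ⟨0, Z.zero_mem, by simp⟩
    have hqn0 : 0 < ‖q‖ := norm_pos_iff.mpr hq
    obtain ⟨x, rfl, hx⟩ := Submodule.Quotient.norm_mk_lt q (ε := (1 - θ) / 2 * ‖q‖)
      (mul_pos (by linarith) hqn0)
    obtain ⟨y, hy, hxy⟩ := h w hw x
    refine ⟨Submodule.Quotient.mk y, (hmem y).mp hy, ?_⟩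
    rw [hbw, ← Submodule.Quotient.mk_sub]
    refine (Submodule.Quotient.norm_mk_le _ _).trans (hxy.trans ?_)
    have h3 : θ * ‖x‖ ≤ θ * (‖(Submodule.Quotient.mk x : X ⧸ Y)‖ +
        (1 - θ) / 2 * ‖(Submodule.Quotient.mk x : X ⧸ Y)‖) := by gcongr
    nlinarith [mul_nonneg (mul_self_nonneg (1 - θ)) hqn0.le]

end BergerWang

section Invariant

variable {X : Type*} [NormedAddCommGroup X] [NormedSpace ℂ X]

theorem wordProd_smul {ι : Type*} (a : ι → X →L[ℂ] X) (c : ℂ) (w : List ι) :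
    wordProd (fun i => c • a i) w = c ^ w.length • wordProd a w := by
  induction w with
  | nil => simp
  | cons i w ih => rw [wordProd_cons, wordProd_cons, ih, List.length_cons, smul_mul_smul_comm,
      pow_succ']

theorem wordProd_wordProd {ι κ : Type*} {R : Type*} [Monoid R] (a : ι → R) (f : κ → List ι)
    (w : List κ) :
    wordProd (fun k => wordProd a (f k)) w = wordProd a (w.flatMap f) := by
  induction w with
  | nil => simp
  | cons i w ih => rw [wordProd_cons, ih, List.flatMap_cons, wordProd_append]

/-- A finite family of compact operators all of whose words are quasinilpotent has joint spectral
radius zero. -/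
theorem exists_norm_wordProd_le_mul_pow [CompleteSpace X] {ι : Type*} [Finite ι]
    {a : ι → X →L[ℂ] X} (ha : ∀ i, IsCompactOperator (a i))
    (hqn : ∀ w ≠ [], spectrum ℂ (wordProd a w) ⊆ {0}) {ε : ℝ} (hε : 0 < ε) :
    ∃ C, ∀ w, ‖wordProd a w‖ ≤ C * ε ^ w.length := by
  by_contra hno
  obtain ⟨S, hS⟩ : ∃ S : Set ℝ, ∀ r, r ∈ S ↔ 0 < r ∧ ∃ C, ∀ w, ‖wordProd a w‖ ≤ C * r ^ w.length :=
    ⟨{r | _}, fun r => Iff.rfl⟩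
  have hup : ∀ r ∈ S, ∀ s, r ≤ s → s ∈ S := by
    intro r hr s hrs
    obtain ⟨hr0, C, hC⟩ := (hS r).mp hr
    have hC0 : 0 ≤ C := by simpa using (norm_nonneg _).trans (hC [])
    exact (hS s).mpr ⟨hr0.trans_le hrs, C, fun w => (hC w).trans (by gcongr)⟩
  have hlb : ∀ r ∈ S, ε ≤ r := fun r hr => by
    by_contra! h
    exact hno ((hS ε).mp (hup r hr ε h.le)).2
  have hne : S.Nonempty := by
    obtain ⟨M, hM⟩ := (Set.finite_range fun i => ‖a i‖).bddAbove
    refine ⟨max M 1, (hS _).mpr ⟨by positivity, ‖(1 : X →L[ℂ] X)‖, fun w => ?_⟩⟩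
    induction w with
    | nil => simp
    | cons i w ih =>
      rw [wordProd_cons, List.length_cons, pow_succ']
      calc _ ≤ ‖a i‖ * ‖wordProd a w‖ := norm_mul_le _ _
        _ ≤ max M 1 * (‖(1 : X →L[ℂ] X)‖ * max M 1 ^ w.length) := by
          gcongr
          exact (hM ⟨i, rfl⟩).trans (le_max_left _ _)
        _ = _ := by ring
  obtain ⟨ρ, hρ⟩ : ∃ ρ, ρ = sInf S := ⟨_, rfl⟩
  have hρ0 : 0 < ρ := hε.trans_le (hρ ▸ le_csInf hne hlb)
  have hρn : ‖((ρ⁻¹ : ℝ) : ℂ)‖ = ρ⁻¹ := by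
    rw [Complex.norm_real, Real.norm_of_nonneg (by positivity)]
  have hρc : ((ρ⁻¹ : ℝ) : ℂ) ≠ 0 := by
    rw [← norm_pos_iff, hρn]; positivity
  refine false_of_critical (a := fun i => ((ρ⁻¹ : ℝ) : ℂ) • a i) (fun i => (ha i).smul _) ?_ ?_ ?_
  · intro w hw z hz
    rw [wordProd_smul] at hz
    have h1 := spectrum.smul_mem_smul_iff (r := (Units.mk0 _ (pow_ne_zero w.length hρc))⁻¹) |>.mpr
        hz
    rw [Units.smul_def, Units.smul_def, smul_smul] at h1
    simp only [Units.val_inv_eq_inv_val, Units.val_mk0] at h1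
    rw [inv_mul_cancel₀ (pow_ne_zero _ hρc), one_smul] at h1
    have h2 := hqn w hw h1
    simpa [hρ0.ne'] using h2
  · intro r hr
    have hlt : sInf S < ρ * r := by rw [← hρ]; exact lt_mul_of_one_lt_right hρ0 hr
    obtain ⟨s, hsS, hs⟩ := exists_lt_of_csInf_lt hne hlt
    obtain ⟨-, C, hC⟩ := (hS _).mp (hup s hsS _ hs.le)
    refine ⟨C, fun w => ?_⟩
    rw [wordProd_smul, norm_smul, norm_pow, hρn, inv_pow, inv_mul_le_iff₀ (by positivity)]
    refine (hC w).trans (le_of_eq ?_)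
    rw [mul_pow]; ring
  · rintro r hr0 hr1 ⟨C, hC⟩
    have hmem : ρ * r ∈ S := by
      refine (hS _).mpr ⟨by positivity, C, fun w => ?_⟩
      have := hC w
      rw [wordProd_smul, norm_smul, norm_pow, hρn, inv_pow, inv_mul_le_iff₀ (by positivity)] at this
      refine this.trans (le_of_eq ?_)
      rw [mul_pow]; ring
    have h1 : ρ ≤ ρ * r := hρ ▸ csInf_le ⟨ε, hlb⟩ (hρ ▸ hmem)
    nlinarith

theorem norm_mul_wordProd_le {ι κ : Type*} {u : κ → X →L[ℂ] X} {b : ι → X →L[ℂ] X} (s : Finset ι)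
    (c : κ → ι → ℂ) (hu : ∀ k, u k = ∑ i ∈ s, c k i • b i) {B : ℝ} (hB : ∀ k, ∑ i ∈ s, ‖c k i‖ ≤ B)
    {m : ℝ} (w : List κ) :
    ∀ T : X →L[ℂ] X, (∀ v : List ι, v.length = w.length → ‖T * wordProd b v‖ ≤ m) →
      0 ≤ m → ‖T * wordProd u w‖ ≤ B ^ w.length * m := by
  induction w with
  | nil => intro T h _; simpa using h [] rfl
  | cons k w ih =>
    intro T h hm
    have hterm : ∀ i ∈ s, ‖c k i • (T * b i * wordProd u w)‖ ≤ ‖c k i‖ * (B ^ w.length * m) := by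
      intro i _
      rw [norm_smul]
      gcongr
      refine ih _ (fun v hv => ?_) hm
      have := h (i :: v) (by simp [hv])
      rwa [wordProd_cons, ← mul_assoc] at this
    have hB0 : 0 ≤ B := (Finset.sum_nonneg fun i _ => norm_nonneg _).trans (hB k)
    have heq : T * wordProd u (k :: w) = ∑ i ∈ s, c k i • (T * b i * wordProd u w) := by
      rw [wordProd_cons, hu, Finset.sum_mul, Finset.mul_sum]
      refine Finset.sum_congr rfl fun i _ => ?_
      rw [smul_mul_assoc, mul_smul_comm, mul_assoc]
    rw [heq, List.length_cons, pow_succ', mul_assoc]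
    refine (norm_sum_le_of_le _ hterm).trans ?_
    rw [← Finset.sum_mul]
    gcongr
    exact hB k

/-- A family of compact operators, one of them nonzero, all of whose words are quasinilpotent
is reducible. -/
theorem exists_invariant_of_quasinilpotent_words [CompleteSpace X] {ι : Type*} {a : ι → X →L[ℂ] X}
    (ha : ∀ i, IsCompactOperator (a i))
    (hqn : ∀ w ≠ [], spectrum ℂ (wordProd a w) ⊆ {0}) {i₀ : ι} (h0 : a i₀ ≠ 0) :
    ∃ M : Submodule ℂ X, IsClosed (M : Set X) ∧ M ≠ ⊥ ∧ M ≠ ⊤ ∧ ∀ i, ∀ x ∈ M, a i x ∈ M := by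
  by_contra! hirr
  obtain ⟨x₀, hx₀⟩ : ∃ x, a i₀ x ≠ 0 := by
    by_contra! h
    exact h0 (ContinuousLinearMap.ext h)
  have hx₀' : 0 < ‖a i₀ x₀‖ := norm_pos_iff.mpr hx₀
  obtain ⟨r, hr0, hr⟩ : ∃ r > 0, ‖a i₀‖ * r ≤ ‖a i₀ x₀‖ / 2 :=
    ⟨‖a i₀ x₀‖ / 2 / (‖a i₀‖ + 1), by positivity, by
      rw [mul_div_assoc', div_le_iff₀ (by positivity)]; nlinarith⟩
  have hlow : ∀ x, ‖x - x₀‖ < r → ‖a i₀ x₀‖ / 2 ≤ ‖a i₀ x‖ := by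
    intro x hx
    have h1 : ‖a i₀ (x - x₀)‖ ≤ ‖a i₀‖ * r := ((a i₀).le_opNorm _).trans (by gcongr)
    have h3 : ‖a i₀ (x₀ - x)‖ = ‖a i₀ (x - x₀)‖ := by rw [← neg_sub, map_neg, norm_neg]
    have h4 := norm_sub_norm_le (a i₀ x₀) (a i₀ x)
    rw [← map_sub, h3] at h4
    linarith
  obtain ⟨K, hK, hKs⟩ := IsCompactOperator.image_closedBall_subset_compact
    (f := (a i₀ : X →ₗ[ℂ] X)) (ha i₀) (‖x₀‖ + r)
  obtain ⟨K', hK'⟩ : ∃ K' : Set X, K' = K ∩ {y | ‖a i₀ x₀‖ / 2 ≤ ‖y‖} := ⟨_, rfl⟩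
  have hK'c : IsCompact K' := hK' ▸ hK.inter_right (isClosed_le continuous_const continuous_norm)
  have hK'mem : ∀ x, ‖x - x₀‖ < r → a i₀ x ∈ K' := by
    intro x hx
    rw [hK']
    refine ⟨hKs ⟨x, ?_, rfl⟩, hlow x hx⟩
    rw [mem_closedBall_zero_iff]
    have := norm_add_le x₀ (x - x₀)
    rw [add_sub_cancel] at this
    linarith
  obtain ⟨A, hA⟩ : ∃ A, A = Submodule.span ℂ (Set.range (wordProd a)) := ⟨_, rfl⟩
  have hAmem : ∀ w, wordProd a w ∈ A := fun w => hA ▸ Submodule.subset_span ⟨w, rfl⟩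
  have hAmul : ∀ i, ∀ T ∈ A, a i * T ∈ A := by
    intro i T hT
    have : A ≤ A.comap (LinearMap.mulLeft ℂ (a i)) := by
      conv_lhs => rw [hA]
      refine Submodule.span_le.mpr ?_
      rintro _ ⟨w, rfl⟩
      have := hAmem (i :: w)
      rwa [wordProd_cons] at this
    exact this hT
  have hcov : ∀ y ∈ K', ∃ T : A, ‖T.1 y - x₀‖ < r := by
    intro y hy
    have hy0 : y ≠ 0 := by
      rintro rfl
      rw [hK'] at hy
      have h1 : ‖a i₀ x₀‖ / 2 ≤ ‖(0 : X)‖ := hy.2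
      rw [norm_zero] at h1; linarith
    obtain ⟨N, hN⟩ : ∃ N : Submodule ℂ X, N = A.map
        (ContinuousLinearMap.apply ℂ X y : (X →L[ℂ] X) →ₗ[ℂ] X) :=
      ⟨_, rfl⟩
    have hNmem : ∀ z, z ∈ N ↔ ∃ T ∈ A, T y = z := by
      intro z; rw [hN, Submodule.mem_map]; rfl
    have htop : N.topologicalClosure = ⊤ := by
      by_contra htop
      have hbot : N.topologicalClosure ≠ ⊥ := by
        intro hb
        have : y ∈ N.topologicalClosure :=
          N.le_topologicalClosure ((hNmem y).mpr ⟨_, hAmem [], by simp⟩)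
        rw [hb] at this
        exact hy0 ((Submodule.mem_bot ℂ).mp this)
      obtain ⟨i, x, hx, hxi⟩ := hirr _ N.isClosed_topologicalClosure hbot htop
      apply hxi
      have : N.topologicalClosure ≤ N.topologicalClosure.comap (a i : X →ₗ[ℂ] X) := by
        refine Submodule.topologicalClosure_minimal _ (fun z hz => ?_)
          (N.isClosed_topologicalClosure.preimage (a i).continuous)
        obtain ⟨T, hT, rfl⟩ := (hNmem z).mp hz
        exact N.le_topologicalClosure ((hNmem _).mpr ⟨_, hAmul i T hT, rfl⟩)
      exact this hx
    have hx : x₀ ∈ closure (N : Set X) := by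
      rw [← Submodule.topologicalClosure_coe, htop]; trivial
    obtain ⟨z, hz, hzx⟩ := Metric.mem_closure_iff.mp hx r hr0
    obtain ⟨T, hT, rfl⟩ := (hNmem z).mp hz
    exact ⟨⟨T, hT⟩, by rwa [← dist_eq_norm, dist_comm]⟩
  obtain ⟨t, ht⟩ := hK'c.elim_finite_subcover (fun T : A => {y | ‖T.1 y - x₀‖ < r})
    (fun T => isOpen_lt (by fun_prop) continuous_const) (fun y hy => by
      obtain ⟨T, hT⟩ := hcov y hy
      exact Set.mem_iUnion.mpr ⟨T, hT⟩)
  have hseq : ∀ n, ∃ w : List t, w.length = n ∧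
      ‖wordProd (fun T : t => T.1.1 * a i₀) w x₀ - x₀‖ < r := by
    intro n
    induction n with
    | zero => exact ⟨[], rfl, by simpa using hr0⟩
    | succ n ih =>
      obtain ⟨w, hw, hwx⟩ := ih
      obtain ⟨T, hT, hTx⟩ := Set.mem_iUnion₂.mp (ht (hK'mem _ hwx))
      exact ⟨⟨T, hT⟩ :: w, by simp [hw], by simpa using hTx⟩
  have hspan : ∀ T : t, ∃ c : List ι →₀ ℂ, (c.sum fun v z => z • wordProd a v) = T.1.1 := by
    intro T
    have : (T.1.1 : X →L[ℂ] X) ∈ Submodule.span ℂ (Set.range (wordProd a)) := hA.le T.1.2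
    exact Finsupp.mem_span_range_iff_exists_finsupp.mp this
  choose c hc using hspan
  classical
  obtain ⟨V, hV⟩ : ∃ V : Finset (List ι), ∀ T, (c T).support ⊆ V :=
    ⟨Finset.univ.biUnion fun T => (c T).support, fun T =>
      Finset.subset_biUnion_of_mem (fun T => (c T).support) (Finset.mem_univ T)⟩
  obtain ⟨b, hb⟩ : ∃ b : V → X →L[ℂ] X, b = fun v => wordProd a (v.1 ++ [i₀]) := ⟨_, rfl⟩
  have hu : ∀ T : t, T.1.1 * a i₀ = ∑ v ∈ (Finset.univ : Finset V), c T v • b v := by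
    intro T
    rw [← hc T, Finsupp.sum_of_support_subset _ (hV T) _ (by simp), Finset.sum_mul,
      ← Finset.sum_coe_sort, hb]
    refine Finset.sum_congr rfl fun v _ => ?_
    show _ = c T v.1 • wordProd a (v.1 ++ [i₀])
    rw [wordProd_append, smul_mul_assoc]; simp
  obtain ⟨B, hB0, hB⟩ : ∃ B > 0, ∀ T : t, ∑ v ∈ (Finset.univ : Finset V), ‖c T v‖ ≤ B := by
    refine ⟨∑ T : t, ∑ v ∈ (Finset.univ : Finset V), ‖c T v‖ + 1, by positivity, fun T => ?_⟩
    have := Finset.single_le_sum (f := fun T : t => ∑ v ∈ (Finset.univ : Finset V), ‖c T v‖)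
      (fun T _ => Finset.sum_nonneg fun _ _ => norm_nonneg _) (Finset.mem_univ T)
    beta_reduce at this
    linarith
  obtain ⟨C, hC⟩ := exists_norm_wordProd_le_mul_pow (a := b) (ε := 1 / (2 * B)) (fun v => by
      rw [hb]
      show IsCompactOperator (wordProd a (v.1 ++ [i₀]) : X →L[ℂ] X)
      rw [wordProd_append, wordProd_cons, wordProd_nil, mul_one]
      exact (ha i₀).clm_comp (wordProd a v.1))
    (fun w hw => by
      rw [hb, wordProd_wordProd]
      refine hqn _ ?_
      obtain ⟨v, w', rfl⟩ := List.exists_cons_of_ne_nil hw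
      simp) (by positivity)
  have hC0 : 0 ≤ C := by simpa using (norm_nonneg _).trans (hC [])
  have hle : ∀ n : ℕ, ‖a i₀ x₀‖ / 2 ≤ ‖a i₀‖ * C * ‖x₀‖ * (1 / 2) ^ n := by
    intro n
    obtain ⟨w, hw, hwx⟩ := hseq n
    have h1 := norm_mul_wordProd_le (u := fun T : t => T.1.1 * a i₀) 
      (s := (Finset.univ : Finset V)) (c := fun (T : t) (v : V) => c T v.1) (b := b) hu hB
      (m := C * (1 / (2 * B)) ^ n) w 1 (fun v hv => by
        rw [one_mul]; exact (hC v).trans (le_of_eq (by rw [hv, hw]))) (by positivity)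
    rw [one_mul, hw] at h1
    have h2 : B ^ n * (C * (1 / (2 * B)) ^ n) = C * (1 / 2) ^ n := by
      have : (1 / 2 : ℝ) = B * (1 / (2 * B)) := by field_simp
      rw [this, mul_pow]; ring
    rw [h2] at h1
    calc _ ≤ _ := hlow _ hwx
      _ ≤ ‖a i₀‖ * (C * (1 / 2) ^ n * ‖x₀‖) := by
        refine ((a i₀).le_opNorm _).trans ?_
        gcongr
        exact (ContinuousLinearMap.le_opNorm _ _).trans (by gcongr)
      _ = _ := by ring
  have hlim : Tendsto (fun n : ℕ => ‖a i₀‖ * C * ‖x₀‖ * (1 / 2 : ℝ) ^ n) atTop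
      (𝓝 (‖a i₀‖ * C * ‖x₀‖ * 0)) :=
    (tendsto_pow_atTop_nhds_zero_of_lt_one (by norm_num) (by norm_num)).const_mul _
  rw [mul_zero] at hlim
  have := ge_of_tendsto' hlim hle
  linarith

end Invariant

section FiniteOrbit

variable {X : Type*} [NormedAddCommGroup X] [NormedSpace ℂ X]

/-- The span of the images of `x` under the words of length at most `m`. -/
def wordSpan {ι : Type*} (S : ι → X →L[ℂ] X) (x : X) (m : ℕ) : Submodule ℂ X :=
  Submodule.span ℂ ((fun w => wordProd S w x) '' {w : List ι | w.length ≤ m})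

theorem wordProd_mem_wordSpan {ι : Type*} {S : ι → X →L[ℂ] X} {x : X} {m : ℕ} {w : List ι}
    (hw : w.length ≤ m) : wordProd S w x ∈ wordSpan S x m :=
  Submodule.subset_span ⟨w, hw, rfl⟩

theorem wordSpan_mono {ι : Type*} {S : ι → X →L[ℂ] X} {x : X} {m n : ℕ} (h : m ≤ n) :
    wordSpan S x m ≤ wordSpan S x n :=
  Submodule.span_mono (Set.image_mono fun _ hw => le_trans hw h)

theorem apply_mem_wordSpan_succ {ι : Type*} {S : ι → X →L[ℂ] X} {x : X} {m : ℕ} (i : ι) {y : X}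
    (hy : y ∈ wordSpan S x m) : S i y ∈ wordSpan S x (m + 1) := by
  have : wordSpan S x m ≤ (wordSpan S x (m + 1)).comap (S i : X →ₗ[ℂ] X) := by
    refine Submodule.span_le.mpr ?_
    rintro _ ⟨w, hw, rfl⟩
    have h : wordProd S (i :: w) x ∈ wordSpan S x (m + 1) :=
      wordProd_mem_wordSpan (by simpa using hw)
    exact h
  exact this hy

/-- If the orbit of a vector under a Jordan algebra of operators is finite-dimensional, then the
vector lies in a finite-dimensional invariant subspace. -/
theorem exists_finiteDimensional_invariant {J : Submodule ℂ (X →L[ℂ] X)}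
    (hJ : ∀ A ∈ J, ∀ B ∈ J, A * B + B * A ∈ J) {x : X} {Y : Submodule ℂ X} [FiniteDimensional ℂ Y]
    (hY : ∀ A ∈ J, A x ∈ Y) :
    ∃ M : Submodule ℂ X, FiniteDimensional ℂ M ∧ x ∈ M ∧ ∀ A ∈ J, ∀ y ∈ M, A y ∈ M := by
  obtain ⟨N, hN⟩ : ∃ N : Submodule ℂ X, ∀ z, z ∈ N ↔ ∃ A ∈ J, A x = z :=
    ⟨J.map (ContinuousLinearMap.apply ℂ X x : (X →L[ℂ] X) →ₗ[ℂ] X), fun z => Iff.rfl⟩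
  have hNY : N ≤ Y := fun z hz => by
    obtain ⟨A, hA, rfl⟩ := (hN z).mp hz
    exact hY A hA
  have : FiniteDimensional ℂ N := Submodule.finiteDimensional_of_le hNY
  obtain ⟨k, b⟩ : ∃ k, Nonempty (Module.Basis (Fin k) ℂ N) := ⟨_, ⟨Module.finBasis ℂ N⟩⟩
  obtain ⟨b⟩ := b
  choose S hSJ hSx using fun i => (hN (b i)).mp (b i).2
  have hdec : ∀ A ∈ J, ∃ c : Fin k → ℂ, (A - ∑ i, c i • S i) x = 0 := by
    intro A hA
    refine ⟨b.repr ⟨A x, (hN _).mpr ⟨A, hA, rfl⟩⟩, ?_⟩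
    have h := congrArg Subtype.val (b.sum_repr ⟨A x, (hN _).mpr ⟨A, hA, rfl⟩⟩)
    simp only [Submodule.coe_sum, Submodule.coe_smul] at h
    rw [sub_apply, sub_eq_zero]
    refine h.symm.trans ?_
    rw [sum_apply]
    exact Finset.sum_congr rfl fun i _ => by rw [smul_apply, hSx]
  have hsumJ : ∀ c : Fin k → ℂ, ∑ i, c i • S i ∈ J := fun c =>
    J.sum_mem fun i _ => J.smul_mem _ (hSJ i)
  have hlift : ∀ (m : ℕ), (∀ T ∈ J, T x = 0 → ∀ y ∈ wordSpan S x m, T y ∈ wordSpan S x m) →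
      ∀ A ∈ J, ∀ y ∈ wordSpan S x m, A y ∈ wordSpan S x (m + 1) := by
    intro m hm A hA y hy
    obtain ⟨c, hc⟩ := hdec A hA
    have h1 := wordSpan_mono (Nat.le_succ m) (hm _ (J.sub_mem hA (hsumJ c)) hc y hy)
    have h2 : (∑ i, c i • S i) y ∈ wordSpan S x (m + 1) := by
      rw [sum_apply]
      exact Submodule.sum_mem _ fun i _ => Submodule.smul_mem _ _ (apply_mem_wordSpan_succ i hy)
    have h3 := Submodule.add_mem _ h1 h2
    rwa [sub_apply, sub_add_cancel] at h3
  have hE : ∀ (m : ℕ), ∀ T ∈ J, T x = 0 → ∀ y ∈ wordSpan S x m, T y ∈ wordSpan S x m := by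
    intro m
    induction m with
    | zero =>
      intro T hT hTx y hy
      have : wordSpan S x 0 ≤ (wordSpan S x 0).comap (T : X →ₗ[ℂ] X) := by
        refine Submodule.span_le.mpr ?_
        rintro _ ⟨w, hw, rfl⟩
        have hw' : w = [] := List.length_eq_zero_iff.mp (Nat.le_zero.mp hw)
        subst hw'
        show T (wordProd S [] x) ∈ wordSpan S x 0
        rw [wordProd_nil, one_apply_eq_self, hTx]
        exact Submodule.zero_mem _
      exact this hy
    | succ m ih =>
      intro T hT hTx y hy
      have : wordSpan S x (m + 1) ≤ (wordSpan S x (m + 1)).comap (T : X →ₗ[ℂ] X) := by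
        refine Submodule.span_le.mpr ?_
        rintro _ ⟨w, hw, rfl⟩
        show T (wordProd S w x) ∈ wordSpan S x (m + 1)
        cases w with
        | nil =>
          rw [wordProd_nil, one_apply_eq_self, hTx]
          exact Submodule.zero_mem _
        | cons i w =>
          have hwm : wordProd S w x ∈ wordSpan S x m :=
            wordProd_mem_wordSpan (by simpa using hw)
          have h1 := hlift m ih _ (hJ T hT _ (hSJ i)) _ hwm
          have h2 := apply_mem_wordSpan_succ i (ih T hT hTx _ hwm)
          have h3 := Submodule.sub_mem _ h1 h2
          rw [add_apply] at h3
          rw [wordProd_cons]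
          simpa using h3
      exact this hy
  have hperm : ∀ w w' : List (Fin k), w.Perm w' → ∀ n, w.length = n + 1 →
      ∃ ε : ℂ, ε ≠ 0 ∧ wordProd S w x - ε • wordProd S w' x ∈ wordSpan S x n := by
    intro w w' h
    induction h with
    | nil => intro n hn; simp at hn
    | cons i h ih =>
      rename_i l₁ l₂
      intro n hn
      cases n with
      | zero =>
        have h1 : l₁ = [] := by simpa using hn
        subst h1
        have h2 : l₂ = [] := h.nil_eq.symm
        subst h2
        exact ⟨1, one_ne_zero, by simp⟩
      | succ n =>
        obtain ⟨ε, hε, hm⟩ := ih n (by simpa using hn)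
        refine ⟨ε, hε, ?_⟩
        have := apply_mem_wordSpan_succ i hm
        rw [map_sub, map_smul] at this
        simpa using this
    | swap i j l =>
      intro n hn
      refine ⟨-1, by simp, ?_⟩
      have h1 := hlift l.length (hE _) _ (hJ _ (hSJ i) _ (hSJ j)) _
        (wordProd_mem_wordSpan (S := S) (x := x) le_rfl)
      have h2 : n = l.length + 1 := by simpa using hn.symm
      rw [h2]
      simpa [add_comm] using h1
    | trans h₁ h₂ ih₁ ih₂ =>
      intro n hn
      obtain ⟨ε, hε, hm⟩ := ih₁ n hn
      obtain ⟨δ, hδ, hm'⟩ := ih₂ n (h₁.length_eq ▸ hn)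
      refine ⟨ε * δ, mul_ne_zero hε hδ, ?_⟩
      have := Submodule.add_mem _ hm (Submodule.smul_mem _ ε hm')
      rwa [smul_sub, smul_smul, sub_add_sub_cancel] at this
  have hstab : wordSpan S x (k + 1) ≤ wordSpan S x k := by
    refine Submodule.span_le.mpr ?_
    rintro _ ⟨w, hw, rfl⟩
    show wordProd S w x ∈ wordSpan S x k
    rcases Nat.lt_or_ge k w.length with hlt | hge
    swap
    · exact wordProd_mem_wordSpan hge
    have hlen : w.length = k + 1 := le_antisymm hw hlt
    have hnd : ¬ w.Nodup := fun h => by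
      have := h.length_le_card
      rw [Fintype.card_fin] at this
      omega
    obtain ⟨i, hi⟩ : ∃ i, List.Duplicate i w := by
      simpa [List.nodup_iff_forall_not_duplicate] using hnd
    obtain ⟨l, hl⟩ := (List.duplicate_iff_sublist.mp hi).exists_perm_append
    obtain ⟨ε, hε, hm⟩ := hperm _ _ hl k hlen
    have hk : k = l.length + 1 := by
      have := hl.length_eq
      rw [hlen] at this
      simpa using this
    have h1 := hlift l.length (hE _) _ (hJ _ (hSJ i) _ (hSJ i)) _
      (wordProd_mem_wordSpan (S := S) (x := x) le_rfl)
    rw [← hk] at h1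
    have h2 : wordProd S ([i, i] ++ l) x ∈ wordSpan S x k := by
      have := Submodule.smul_mem _ (2⁻¹ : ℂ) h1
      rw [← two_smul ℂ, smul_apply, smul_smul] at this
      simpa using this
    have := Submodule.add_mem _ hm (Submodule.smul_mem _ ε h2)
    rwa [sub_add_cancel] at this
  refine ⟨wordSpan S x k, ?_, ?_, fun A hA y hy => hstab (hlift k (hE k) A hA y hy)⟩
  · exact FiniteDimensional.span_of_finite ℂ ((List.finite_length_le (Fin k) k).image _)
  · simpa using wordProd_mem_wordSpan (S := S) (x := x) (m := k) (w := []) (by simp)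

end FiniteOrbit

section PowGrowthOn

variable {A : Type*} [NormedRing A] [NormedAlgebra ℂ A]

/-- The element `u` agrees with an element of power growth at most `r` on the right ideal
generated by `e`. -/
def PowGrowthOn (u e : A) (r : ℝ) : Prop :=
  ∃ w, PowGrowth w r ∧ Commute w e ∧ u * e = w * e

omit [NormedAlgebra ℂ A] in
theorem pow_mul_eq_of_mul_eq {u w e : A} (hw : Commute w e) (h : u * e = w * e) (n : ℕ) :
    u ^ n * e = w ^ n * e := by
  induction n with
  | zero => simp
  | succ n ih => rw [pow_succ, mul_assoc, h, hw.eq, ← mul_assoc, ih, mul_assoc, ← hw.eq,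
      ← mul_assoc,
      ← pow_succ]

omit [NormedAlgebra ℂ A] in
theorem PowGrowthOn.mono {u e : A} {r s : ℝ} (h : PowGrowthOn u e r) (hr : 0 ≤ r) (hrs : r ≤ s) :
    PowGrowthOn u e s := by
  obtain ⟨w, hw, hc, he⟩ := h
  exact ⟨w, hw.mono hr hrs, hc, he⟩

omit [NormedAlgebra ℂ A] in
theorem PowGrowthOn.pow {u e : A} {r : ℝ} (h : PowGrowthOn u e r) (N : ℕ) :
    PowGrowthOn (u ^ N) e (r ^ N) := by
  obtain ⟨w, hw, hc, he⟩ := h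
  exact ⟨w ^ N, hw.pow N, hc.pow_left N, pow_mul_eq_of_mul_eq hc he N⟩

theorem PowGrowthOn.smul {u e : A} {r : ℝ} (h : PowGrowthOn u e r) (c : ℂ) :
    PowGrowthOn (c • u) e (‖c‖ * r) := by
  obtain ⟨w, hw, hc, he⟩ := h
  exact ⟨c • w, hw.smul c, hc.smul_left c, by rw [smul_mul_assoc, he, smul_mul_assoc]⟩

omit [NormedAlgebra ℂ A] in
theorem PowGrowthOn.one_add_pow_sub_one {u e : A} {r : ℝ} (h : PowGrowthOn u e r) (hr : 0 ≤ r)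
    (N : ℕ) : PowGrowthOn ((1 + u) ^ N - 1) e ((1 + r) ^ N - 1) := by
  obtain ⟨w, hw, hc, he⟩ := h
  have hc' : Commute (1 + w) e := (Commute.one_left e).add_left hc
  refine ⟨_, hw.one_add_pow_sub_one hr N, (hc'.pow_left N).sub_left (Commute.one_left e), ?_⟩
  rw [sub_mul, sub_mul, pow_mul_eq_of_mul_eq hc' (by rw [add_mul, add_mul, he])]

omit [NormedAlgebra ℂ A] in
theorem PowGrowthOn.exists_bound {u e : A} {r : ℝ} (h : PowGrowthOn u e r) :
    ∃ C, ∀ n, ‖u ^ n * e‖ ≤ C * r ^ n := by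
  obtain ⟨w, ⟨C, hC⟩, hc, he⟩ := h
  refine ⟨C * ‖e‖, fun n => ?_⟩
  rw [pow_mul_eq_of_mul_eq hc he]
  refine (norm_mul_le _ _).trans ?_
  calc _ ≤ C * r ^ n * ‖e‖ := by gcongr; exact hC n
    _ = _ := by ring

theorem powGrowthOn_add_mul {r k e f : A} {s η : ℝ} (c : ℂ)
    (hre : PowGrowth ((r - algebraMap ℂ A c) * e) s) (hkf : PowGrowth (k * f) η)
    (he : e * e = e) (hf : f * f = f) (h₁ : Commute r k) (h₂ : Commute r e) (h₃ : Commute r f)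
    (h₄ : Commute k e) (h₅ : Commute k f) (h₆ : Commute e f) :
    PowGrowthOn (r + k * r - algebraMap ℂ A c) (e * f) (s + η * ‖r‖) := by
  have h₇ : ∀ x : A, Commute (algebraMap ℂ A c) x := Algebra.commutes c
  have hcr : ∀ {x}, Commute r x → Commute (r - algebraMap ℂ A c) x := fun h => h.sub_left (h₇ _)
  have hk : PowGrowth (k * f * r) (η * ‖r‖) :=
    hkf.mul (powGrowth_norm r) (h₁.symm.mul_left h₃.symm)
  have c1 : Commute ((r - algebraMap ℂ A c) * e) (k * f * r) :=
    (((hcr h₁).mul_right (hcr h₃)).mul_right (hcr (Commute.refl r))).mul_left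
      ((h₄.symm.mul_right h₆).mul_right h₂.symm)
  refine ⟨(r - algebraMap ℂ A c) * e + k * f * r, hre.add hk c1, ?_, ?_⟩
  · exact (((hcr h₂).mul_right (hcr h₃)).mul_left ((Commute.refl e).mul_right h₆)).add_left
      (((h₄.mul_right h₅).mul_left (h₆.symm.mul_right (Commute.refl f))).mul_left
        (h₂.mul_right h₃))
  · have e1 : e * (e * f) = e * f := by rw [← mul_assoc, he]
    have e2 : f * r * (e * f) = r * (e * f) := by
      rw [← h₃.eq, mul_assoc, h₆.eq, ← mul_assoc f, hf]
    rw [add_mul, mul_assoc _ e, e1, mul_assoc k, mul_assoc k, e2, ← mul_assoc k, ← add_mul]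
    congr 1
    abel

end PowGrowthOn

section Multiplication

variable {A : Type*} [NormedRing A] [NormedAlgebra ℂ A]

/-- Left multiplication as a bounded operator. -/
noncomputable def leftMul (a : A) : A →L[ℂ] A := ContinuousLinearMap.mul ℂ A a

/-- Right multiplication as a bounded operator. -/
noncomputable def rightMul (a : A) : A →L[ℂ] A := (ContinuousLinearMap.mul ℂ A).flip a

@[simp] theorem leftMul_apply (a x : A) : leftMul a x = a * x := rfl

@[simp] theorem rightMul_apply (a x : A) : rightMul a x = x * a := rfl

theorem leftMul_pow (a : A) (n : ℕ) : leftMul a ^ n = leftMul (a ^ n) := by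
  induction n with
  | zero => ext; simp
  | succ n ih => ext x; simp [pow_succ, ih, mul_assoc]

theorem rightMul_pow (a : A) (n : ℕ) : rightMul a ^ n = rightMul (a ^ n) := by
  induction n with
  | zero => ext; simp
  | succ n ih => ext x; simp [pow_succ, ih, mul_assoc, (Commute.self_pow a n).eq]

theorem commute_leftMul_rightMul (a b : A) : Commute (leftMul a) (rightMul b) := by
  ext x; simp [mul_assoc]

theorem Commute.leftMul {a b : A} (h : Commute a b) : Commute (leftMul a) (leftMul b) := by
  ext x; simp [← mul_assoc, h.eq]

theorem Commute.rightMul {a b : A} (h : Commute a b) : Commute (rightMul a) (rightMul b) := by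
  ext x; simp [mul_assoc, h.eq]

theorem norm_leftMul_le (a : A) : ‖leftMul a‖ ≤ ‖a‖ :=
  ContinuousLinearMap.opNorm_le_bound _ (norm_nonneg _) fun _ => norm_mul_le _ _

theorem norm_rightMul_le (a : A) : ‖rightMul a‖ ≤ ‖a‖ :=
  ContinuousLinearMap.opNorm_le_bound _ (norm_nonneg _) fun _ =>
    (norm_mul_le _ _).trans (mul_comm _ _).le

theorem PowGrowth.leftMul {a : A} {r : ℝ} (h : PowGrowth a r) : PowGrowth (leftMul a) r := by
  obtain ⟨C, hC⟩ := h
  exact ⟨C, fun n => by rw [leftMul_pow]; exact (norm_leftMul_le _).trans (hC n)⟩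

theorem PowGrowth.rightMul {a : A} {r : ℝ} (h : PowGrowth a r) : PowGrowth (rightMul a) r := by
  obtain ⟨C, hC⟩ := h
  exact ⟨C, fun n => by rw [rightMul_pow]; exact (norm_rightMul_le _).trans (hC n)⟩

end Multiplication

section Splitting

variable {V : Type*} [NormedAddCommGroup V] [NormedSpace ℂ V]

theorem norm_pow_one_sub_pow_apply_le {S : V →L[ℂ] V} {v : V} {C θ : ℝ}
    (h : ∀ n, ‖(S ^ n) v‖ ≤ C * θ ^ n) (n j : ℕ) :
    ‖((1 - S) ^ j * S ^ n) v‖ ≤ C * θ ^ n * (1 + θ) ^ j := by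
  induction j generalizing n with
  | zero => simpa using h n
  | succ j ih =>
    have heq : (1 - S) ^ (j + 1) * S ^ n = (1 - S) ^ j * S ^ n - (1 - S) ^ j * S ^ (n + 1) := by
      rw [pow_succ, pow_succ', mul_assoc, sub_mul, one_mul, mul_sub]
    rw [heq, sub_apply]
    refine (norm_sub_le _ _).trans ((add_le_add (ih n) (ih (n + 1))).trans (le_of_eq ?_))
    ring

/-- If the sum of a vector decaying under `S` and of a vector decaying under `1 - S` lies in a
closed `S`-invariant subspace, then so does the second vector. -/
theorem mem_of_add_mem_of_decay {S : V →L[ℂ] V} {J : Submodule ℂ V} (hJ : IsClosed (J : Set V))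
    (hS : ∀ x ∈ J, S x ∈ J) {u v : V} (huv : u + v ∈ J) {C : ℝ}
    (hu : ∀ n, ‖(S ^ n) u‖ ≤ C * (1 / 8) ^ n) (hv : ∀ n, ‖((1 - S) ^ n) v‖ ≤ C * (1 / 8) ^ n) :
    v ∈ J := by
  have hC0 : 0 ≤ C := by simpa using (norm_nonneg _).trans (hu 0)
  have hcomm : Commute S (1 - S) := (Commute.one_right S).sub_right (Commute.refl S)
  have hSpow : ∀ n, ∀ x ∈ J, (S ^ n) x ∈ J := by
    intro n
    induction n with
    | zero => simp
    | succ n ih => intro x hx; rw [pow_succ]; exact ih _ (hS x hx)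
  have hS' : ∀ x ∈ J, (1 - S) x ∈ J := fun x hx => by
    rw [sub_apply, one_apply_eq_self]; exact J.sub_mem hx (hS x hx)
  have hSpow' : ∀ n, ∀ x ∈ J, ((1 - S) ^ n : V →L[ℂ] V) x ∈ J := by
    intro n
    induction n with
    | zero => simp
    | succ n ih => intro x hx; rw [pow_succ]; exact ih _ (hS' x hx)
  obtain ⟨t, ht⟩ : ∃ t : ℕ → ℕ → V →L[ℂ] V,
      ∀ m j, t m j = S ^ j * (1 - S) ^ (2 * m - j) * ((2 * m).choose j : V →L[ℂ] V) :=
    ⟨_, fun _ _ => rfl⟩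
  have hbin : ∀ m, ∑ j ∈ Finset.range (2 * m + 1), t m j = 1 := by
    intro m
    simp only [ht]
    rw [← hcomm.add_pow, add_sub_cancel, one_pow]
  have hta : ∀ m j x, t m j x = ((2 * m).choose j : ℂ) • (S ^ j * (1 - S) ^ (2 * m - j)) x := by
    intro m j x
    rw [ht, ← nsmul_eq_mul', Nat.cast_smul_eq_nsmul]; rfl
  have htn : ∀ m j x, ‖t m j x‖ = ((2 * m).choose j : ℝ) * ‖(S ^ j * (1 - S) ^ (2 * m - j)) x‖ := by
    intro m j x
    rw [hta, norm_smul, Complex.norm_natCast]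
  obtain ⟨a, ha⟩ : ∃ a : ℕ → V, ∀ m, a m =
      ∑ j ∈ (Finset.range (2 * m + 1)).filter (m ≤ ·), t m j (u + v) := ⟨_, fun _ => rfl⟩
  have haJ : ∀ m, a m ∈ J := fun m => by
    rw [ha]
    refine J.sum_mem fun j _ => ?_
    rw [hta]
    exact J.smul_mem _ (hSpow _ _ (hSpow' _ _ huv))
  have hdiff : ∀ m, a m - v = ∑ j ∈ (Finset.range (2 * m + 1)).filter (m ≤ ·), t m j u -
      ∑ j ∈ (Finset.range (2 * m + 1)).filter (¬ m ≤ ·), t m j v := by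
    intro m
    have h1 : v = ∑ j ∈ Finset.range (2 * m + 1), t m j v := by
      rw [← sum_apply, hbin, one_apply_eq_self]
    have h2 := Finset.sum_filter_add_sum_filter_not (Finset.range (2 * m + 1)) (m ≤ ·)
      (fun j => t m j v)
    rw [ha]
    simp only [map_add, Finset.sum_add_distrib]
    rw [← h1] at h2
    nth_rewrite 2 [← h2]
    abel
  have hchoose : ∀ m, ∑ j ∈ Finset.range (2 * m + 1), ((2 * m).choose j : ℝ) = 4 ^ m := by
    intro m
    have := Nat.sum_range_choose (2 * m)
    rw [pow_mul] at this
    exact_mod_cast this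
  have hpart : ∀ (m : ℕ) (s : Finset ℕ), s ⊆ Finset.range (2 * m + 1) → ∀ x : V,
      (∀ j ∈ s, ‖(S ^ j * (1 - S) ^ (2 * m - j)) x‖ ≤ C * (9 / 64) ^ m) →
      ‖∑ j ∈ s, t m j x‖ ≤ C * (9 / 16) ^ m := by
    intro m s hs x hx
    refine (norm_sum_le _ _).trans ?_
    calc _ ≤ ∑ j ∈ s, ((2 * m).choose j : ℝ) * (C * (9 / 64) ^ m) := by
          refine Finset.sum_le_sum fun j hj => ?_
          rw [htn]
          gcongr
          exact hx j hj
      _ ≤ ∑ j ∈ Finset.range (2 * m + 1), ((2 * m).choose j : ℝ) * (C * (9 / 64) ^ m) :=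
          Finset.sum_le_sum_of_subset_of_nonneg hs fun _ _ _ => by positivity
      _ = _ := by
          rw [← Finset.sum_mul, hchoose]
          have : (9 / 16 : ℝ) = 4 * (9 / 64) := by norm_num
          rw [this, mul_pow]; ring
  have harith : ∀ m i j : ℕ, m ≤ i → i + j = 2 * m →
      C * (1 / 8) ^ i * (1 + 1 / 8) ^ j ≤ C * (9 / 64 : ℝ) ^ m := by
    intro m i j hi hij
    have hjm : j ≤ m := by omega
    have : (9 / 64 : ℝ) ^ m = (1 / 8) ^ m * (1 + 1 / 8) ^ m := by
      rw [← mul_pow]; norm_num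
    rw [this, mul_assoc]
    gcongr C * (?_ * ?_)
    · exact pow_le_pow_of_le_one (by norm_num) (by norm_num) hi
    · exact pow_le_pow_right₀ (by norm_num) hjm
  have hbound : ∀ m, ‖a m - v‖ ≤ 2 * C * (9 / 16) ^ m := by
    intro m
    rw [hdiff]
    refine (norm_sub_le _ _).trans ?_
    have h1 := hpart m ((Finset.range (2 * m + 1)).filter (m ≤ ·)) (Finset.filter_subset _ _) u
      (fun j hj => by
        obtain ⟨hj1, hj2⟩ := Finset.mem_filter.mp hj
        have hj3 := Finset.mem_range.mp hj1
        rw [(hcomm.pow_pow _ _).eq]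
        exact (norm_pow_one_sub_pow_apply_le hu _ _).trans (harith m _ _ hj2 (by omega)))
    have h2 := hpart m ((Finset.range (2 * m + 1)).filter (¬ m ≤ ·)) (Finset.filter_subset _ _) v
      (fun j hj => by
        obtain ⟨hj1, hj2⟩ := Finset.mem_filter.mp hj
        have := norm_pow_one_sub_pow_apply_le hv (2 * m - j) j
        rw [sub_sub_cancel] at this
        exact this.trans (harith m _ _ (by omega) (by omega)))
    linarith
  have hlim : Tendsto a atTop (𝓝 v) := by
    rw [tendsto_iff_norm_sub_tendsto_zero]
    have h0 : Tendsto (fun m : ℕ => 2 * C * (9 / 16 : ℝ) ^ m) atTop (𝓝 (2 * C * 0)) :=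
      (tendsto_pow_atTop_nhds_zero_of_lt_one (by norm_num) (by norm_num)).const_mul _
    rw [mul_zero] at h0
    exact squeeze_zero (fun _ => norm_nonneg _) hbound h0
  exact hJ.mem_of_tendsto hlim (Eventually.of_forall haJ)

end Splitting

section Pieces

variable {A : Type*} [NormedRing A] [NormedAlgebra ℂ A]

theorem leftMul_one_add (a : A) : leftMul (1 + a) = 1 + leftMul a := by ext x; simp [add_mul]

theorem rightMul_one_add (a : A) : rightMul (1 + a) = 1 + rightMul a := by ext x; simp [mul_add]

theorem powGrowthOn_rightMul_leftMul {κ κ' e f : A} {s η : ℝ} (c : ℂ)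
    (hs : PowGrowth ((κ - algebraMap ℂ A c) * e) s) (hη : PowGrowth (κ' * f) η)
    (he : e * e = e) (hf : f * f = f) (hκe : Commute κ e) (hκf : Commute κ' f) :
    PowGrowthOn (leftMul (1 + κ') * rightMul (1 + κ) - algebraMap ℂ (A →L[ℂ] A) (1 + c))
      (rightMul e * leftMul f) (s + η * ‖rightMul (1 + κ)‖) := by
  have h := powGrowthOn_add_mul (r := rightMul (1 + κ)) (k := leftMul κ') (e := rightMul e)
    (f := leftMul f) (s := s) (η := η) (1 + c) ?_ ?_ ?_ ?_ (commute_leftMul_rightMul _ _).symm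
    (((Commute.one_left e).add_left hκe).rightMul) (commute_leftMul_rightMul _ _).symm
    (commute_leftMul_rightMul _ _) hκf.leftMul (commute_leftMul_rightMul _ _).symm
  · rwa [leftMul_one_add, add_mul, one_mul]
  · convert hs.rightMul using 1
    ext x
    rw [mul_apply_eq_comp, sub_apply, map_add, map_one, add_apply, one_apply_eq_self]
    simp only [rightMul_apply, Algebra.algebraMap_eq_smul_one, smul_apply, one_apply_eq_self,
      mul_add, mul_sub, sub_mul, mul_one, smul_mul_assoc, mul_smul_comm, one_mul, mul_assoc, hκe.eq]
    abel
  · convert hη.leftMul using 1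
    ext x
    simp [mul_assoc]
  · ext x; simp [mul_assoc, he]
  · ext x; simp [← mul_assoc, hf]

theorem powGrowthOn_leftMul_rightMul {κ κ' e f : A} {s η : ℝ} (c : ℂ)
    (hs : PowGrowth ((κ' - algebraMap ℂ A c) * e) s) (hη : PowGrowth (κ * f) η)
    (he : e * e = e) (hf : f * f = f) (hκe : Commute κ' e) (hκf : Commute κ f) :
    PowGrowthOn (leftMul (1 + κ') * rightMul (1 + κ) - algebraMap ℂ (A →L[ℂ] A) (1 + c))
      (leftMul e * rightMul f) (s + η * ‖leftMul (1 + κ')‖) := by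
  have h := powGrowthOn_add_mul (r := leftMul (1 + κ')) (k := rightMul κ) (e := leftMul e)
    (f := rightMul f) (s := s) (η := η) (1 + c) ?_ ?_ ?_ ?_ (commute_leftMul_rightMul _ _)
    (((Commute.one_left e).add_left hκe).leftMul) (commute_leftMul_rightMul _ _)
    (commute_leftMul_rightMul _ _).symm hκf.rightMul (commute_leftMul_rightMul _ _)
  · rw [(commute_leftMul_rightMul _ _).eq]
    rwa [rightMul_one_add, add_mul, one_mul]
  · convert hs.leftMul using 1
    ext x
    rw [mul_apply_eq_comp, sub_apply, map_add, map_one, add_apply, one_apply_eq_self]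
    simp only [leftMul_apply, Algebra.algebraMap_eq_smul_one, smul_apply, one_apply_eq_self,
      add_mul, sub_mul, one_mul, smul_mul_assoc, mul_assoc]
    abel
  · convert hη.rightMul using 1
    ext x
    simp [mul_assoc, hκf.eq]
  · ext x; simp [← mul_assoc, he]
  · ext x; simp [mul_assoc, hf]

end Pieces

section Aeval

variable {V : Type*} [NormedAddCommGroup V] [NormedSpace ℂ V]

theorem aeval_apply_mem {J : Submodule ℂ V} {U : V →L[ℂ] V} (hU : ∀ x ∈ J, U x ∈ J)
    (f : Polynomial ℂ) : ∀ x ∈ J, Polynomial.aeval U f x ∈ J := by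
  induction f using Polynomial.induction_on with
  | C a =>
    intro x hx
    rw [Polynomial.aeval_C, Algebra.algebraMap_eq_smul_one, smul_apply]
    exact J.smul_mem _ hx
  | add p q hp hq => intro x hx; rw [map_add, add_apply]; exact J.add_mem (hp x hx) (hq x hx)
  | monomial n a ih =>
    intro x hx
    rw [pow_succ, ← mul_assoc, map_mul, Polynomial.aeval_X, mul_apply_eq_comp]
    exact ih _ (hU x hx)

theorem map_aeval_apply {W : Type*} [NormedAddCommGroup W] [NormedSpace ℂ W] {U : V →L[ℂ] V}
    {T : W →L[ℂ] W} (φ : V →ₗ[ℂ] W) (h : ∀ v, φ (U v) = T (φ v)) (f : Polynomial ℂ) :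
    ∀ v, φ (Polynomial.aeval U f v) = Polynomial.aeval T f (φ v) := by
  induction f using Polynomial.induction_on with
  | C a => intro v; simp [Algebra.algebraMap_eq_smul_one]
  | add p q hp hq =>
    intro v
    rw [map_add, map_add, add_apply, add_apply, map_add, hp, hq]
  | monomial n a ih =>
    intro v
    rw [pow_succ, ← mul_assoc, map_mul _ _ Polynomial.X, map_mul _ _ Polynomial.X,
      Polynomial.aeval_X, mul_apply_eq_comp, ih, h, Polynomial.aeval_X, mul_apply_eq_comp]

theorem exists_bound_of_pow_apply_eq_zero {D : V →L[ℂ] V} {v : V} {k : ℕ} (h : (D ^ k) v = 0)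
    {r : ℝ} (hr : 0 < r) : ∃ C, ∀ n, ‖(D ^ n) v‖ ≤ C * r ^ n := by
  refine ⟨∑ i ∈ Finset.range k, ‖(D ^ i) v‖ / r ^ i, fun n => ?_⟩
  rcases lt_or_ge n k with hn | hn
  · rw [← div_le_iff₀ (by positivity)]
    exact Finset.single_le_sum (f := fun i => ‖(D ^ i) v‖ / r ^ i) (fun i _ => by positivity)
      (Finset.mem_range.mpr hn)
  · obtain ⟨j, rfl⟩ := Nat.exists_eq_add_of_le hn
    rw [add_comm k j, pow_add, mul_apply_eq_comp, h, map_zero, norm_zero]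
    exact mul_nonneg (Finset.sum_nonneg fun i _ => by positivity) (by positivity)

end Aeval

section Operators

variable {X : Type*} [NormedAddCommGroup X] [NormedSpace ℂ X]

theorem aeval_mul_mul_apply {g g' : X →L[ℂ] X} {x : X} {z : ℂ} (hx : g x = z • x)
    (f : Polynomial ℂ) (Y : X →L[ℂ] X) :
    (Polynomial.aeval (leftMul g' * rightMul g) f Y) x = Polynomial.aeval (z • g') f (Y x) :=
  map_aeval_apply (ContinuousLinearMap.apply ℂ X x : (X →L[ℂ] X) →ₗ[ℂ] X)
    (fun Y => by simp [hx]) f Y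

theorem finiteDimensional_ker_aeval [CompleteSpace X] {κ : X →L[ℂ] X} (hκ : IsCompactOperator κ)
    {z : ℂ} {f : Polynomial ℂ} (hf : f.eval z ≠ 0) :
    FiniteDimensional ℂ (Polynomial.aeval (z • (1 + κ)) f : X →L[ℂ] X).ker := by
  obtain ⟨h, hh⟩ := Polynomial.X_sub_C_dvd_sub_C_eval (a := z) (p := f)
  have h1 := congrArg (Polynomial.aeval (z • (1 + κ))) hh
  simp only [map_sub, map_mul, Polynomial.aeval_C, Polynomial.aeval_X] at h1
  have h2 : z • (1 + κ) - algebraMap ℂ (X →L[ℂ] X) z = z • κ := by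
    rw [Algebra.algebraMap_eq_smul_one, smul_add]; abel
  rw [h2] at h1
  have hc : IsCompactOperator (z • κ * Polynomial.aeval (z • (1 + κ)) h : X →L[ℂ] X) :=
    IsCompactOperator.comp_clm (f := z • κ) (hκ.smul z) _
  have h3 := finiteDimensional_ker_sub_pow hc (neg_ne_zero.mpr hf) 1
  rw [← h1, pow_one, map_neg, sub_neg_eq_add, sub_add_cancel] at h3
  exact h3

/-- A nonzero polynomial in a bounded operator vanishes on an invariant finite-rank block. -/
theorem exists_aeval_mul_eq_zero {V : Type*} [NormedAddCommGroup V] [NormedSpace ℂ V]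
    {U e : V →L[ℂ] V} (h : Commute U e)
    (he : IsFiniteRank e) : ∃ P : Polynomial ℂ, P ≠ 0 ∧ Polynomial.aeval U P * e = 0 := by
  have : FiniteDimensional ℂ e.range := he
  have hinv : ∀ x ∈ e.range, (U : V →ₗ[ℂ] V) x ∈ e.range := by
    rintro _ ⟨y, rfl⟩
    refine ⟨U y, ?_⟩
    have := congrArg (fun T => T y) h.eq
    exact this.symm
  obtain ⟨u, hu⟩ : ∃ u, u = (U : V →ₗ[ℂ] V).restrict hinv := ⟨_, rfl⟩
  refine ⟨u.charpoly, u.charpoly_monic.ne_zero, ?_⟩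
  have key : ∀ (f : Polynomial ℂ) (y : e.range),
      ((Polynomial.aeval u f y : e.range) : V) = Polynomial.aeval U f y.1 := by
    intro f
    induction f using Polynomial.induction_on with
    | C a => intro y; simp [Algebra.algebraMap_eq_smul_one]
    | add p q hp hq =>
      intro Y
      rw [map_add, map_add, LinearMap.add_apply, add_apply, Submodule.coe_add, hp, hq]
    | monomial n a ih =>
      intro Y
      rw [pow_succ, ← mul_assoc, map_mul _ _ Polynomial.X, map_mul _ _ Polynomial.X,
        Polynomial.aeval_X, Module.End.mul_apply, ih, Polynomial.aeval_X, mul_apply_eq_comp, hu]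
      rfl
  refine ContinuousLinearMap.ext fun y => ?_
  have := key u.charpoly ⟨e y, y, rfl⟩
  rw [LinearMap.aeval_self_charpoly] at this
  exact this.symm

theorem isFiniteRank_leftMul_mul_rightMul {q p : X →L[ℂ] X} (hq : IsFiniteRank q)
    (hp : IsFiniteRank p) : IsFiniteRank (leftMul q * rightMul p) := by
  have : FiniteDimensional ℂ q.range := hq
  have : FiniteDimensional ℂ p.range := hp
  obtain ⟨Φ, hΦ⟩ : ∃ Φ : (p.range →ₗ[ℂ] q.range) →ₗ[ℂ] (X →ₗ[ℂ] X),
      ∀ φ x, Φ φ x = φ ⟨p x, x, rfl⟩ :=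
    ⟨(LinearMap.lcomp ℂ X (p : X →ₗ[ℂ] X).rangeRestrict).comp
      (LinearMap.llcomp ℂ p.range q.range X q.range.subtype), fun _ _ => rfl⟩
  have hmem : ∀ Y : (leftMul q * rightMul p).range,
      ((Y : X →L[ℂ] X) : X →ₗ[ℂ] X) ∈ LinearMap.range Φ := by
    rintro ⟨_, Z, rfl⟩
    refine ⟨((q : X →ₗ[ℂ] X).rangeRestrict.comp (Z : X →ₗ[ℂ] X)).comp p.range.subtype, ?_⟩
    ext x
    rw [hΦ]
    rfl
  have hfin : FiniteDimensional ℂ (LinearMap.range Φ) := inferInstance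
  refine FiniteDimensional.of_injective
    (((ContinuousLinearMap.coeLM ℂ).comp (leftMul q * rightMul p).range.subtype).codRestrict
      (LinearMap.range Φ) hmem) ?_
  intro Y Z h
  have h1 := congrArg Subtype.val h
  exact Subtype.ext (ContinuousLinearMap.coe_injective h1)

end Operators

section Decay

variable {V : Type*} [NormedAddCommGroup V] [NormedSpace ℂ V]

/-- The orbit of `v` under `S` decays at the geometric rate `1 / 8`. -/
def Decays (S : V →L[ℂ] V) (v : V) : Prop := ∃ C : ℝ, ∀ n : ℕ, ‖(S ^ n) v‖ ≤ C * (1 / 8) ^ n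

theorem Decays.add {S : V →L[ℂ] V} {v w : V} (hv : Decays S v) (hw : Decays S w) :
    Decays S (v + w) := by
  obtain ⟨C, hC⟩ := hv
  obtain ⟨D, hD⟩ := hw
  refine ⟨C + D, fun n => ?_⟩
  rw [map_add, add_mul]
  exact (norm_add_le _ _).trans (add_le_add (hC n) (hD n))

theorem Decays.map {S W : V →L[ℂ] V} {v : V} (hv : Decays S v) (h : Commute W S) :
    Decays S (W v) := by
  obtain ⟨C, hC⟩ := hv
  refine ⟨‖W‖ * C, fun n => ?_⟩
  rw [← mul_apply_eq_comp, ← (h.pow_right n).eq, mul_apply_eq_comp, mul_assoc]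
  exact (W.le_opNorm _).trans (by gcongr; exact hC n)

theorem PowGrowthOn.decays {S e : V →L[ℂ] V} {r : ℝ} (h : PowGrowthOn S e r) (hr : 0 ≤ r)
    (hr' : r ≤ 1 / 8) (v : V) : Decays S (e v) := by
  obtain ⟨C, hC⟩ := (h.mono hr hr').exists_bound
  refine ⟨C * ‖v‖, fun n => ?_⟩
  rw [← mul_apply_eq_comp]
  refine (ContinuousLinearMap.le_opNorm _ _).trans ?_
  calc _ ≤ C * (1 / 8) ^ n * ‖v‖ := by gcongr; exact hC n
    _ = _ := by ring

/-- A power of the affine function of `U` which maps `1 + α` to `1` and `1 - α` to `0`. -/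
noncomputable def peakPow (U : V →L[ℂ] V) (α : ℂ) (N : ℕ) : V →L[ℂ] V :=
  ((2 * α)⁻¹ • (U - algebraMap ℂ _ (1 - α))) ^ N

theorem norm_two_mul_inv (α : ℂ) : ‖(2 * α)⁻¹‖ = (2 * ‖α‖)⁻¹ := by simp

theorem PowGrowthOn.decays_peakPow {U e : V →L[ℂ] V} {α : ℂ} {s : ℝ} {N : ℕ}
    (h : PowGrowthOn (U - algebraMap ℂ _ (1 - α)) e s) (hs : 0 ≤ s)
    (hN : ((2 * ‖α‖)⁻¹ * s) ^ N ≤ 1 / 8) (v : V) : Decays (peakPow U α N) (e v) := by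
  have := (h.smul (2 * α)⁻¹).pow N
  rw [norm_two_mul_inv] at this
  exact this.decays (by positivity) hN v

theorem sub_one_eq_smul {U : V →L[ℂ] V} {α : ℂ} (hα : α ≠ 0) :
    (2 * α)⁻¹ • (U - algebraMap ℂ (V →L[ℂ] V) (1 - α)) =
      1 + (2 * α)⁻¹ • (U - algebraMap ℂ (V →L[ℂ] V) (1 + α)) := by
  have h1 : U - algebraMap ℂ (V →L[ℂ] V) (1 - α) =
      (2 * α) • (1 : V →L[ℂ] V) + (U - algebraMap ℂ (V →L[ℂ] V) (1 + α)) := by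
    rw [Algebra.algebraMap_eq_smul_one, Algebra.algebraMap_eq_smul_one]
    module
  rw [h1, smul_add, inv_smul_smul₀ (by simpa using hα)]

theorem PowGrowthOn.decays_one_sub_peakPow {U e : V →L[ℂ] V} {α : ℂ} (hα : α ≠ 0) {r : ℝ} {N : ℕ}
    (h : PowGrowthOn (U - algebraMap ℂ _ (1 + α)) e r) (hr : 0 ≤ r)
    (hN : (1 + (2 * ‖α‖)⁻¹ * r) ^ N - 1 ≤ 1 / 8) (v : V) :
    Decays (1 - peakPow U α N) (e v) := by
  have h1 := (((h.smul (2 * α)⁻¹).one_add_pow_sub_one (by positivity) N).smul (-1))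
  rw [norm_two_mul_inv, norm_neg, norm_one, one_mul, ← sub_one_eq_smul hα, neg_one_smul,
    neg_sub] at h1
  refine h1.decays ?_ hN v
  rw [sub_nonneg]
  exact one_le_pow₀ (le_add_of_nonneg_right (by positivity))

theorem exists_aeval_eq_peakPow (U : V →L[ℂ] V) {α : ℂ} (hα : α ≠ 0) (N : ℕ) :
    ∃ F : Polynomial ℂ, F.eval (1 + α) = 1 ∧ Polynomial.aeval U F = peakPow U α N := by
  refine ⟨(Polynomial.C (2 * α)⁻¹ * (Polynomial.X - Polynomial.C (1 - α))) ^ N, ?_, ?_⟩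
  · have : (2 * α)⁻¹ * (1 + α - (1 - α)) = 1 := by field_simp; ring
    simp only [Polynomial.eval_pow, Polynomial.eval_mul, Polynomial.eval_C, Polynomial.eval_sub,
      Polynomial.eval_X, this, one_pow]
  · rw [map_pow, map_mul, map_sub, Polynomial.aeval_C, Polynomial.aeval_X, Polynomial.aeval_C,
      peakPow, ← Algebra.smul_def]

theorem decays_one_sub_peakPow_aeval {U : V →L[ℂ] V} {α : ℂ} (hα : α ≠ 0) (N : ℕ) {k : ℕ}
    {χ : Polynomial ℂ} {w : V}
    (h : Polynomial.aeval U ((Polynomial.X - Polynomial.C (1 + α)) ^ k * χ) w = 0) :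
    Decays (1 - peakPow U α N) (Polynomial.aeval U χ w) := by
  obtain ⟨F, hF1, hF⟩ := exists_aeval_eq_peakPow U hα N
  have hroot : (1 - F).IsRoot (1 + α) := by simp [hF1]
  obtain ⟨H, hH⟩ := Polynomial.dvd_iff_isRoot.mpr hroot
  refine exists_bound_of_pow_apply_eq_zero (k := k) ?_ (by norm_num)
  have h1 : (1 - peakPow U α N) ^ k * Polynomial.aeval U χ = Polynomial.aeval U (H ^ k) *
      Polynomial.aeval U ((Polynomial.X - Polynomial.C (1 + α)) ^ k * χ) := by
    rw [← hF, ← map_one (Polynomial.aeval (R := ℂ) U), ← map_sub, ← map_pow, ← map_mul, ← map_mul,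
        hH, mul_pow]
    congr 1
    ring
  rw [← mul_apply_eq_comp, h1, mul_apply_eq_comp, h, map_zero]

theorem aeval_mem_of_decay {U : V →L[ℂ] V} {J : Submodule ℂ V} (hJ : IsClosed (J : Set V))
    (hU : ∀ x ∈ J, U x ∈ J) {α : ℂ} (hα : α ≠ 0) {N : ℕ} (χ : Polynomial ℂ) {k : ℕ} {u v w : V}
    (hT : u + v + w ∈ J) (hu : Decays (peakPow U α N) u) (hv : Decays (1 - peakPow U α N) v)
    (hw : Polynomial.aeval U ((Polynomial.X - Polynomial.C (1 + α)) ^ k * χ) w = 0) :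
    Polynomial.aeval U χ (v + w) ∈ J := by
  obtain ⟨F, -, hF⟩ := exists_aeval_eq_peakPow U hα N
  have hc : Commute (Polynomial.aeval U χ) (peakPow U α N) := hF ▸ Commute.map (Commute.all χ F) _
  have hsum := aeval_apply_mem hU χ _ hT
  rw [add_assoc, map_add] at hsum
  obtain ⟨C, hC⟩ := hu.map hc
  have hd : Decays (1 - peakPow U α N) (Polynomial.aeval U χ (v + w)) := by
    rw [map_add]
    exact (hv.map ((Commute.one_right _).sub_right hc)).add (decays_one_sub_peakPow_aeval hα N hw)
  obtain ⟨D, hD⟩ := hd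
  refine mem_of_add_mem_of_decay hJ (S := peakPow U α N) ?_ hsum (C := max C D) ?_ ?_
  · rw [← hF]; exact aeval_apply_mem hU F
  · exact fun n => (hC n).trans (by gcongr; exact le_max_left _ _)
  · exact fun n => (hD n).trans (by gcongr; exact le_max_right _ _)

end Decay

section Peripheral

variable {X : Type*} [NormedAddCommGroup X] [NormedSpace ℂ X] [CompleteSpace X]

theorem norm_add_lt_of_ne {z α : ℂ} (h : ‖z‖ ≤ ‖α‖) (hne : z ≠ α) : ‖z + α‖ < 2 * ‖α‖ := by
  by_contra! hge
  have hp := parallelogram_law_with_norm ℝ z α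
  have h1 : 0 < ‖z - α‖ := norm_pos_iff.mpr (sub_ne_zero.mpr hne)
  nlinarith [norm_nonneg z, norm_nonneg α, norm_nonneg (z + α)]

theorem exists_peripheral_idempotent {κ : X →L[ℂ] X} (hκ : IsCompactOperator κ) {α : ℂ}
    (hα : α ≠ 0) (hmax : ∀ z ∈ spectrum ℂ κ, ‖z‖ ≤ ‖α‖) :
    ∃ (m : ℕ) (p : X →L[ℂ] X) (s : ℝ), p * p = p ∧ IsFiniteRank p ∧
      (κ - algebraMap ℂ _ α) ^ m * p = 0 ∧ 0 < s ∧ s < 2 * ‖α‖ ∧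
      PowGrowth ((κ - algebraMap ℂ _ (-α)) * (1 - p)) s ∧ Commute κ p ∧
      ∀ x, κ x = α • x → p x = x := by
  obtain ⟨m, p, hp, hfin, hm, hσ, hc⟩ := exists_spectral_idempotent hκ hα
  have hα' : 0 < 2 * ‖α‖ := by positivity
  obtain ⟨s, hs0, hs, hg⟩ := powGrowth_of_spectrum (a := (κ - algebraMap ℂ _ (-α)) * (1 - p)) hα'
    (fun l hl => by
      rcases eq_or_ne l 0 with rfl | hl0
      · simpa using hα
      · obtain ⟨h1, h2⟩ := hσ _ l hl hl0
        have := norm_add_lt_of_ne (hmax _ h1) h2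
        rwa [neg_add_cancel_right] at this)
  have hκp : Commute κ p := hc κ (Commute.refl κ)
  refine ⟨m, p, s, hp, hfin, hm, hs0, hs, hg, hκp, fun x hx => ?_⟩
  by_contra hne
  have hy : x - p x ≠ 0 := fun h => hne (sub_eq_zero.mp h).symm
  have hpκ : κ (p x) = α • p x := by
    rw [← mul_apply_eq_comp, hκp.eq, mul_apply_eq_comp, hx, map_smul]
  have hpp : p (p x) = p x := by rw [← mul_apply_eq_comp, hp]
  have hmem : α ∈ spectrum ℂ ((κ - algebraMap ℂ _ 0) * (1 - p)) := by
    refine mem_spectrum_of_eigenvector hy ?_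
    rw [map_zero, sub_zero, mul_apply_eq_comp, sub_apply, one_apply_eq_self, map_sub p, hpp,
        sub_self,
      sub_zero, map_sub, hx, hpκ, smul_sub]
  exact (hσ 0 α hmem hα).2 (add_zero α)

end Peripheral

section AevalCommute

theorem commute_aeval {A : Type*} [Ring A] [Algebra ℂ A] {a b : A} (h : Commute a b)
    (f : Polynomial ℂ) : Commute (Polynomial.aeval a f) b := by
  induction f using Polynomial.induction_on' with
  | add p q hp hq => rw [map_add]; exact hp.add_left hq
  | monomial n c =>
    rw [Polynomial.aeval_monomial]
    exact (show Commute (algebraMap ℂ A c) b from Algebra.commutes c b).mul_left (h.pow_left n)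

variable {V : Type*} [NormedAddCommGroup V] [NormedSpace ℂ V]

theorem aeval_apply_eq_zero_of_commute {U L : V →L[ℂ] V} (h : Commute U L) {f : Polynomial ℂ}
    {v : V} (hv : Polynomial.aeval U f v = 0) : Polynomial.aeval U f (L v) = 0 := by
  have h1 := congrArg (fun S : V →L[ℂ] V => S v) (commute_aeval h f).eq
  simp only [mul_apply_eq_comp, hv, map_zero] at h1
  exact h1

variable (V) in
/-- The space of bounded operators of finite rank. -/
def finiteRankSubmodule : Submodule ℂ (V →L[ℂ] V) where
  carrier := {T | IsFiniteRank T}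
  add_mem' h h' := h.add h'
  zero_mem' := isFiniteRank_zero
  smul_mem' c _ h := h.smul c

end AevalCommute

section PeripheralOrbit

variable {X : Type*} [NormedAddCommGroup X] [NormedSpace ℂ X] [CompleteSpace X]

theorem exists_growth_parameters {D s : ℝ} (M : ℝ) (hs0 : 0 ≤ s) (hs : s < D) :
    ∃ (N : ℕ) (η : ℝ), 0 < η ∧ (D⁻¹ * (s + η * M)) ^ N ≤ 1 / 8 ∧
      (1 + D⁻¹ * (η + η * M)) ^ N - 1 ≤ 1 / 8 := by
  have hD : 0 < D := hs0.trans_lt hs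
  have h1 : D⁻¹ * s < 1 := by rwa [inv_mul_lt_iff₀ hD, mul_one]
  obtain ⟨N, hN⟩ := exists_pow_lt_of_lt_one (show (0 : ℝ) < 1 / 8 by norm_num) h1
  have h2 : Tendsto (fun η : ℝ => (D⁻¹ * (s + η * M)) ^ N) (𝓝[>] 0) (𝓝 ((D⁻¹ * (s + 0 * M)) ^ N)) :=
    (Continuous.tendsto (by fun_prop) 0).mono_left nhdsWithin_le_nhds
  have h3 : Tendsto (fun η : ℝ => (1 + D⁻¹ * (η + η * M)) ^ N - 1) (𝓝[>] 0)
      (𝓝 ((1 + D⁻¹ * (0 + 0 * M)) ^ N - 1)) :=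
    (Continuous.tendsto (by fun_prop) 0).mono_left nhdsWithin_le_nhds
  have h4 := h2.eventually_lt_const (u := 1 / 8) (by simpa using hN)
  have h5 := h3.eventually_lt_const (u := 1 / 8) (by norm_num)
  obtain ⟨η, ⟨h6, h7⟩, h8⟩ := ((h4.and h5).and self_mem_nhdsWithin).exists
  exact ⟨N, η, h8, h6.le, h7.le⟩

omit [CompleteSpace X] in
theorem isFiniteRank_block {p q f : X →L[ℂ] X} (hp : IsFiniteRank p) (hq : IsFiniteRank q)
    (hf : IsFiniteRank f) (e T : X →L[ℂ] X) :
    IsFiniteRank ((rightMul p * leftMul (1 - f)) T + (leftMul q * rightMul (1 - e)) (f * T) +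
      (leftMul f * rightMul e) T) := by
  refine (IsFiniteRank.add ?_ ?_).add ?_
  · exact IsFiniteRank.mul_left hp _
  · exact IsFiniteRank.mul_right hq _
  · exact IsFiniteRank.mul_right hf _

omit [CompleteSpace X] in
theorem leftMul_one_sub_block {q f : X →L[ℂ] X} (hf : f * f = f) (hc : Commute q f)
    (p e T : X →L[ℂ] X) :
    leftMul (1 - f) ((rightMul p * leftMul (1 - f)) T +
      (leftMul q * rightMul (1 - e)) (f * T) + (leftMul f * rightMul e) T) = (1 - f) * T * p := by
  have h0 : (1 - f) * f = 0 := by rw [sub_mul, one_mul, hf, sub_self]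
  have h1 : (1 - f) * (1 - f) = 1 - f := by rw [mul_sub, h0, mul_one, sub_zero]
  have h2 : (1 - f) * q * f = 0 := by rw [mul_assoc, hc.eq, ← mul_assoc, h0, zero_mul]
  simp only [mul_apply_eq_comp, leftMul_apply, rightMul_apply, mul_add, ← mul_assoc, h0, h1, h2,
    zero_mul, add_zero]

omit [CompleteSpace X] in
theorem isFiniteRank_aeval (a b : X →L[ℂ] X) (f : Polynomial ℂ) {T : X →L[ℂ] X}
    (hT : IsFiniteRank T) : IsFiniteRank (Polynomial.aeval (leftMul a * rightMul b) f T) :=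
  aeval_apply_mem (J := finiteRankSubmodule X) (U := leftMul a * rightMul b)
    (fun _ hS => IsFiniteRank.mul_left (IsFiniteRank.mul_right hS b) a) f T hT

set_option maxHeartbeats 1000000 in
/-- Let `J` be a closed space of operators without nonzero operators of finite rank which is
invariant under `T ↦ (1 + κ') * T * (1 + κ)` with `κ` and `κ'` compact. Then the `J`-orbit of
an eigenvector of `κ` at a nonzero peripheral eigenvalue of the pair is finite-dimensional. -/
theorem exists_finiteDimensional_orbit {κ κ' : X →L[ℂ] X} (hκ : IsCompactOperator κ)
    (hκ' : IsCompactOperator κ') {J : Submodule ℂ (X →L[ℂ] X)}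
    (hJ : IsClosed (J : Set (X →L[ℂ] X)))
    (hU : ∀ T ∈ J, (1 + κ') * T * (1 + κ) ∈ J) (hfr : ∀ T ∈ J, IsFiniteRank T → T = 0) {α : ℂ}
    (hα : α ≠ 0) (hmem : α ∈ spectrum ℂ κ) (hmax : ∀ z ∈ spectrum ℂ κ, ‖z‖ ≤ ‖α‖)
    (hmax' : ∀ z ∈ spectrum ℂ κ', ‖z‖ ≤ ‖α‖) :
    ∃ x : X, x ≠ 0 ∧ ∃ Y : Submodule ℂ X, FiniteDimensional ℂ Y ∧ ∀ T ∈ J, T x ∈ Y := by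
  obtain ⟨m, p, s, hp, hpfin, hpm, hs0, hs, hps, hpκ, hpx⟩ :=
    exists_peripheral_idempotent hκ hα hmax
  obtain ⟨m', q, s', hq, hqfin, hqm, hs0', hs', hqs, hqκ, -⟩ :=
    exists_peripheral_idempotent hκ' hα hmax'
  obtain ⟨M, hM⟩ : ∃ M, M = ‖rightMul (1 + κ)‖ + ‖leftMul (1 + κ')‖ := ⟨_, rfl⟩
  have hM0 : 0 ≤ M := hM ▸ by positivity
  have hMr : ‖rightMul (1 + κ)‖ ≤ M := hM ▸ le_add_of_nonneg_right (norm_nonneg _)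
  have hMl : ‖leftMul (1 + κ')‖ ≤ M := hM ▸ le_add_of_nonneg_left (norm_nonneg _)
  obtain ⟨N, η, hη, hN1, hN2⟩ := exists_growth_parameters M (D := 2 * ‖α‖) (s := max s s')
    (le_max_of_le_left hs0.le) (max_lt hs hs')
  obtain ⟨pf, hpf, hpffin, hpfc, hpfη⟩ := exists_idempotent_powGrowth hκ hη
  obtain ⟨qf, hqf, hqffin, hqfc, hqfη⟩ := exists_idempotent_powGrowth hκ' hη
  have hpfκ : Commute κ pf := hpfc κ (Commute.refl κ)
  have hqfκ : Commute κ' qf := hqfc κ' (Commute.refl κ')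
  have compl : ∀ {e : X →L[ℂ] X}, e * e = e → (1 - e) * (1 - e) = 1 - e := fun h => by
    rw [mul_sub, mul_one, sub_mul, one_mul, h, sub_self, sub_zero]
  have complc : ∀ {a e : X →L[ℂ] X}, Commute a e → Commute a (1 - e) := fun h =>
    (Commute.one_right _).sub_right h
  have hnil : ∀ {a e : X →L[ℂ] X} {j : ℕ}, e * e = e → Commute a e →
      (a - algebraMap ℂ _ α) ^ j * e = 0 → PowGrowth ((a - algebraMap ℂ _ α) * e) η := by
    intro a e j he hc hj
    have hce : Commute (a - algebraMap ℂ _ α) e := hc.sub_left (Algebra.commutes α e)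
    refine powGrowth_of_pow_eq_zero (m := j + 1) ?_ hη
    rw [hce.mul_pow, pow_succ' e, ← mul_assoc, pow_succ', mul_assoc _ _ e, hj, mul_zero, zero_mul]
  obtain ⟨U, hUdef⟩ : ∃ U, U = leftMul (1 + κ') * rightMul (1 + κ) := ⟨_, rfl⟩
  have hUJ : ∀ T ∈ J, U T ∈ J := fun T hT => by
    have := hU T hT
    rw [mul_assoc] at this
    rw [hUdef]
    exact this
  have hle : ∀ {t r}, t ≤ max s s' → 0 ≤ r → r ≤ M → t + η * r ≤ max s s' + η * M :=
    fun h _ h' => by gcongr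
  have hle' : ∀ {r}, r ≤ M → η + η * r ≤ η + η * M := fun h => by gcongr
  have g1 : PowGrowthOn (U - algebraMap ℂ _ (1 - α)) (rightMul (1 - p) * leftMul (1 - qf))
      (max s s' + η * M) := by
    have := powGrowthOn_rightMul_leftMul (-α) hps hqfη (compl hp) (compl hqf) (complc hpκ)
      (complc hqfκ)
    rw [← sub_eq_add_neg, ← hUdef] at this
    exact this.mono (by positivity) (hle (le_max_left _ _) (norm_nonneg _) hMr)
  have g2 : PowGrowthOn (U - algebraMap ℂ _ (1 - α)) (leftMul (1 - q) * rightMul (1 - pf))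
      (max s s' + η * M) := by
    have := powGrowthOn_leftMul_rightMul (-α) hqs hpfη (compl hq) (compl hpf) (complc hqκ)
      (complc hpfκ)
    rw [← sub_eq_add_neg, ← hUdef] at this
    exact this.mono (by positivity) (hle (le_max_right _ _) (norm_nonneg _) hMl)
  have g3 : PowGrowthOn (U - algebraMap ℂ _ (1 + α)) (rightMul p * leftMul (1 - qf))
      (η + η * M) := by
    have := powGrowthOn_rightMul_leftMul α (hnil hp hpκ hpm) hqfη hp (compl hqf) hpκ (complc hqfκ)
    rw [← hUdef] at this
    exact this.mono (by positivity) (hle' hMr)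
  have g4 : PowGrowthOn (U - algebraMap ℂ _ (1 + α)) (leftMul q * rightMul (1 - pf))
      (η + η * M) := by
    have := powGrowthOn_leftMul_rightMul α (hnil hq hqκ hqm) hpfη hq (compl hpf) hqκ (complc hpfκ)
    rw [← hUdef] at this
    exact this.mono (by positivity) (hle' hMl)
  have hcl : ∀ {e : X →L[ℂ] X}, Commute κ' e → Commute U (leftMul e) := fun h => by
    rw [hUdef]
    exact (((Commute.one_left _).add_left h).leftMul).mul_left (commute_leftMul_rightMul _ _).symm
  have hcr : ∀ {e : X →L[ℂ] X}, Commute κ e → Commute U (rightMul e) := fun h => by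
    rw [hUdef]
    exact (commute_leftMul_rightMul _ _).mul_left (((Commute.one_left _).add_left h).rightMul)
  obtain ⟨P, hP0, hP⟩ := exists_aeval_mul_eq_zero ((hcl hqfκ).mul_right (hcr hpfκ))
    (isFiniteRank_leftMul_mul_rightMul hqffin hpffin)
  obtain ⟨χ, hχ, hχd⟩ := Polynomial.exists_eq_pow_rootMultiplicity_mul_and_not_dvd P hP0 (1 + α)
  have hχ0 : χ.eval (1 + α) ≠ 0 := fun h => hχd (Polynomial.dvd_iff_isRoot.mpr h)
  have hvanish : ∀ T ∈ J, Polynomial.aeval U χ ((1 - qf) * T * p) = 0 := by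
    intro T hT
    have hd := aeval_mem_of_decay hJ hUJ hα (N := N) χ (k := P.rootMultiplicity (1 + α))
      (u := (rightMul (1 - p) * leftMul (1 - qf)) T +
        (leftMul (1 - q) * rightMul (1 - pf)) (qf * T))
      (v := (rightMul p * leftMul (1 - qf)) T + (leftMul q * rightMul (1 - pf)) (qf * T))
      (w := (leftMul qf * rightMul pf) T) (by
        convert hT using 1
        simp only [mul_apply_eq_comp, leftMul_apply, rightMul_apply]
        noncomm_ring)
      ((g1.decays_peakPow (by positivity) hN1 _).add (g2.decays_peakPow (by positivity) hN1 _))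
      ((g3.decays_one_sub_peakPow hα (by positivity) hN2 _).add
        (g4.decays_one_sub_peakPow hα (by positivity) hN2 _))
      (by rw [← hχ, ← mul_apply_eq_comp, hP]; rfl)
    rw [hUdef] at hd
    have hz := hfr _ hd (isFiniteRank_aeval _ _ _ (isFiniteRank_block hpfin hqfin hqffin pf T))
    rw [← hUdef] at hz
    have h1 := aeval_apply_eq_zero_of_commute (hcl (complc hqfκ)) hz
    rwa [leftMul_one_sub_block hqf (hqfc q hqκ.symm)] at h1
  obtain ⟨x, hx0, hx⟩ := exists_eigenvector hκ hα hmem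
  have : FiniteDimensional ℂ qf.range := hqffin
  have := finiteDimensional_ker_aeval hκ' hχ0
  refine ⟨x, hx0, (Polynomial.aeval ((1 + α) • (1 + κ')) χ : X →L[ℂ] X).ker ⊔ qf.range,
    inferInstance, fun T hT => ?_⟩
  have h1 := congrArg (fun S => S x) (hvanish T hT)
  have hgx : (1 + κ) x = (1 + α) • x := by
    rw [add_apply, one_apply_eq_self, hx, add_smul, one_smul]
  simp only [hUdef] at h1
  rw [aeval_mul_mul_apply hgx, mul_apply_eq_comp, mul_apply_eq_comp, hpx x hx] at h1
  have h2 : T x = (1 - qf) (T x) + qf (T x) := by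
    rw [sub_apply, one_apply_eq_self, sub_add_cancel]
  rw [h2]
  exact Submodule.add_mem_sup h1 ⟨T x, rfl⟩

end PeripheralOrbit

section JordanIdentities

variable {R : Type*} [Ring R] [Algebra ℂ R]

theorem jordan_mul_mul_mem {J : Submodule ℂ R} (hJ : ∀ A ∈ J, ∀ B ∈ J, A * B + B * A ∈ J) {A T : R}
    (hA : A ∈ J) (hT : T ∈ J) : A * T * A ∈ J := by
  have h1 := hJ A hA _ (hJ A hA T hT)
  have h2 := hJ _ (hJ A hA A hA) T hT
  have h3 : A * T * A = (1 / 2 : ℂ) • (A * (A * T + T * A) + (A * T + T * A) * A) -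
      (1 / 4 : ℂ) • ((A * A + A * A) * T + T * (A * A + A * A)) := by
    simp only [mul_add, add_mul, smul_add, ← mul_assoc]
    module
  rw [h3]
  exact J.sub_mem (J.smul_mem _ h1) (J.smul_mem _ h2)

theorem jordan_prod_one_add_mem {J : Submodule ℂ R} (hJ : ∀ A ∈ J, ∀ B ∈ J, A * B + B * A ∈ J)
    {l : List R} (hl : ∀ A ∈ l, A ∈ J) {T : R} (hT : T ∈ J) :
    (l.reverse.map (1 + ·)).prod * T * (l.map (1 + ·)).prod ∈ J := by
  induction l generalizing T with
  | nil => simpa using hT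
  | cons A t ih =>
    have hA := hl A List.mem_cons_self
    have h : (1 + A) * T * (1 + A) ∈ J := by
      have : (1 + A) * T * (1 + A) = T + (A * T + T * A) + A * T * A := by noncomm_ring
      rw [this]
      exact J.add_mem (J.add_mem hT (hJ A hA T hT)) (jordan_mul_mul_mem hJ hA hT)
    have h' := ih (fun B hB => hl B (List.mem_cons_of_mem _ hB)) h
    convert h' using 1
    simp [mul_assoc]

end JordanIdentities

section QuasinilpotentWords

variable {X : Type*} [NormedAddCommGroup X] [NormedSpace ℂ X]

theorem isCompactOperator_prod_one_add_sub_one {l : List (X →L[ℂ] X)}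
    (hl : ∀ A ∈ l, IsCompactOperator A) :
    IsCompactOperator ((l.map (1 + ·)).prod - 1 : X →L[ℂ] X) := by
  induction l with
  | nil =>
    simp only [List.map_nil, List.prod_nil, sub_self]
    exact isCompactOperator_zero
  | cons A t ih =>
    have h1 := ih fun B hB => hl B (List.mem_cons_of_mem _ hB)
    have h2 : IsCompactOperator (A * (t.map (1 + ·)).prod : X →L[ℂ] X) :=
      (hl A List.mem_cons_self).comp_clm _
    have h3 : ((A :: t).map (1 + ·)).prod - 1 =
        ((t.map (1 + ·)).prod - 1) + A * (t.map (1 + ·)).prod := by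
      rw [List.map_cons, List.prod_cons, add_mul, one_mul]; abel
    rw [h3]
    exact h1.add h2

variable [CompleteSpace X]

theorem spectrum_prod_one_add_sub_one_subset {J : Submodule ℂ (X →L[ℂ] X)}
    (hcl : IsClosed (J : Set (X →L[ℂ] X))) (hJ : ∀ A ∈ J, ∀ B ∈ J, A * B + B * A ∈ J)
    (hc : ∀ A ∈ J, IsCompactOperator A) (hfr : ∀ T ∈ J, IsFiniteRank T → T = 0)
    (horb : ∀ x : X, x ≠ 0 → ¬ ∃ Y : Submodule ℂ X, FiniteDimensional ℂ Y ∧ ∀ T ∈ J, T x ∈ Y)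
    {l : List (X →L[ℂ] X)} (hl : ∀ A ∈ l, A ∈ J) :
    spectrum ℂ ((l.map (1 + ·)).prod - 1) ⊆ {0} := by
  by_contra hne
  obtain ⟨z, hz, hz0⟩ := Set.not_subset.mp hne
  have hl' : ∀ A ∈ l.reverse, A ∈ J := fun A hA => hl A (List.mem_reverse.mp hA)
  obtain ⟨κ, hκ⟩ : ∃ κ : X →L[ℂ] X, κ = (l.map (1 + ·)).prod - 1 := ⟨_, rfl⟩
  obtain ⟨κ', hκ'⟩ : ∃ κ : X →L[ℂ] X, κ = (l.reverse.map (1 + ·)).prod - 1 := ⟨_, rfl⟩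
  have hκc : IsCompactOperator κ :=
    hκ ▸ isCompactOperator_prod_one_add_sub_one fun A hA => hc A (hl A hA)
  have hκc' : IsCompactOperator κ' :=
    hκ' ▸ isCompactOperator_prod_one_add_sub_one fun A hA => hc A (hl' A hA)
  have hU : ∀ T ∈ J, (1 + κ') * T * (1 + κ) ∈ J := fun T hT => by
    rw [hκ, hκ', add_sub_cancel, add_sub_cancel]
    exact jordan_prod_one_add_mem hJ hl hT
  have hU' : ∀ T ∈ J, (1 + κ) * T * (1 + κ') ∈ J := fun T hT => by
    rw [hκ, hκ', add_sub_cancel, add_sub_cancel]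
    simpa using jordan_prod_one_add_mem hJ hl' hT
  rw [← hκ] at hz
  obtain ⟨α, hα, hmax⟩ := ((spectrum.isCompact (𝕜 := ℂ) κ).union
    (spectrum.isCompact (𝕜 := ℂ) κ')).exists_isMaxOn ⟨z, Or.inl hz⟩ continuous_norm.continuousOn
  have hm : ∀ y ∈ spectrum ℂ κ, ‖y‖ ≤ ‖α‖ := fun y hy => hmax (Or.inl hy)
  have hm' : ∀ y ∈ spectrum ℂ κ', ‖y‖ ≤ ‖α‖ := fun y hy => hmax (Or.inr hy)
  have hα0 : α ≠ 0 := by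
    rintro rfl
    exact hz0 (by simpa using hm z hz)
  rcases hα with hα | hα
  · obtain ⟨x, hx0, hx⟩ := exists_finiteDimensional_orbit hκc hκc' hcl hU hfr hα0 hα hm hm'
    exact horb x hx0 hx
  · obtain ⟨x, hx0, hx⟩ := exists_finiteDimensional_orbit hκc' hκc hcl hU' hfr hα0 hα hm' hm
    exact horb x hx0 hx

omit [CompleteSpace X] in
theorem isCompactOperator_list_prod {l : List (X →L[ℂ] X)} (hl0 : l ≠ [])
    (hl : ∀ A ∈ l, IsCompactOperator A) : IsCompactOperator (l.prod : X →L[ℂ] X) := by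
  cases l with
  | nil => exact absurd rfl hl0
  | cons A t =>
    rw [List.prod_cons]
    have : IsCompactOperator (⇑A ∘ ⇑t.prod) := (hl A List.mem_cons_self).comp_clm _
    exact this

theorem prod_smul_one_add {R : Type*} [Ring R] [Algebra ℂ R] {s : ℂ} (hs : s ≠ 0) (l : List R) :
    (l.map (s • (1 : R) + ·)).prod = s ^ l.length • ((l.map (s⁻¹ • ·)).map (1 + ·)).prod := by
  induction l with
  | nil => simp
  | cons A t ih =>
    have h : s • (1 : R) + A = s • (1 + s⁻¹ • A) := by rw [smul_add, smul_inv_smul₀ hs]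
    simp only [List.map_cons, List.prod_cons, List.length_cons, ih, h, pow_succ', smul_mul_assoc,
      mul_smul_comm, mul_smul]
    rw [smul_comm]

omit [CompleteSpace X] in
theorem continuous_prod_smul_one_add (l : List (X →L[ℂ] X)) :
    Continuous fun s : ℂ => (l.map (s • (1 : X →L[ℂ] X) + ·)).prod := by
  induction l with
  | nil => simpa using continuous_const
  | cons A t ih =>
    simp only [List.map_cons, List.prod_cons]
    exact ((continuous_id.smul continuous_const).add continuous_const).mul ih

theorem spectrum_list_prod_subset {J : Submodule ℂ (X →L[ℂ] X)}
    (hcl : IsClosed (J : Set (X →L[ℂ] X))) (hJ : ∀ A ∈ J, ∀ B ∈ J, A * B + B * A ∈ J)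
    (hc : ∀ A ∈ J, IsCompactOperator A) (hfr : ∀ T ∈ J, IsFiniteRank T → T = 0)
    (horb : ∀ x : X, x ≠ 0 → ¬ ∃ Y : Submodule ℂ X, FiniteDimensional ℂ Y ∧ ∀ T ∈ J, T x ∈ Y)
    {l : List (X →L[ℂ] X)} (hl0 : l ≠ []) (hl : ∀ A ∈ l, A ∈ J) :
    spectrum ℂ l.prod ⊆ {0} := by
  by_contra hne
  obtain ⟨z, hz, hz0⟩ := Set.not_subset.mp hne
  have hz0' : z ≠ 0 := hz0
  have hlen : l.length ≠ 0 := by simpa using hl0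
  have hpos : 0 < ‖z‖ / 2 := by positivity
  have h1 := eventually_exists_spectrum_near
    (isCompactOperator_list_prod hl0 fun A hA => hc A (hl A hA)) hz0' hz hpos
  have h2 : Tendsto (fun s : ℂ => (l.map (s • (1 : X →L[ℂ] X) + ·)).prod) (𝓝[≠] 0)
      (𝓝 l.prod) := by
    have := ((continuous_prod_smul_one_add l).tendsto 0).mono_left
      (nhdsWithin_le_nhds (s := {0}ᶜ))
    simpa using this
  have h3 : Tendsto (fun s : ℂ => ‖s ^ l.length‖) (𝓝[≠] 0) (𝓝 0) := by
    have := ((by fun_prop : Continuous fun s : ℂ => ‖s ^ l.length‖).tendsto 0).mono_left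
      (nhdsWithin_le_nhds (s := {0}ᶜ))
    simpa [hlen] using this
  obtain ⟨s, ⟨⟨m, hm, hmz⟩, hs⟩, hs0⟩ :=
    (((h2.eventually h1).and (h3.eventually_lt_const hpos)).and self_mem_nhdsWithin).exists
  have hs0' : s ≠ 0 := hs0
  rw [prod_smul_one_add hs0'] at hm
  have hl' : ∀ A ∈ l.map (s⁻¹ • ·), A ∈ J := by
    intro A hA
    obtain ⟨B, hB, rfl⟩ := List.mem_map.mp hA
    exact J.smul_mem _ (hl B hB)
  have h4 := spectrum_prod_one_add_sub_one_subset hcl hJ hc hfr horb hl'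
  have hu : IsUnit (s ^ l.length) := (pow_ne_zero _ hs0').isUnit
  have h5 : m = s ^ l.length := by
    have h6 : (s ^ l.length)⁻¹ * m - 1 ∈
        spectrum ℂ (((l.map (s⁻¹ • ·)).map (1 + ·)).prod - 1 : X →L[ℂ] X) := by
      have h7 := spectrum.smul_mem_smul_iff (r := Units.mk0 (s ^ l.length) hu.ne_zero)
        (s := (s ^ l.length)⁻¹ * m) (a := ((l.map (s⁻¹ • ·)).map (1 + ·)).prod)
      have h8 : (s ^ l.length)⁻¹ * m ∈
          spectrum ℂ (((l.map (s⁻¹ • ·)).map (1 + ·)).prod : X →L[ℂ] X) := by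
        refine h7.mp ?_
        simp only [Units.smul_def, Units.val_mk0, smul_eq_mul]
        rwa [mul_inv_cancel_left₀ hu.ne_zero]
      have h9 := spectrum.sub_singleton_eq (((l.map (s⁻¹ • ·)).map (1 + ·)).prod : X →L[ℂ] X)
        (1 : ℂ)
      rw [map_one] at h9
      rw [← h9]
      exact Set.sub_mem_sub h8 rfl
    have h7 : (s ^ l.length)⁻¹ * m - 1 = 0 := h4 h6
    rw [sub_eq_zero, inv_mul_eq_one₀ hu.ne_zero] at h7
    exact h7.symm
  rw [h5] at hmz
  have := norm_sub_norm_le z (s ^ l.length)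
  rw [norm_sub_rev] at this
  linarith

theorem exists_invariant_of_no_finiteRank {J : Submodule ℂ (X →L[ℂ] X)}
    (hcl : IsClosed (J : Set (X →L[ℂ] X))) (hJ : ∀ A ∈ J, ∀ B ∈ J, A * B + B * A ∈ J)
    (hc : ∀ A ∈ J, IsCompactOperator A) (hfr : ∀ T ∈ J, IsFiniteRank T → T = 0) (hJ0 : J ≠ ⊥) :
    ∃ M : Submodule ℂ X, IsClosed (M : Set X) ∧ M ≠ ⊥ ∧ M ≠ ⊤ ∧ ∀ A ∈ J, ∀ x ∈ M, A x ∈ M := by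
  obtain ⟨A, hA, hA0⟩ := J.ne_bot_iff.mp hJ0
  by_cases horb : ∃ x : X, x ≠ 0 ∧ ∃ Y : Submodule ℂ X, FiniteDimensional ℂ Y ∧ ∀ T ∈ J, T x ∈ Y
  · obtain ⟨x, hx0, Y, hY, hxY⟩ := horb
    obtain ⟨M, hM, hxM, hinv⟩ := exists_finiteDimensional_invariant hJ hxY
    refine ⟨M, M.closed_of_finiteDimensional, (Submodule.ne_bot_iff M).mpr ⟨x, hxM, hx0⟩, ?_, hinv⟩
    rintro rfl
    have : FiniteDimensional ℂ X := Module.Finite.equiv (Submodule.topEquiv (R := ℂ) (M := X))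
    have hAf : FiniteDimensional ℂ A.range := inferInstance
    exact hA0 (hfr A hA hAf)
  · push Not at horb
    obtain ⟨M, h1, h2, h3, h4⟩ := exists_invariant_of_quasinilpotent_words
      (a := fun i : J => (i : X →L[ℂ] X)) (fun i => hc i i.2)
      (fun w hw => spectrum_list_prod_subset hcl hJ hc hfr
        (fun x hx ⟨Y, hY, hxY⟩ => by obtain ⟨T, hT, h⟩ := horb x hx Y hY; exact h (hxY T hT))
        (by rwa [Ne, List.map_eq_nil_iff]) (by
          intro B hB
          obtain ⟨i, -, rfl⟩ := List.mem_map.mp hB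
          exact i.2)) (i₀ := ⟨A, hA⟩) hA0
    exact ⟨M, h1, h2, h3, fun B hB => h4 ⟨B, hB⟩⟩

end QuasinilpotentWords

section FiniteTrace

variable {X : Type*} [NormedAddCommGroup X] [NormedSpace ℂ X]

/-- The trace of an operator of finite rank. -/
noncomputable def finiteTrace (T : X →L[ℂ] X) : ℂ :=
  LinearMap.trace ℂ T.range ((T : X →ₗ[ℂ] X).rangeRestrict ∘ₗ T.range.subtype)

theorem finiteTrace_eq_trace {T : X →L[ℂ] X} {W : Submodule ℂ X} [FiniteDimensional ℂ W]
    (h : ∀ x, (T : X →ₗ[ℂ] X) x ∈ W) :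
    finiteTrace T = LinearMap.trace ℂ W ((T : X →ₗ[ℂ] X).codRestrict W h ∘ₗ W.subtype) := by
  have hle : T.range ≤ W := by
    rintro _ ⟨x, rfl⟩
    exact h x
  have : FiniteDimensional ℂ T.range := Submodule.finiteDimensional_of_le hle
  exact (LinearMap.trace_comp_comm' ((T : X →ₗ[ℂ] X).rangeRestrict ∘ₗ W.subtype)
    (Submodule.inclusion hle)).symm

theorem finiteTrace_add {S T : X →L[ℂ] X} (hS : IsFiniteRank S) (hT : IsFiniteRank T) :
    finiteTrace (S + T) = finiteTrace S + finiteTrace T := by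
  have : FiniteDimensional ℂ S.range := hS
  have : FiniteDimensional ℂ T.range := hT
  have h1 : ∀ x, (S : X →ₗ[ℂ] X) x ∈ S.range ⊔ T.range :=
    fun x => Submodule.mem_sup_left ⟨x, rfl⟩
  have h2 : ∀ x, (T : X →ₗ[ℂ] X) x ∈ S.range ⊔ T.range :=
    fun x => Submodule.mem_sup_right ⟨x, rfl⟩
  have h3 : ∀ x, ((S + T : X →L[ℂ] X) : X →ₗ[ℂ] X) x ∈ S.range ⊔ T.range :=
    fun x => Submodule.add_mem _ (h1 x) (h2 x)
  rw [finiteTrace_eq_trace h1, finiteTrace_eq_trace h2, finiteTrace_eq_trace h3, ← map_add]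
  rfl

theorem finiteTrace_smul {T : X →L[ℂ] X} (hT : IsFiniteRank T) (c : ℂ) :
    finiteTrace (c • T) = c * finiteTrace T := by
  have : FiniteDimensional ℂ T.range := hT
  have h1 : ∀ x, (T : X →ₗ[ℂ] X) x ∈ T.range := fun x => ⟨x, rfl⟩
  have h2 : ∀ x, ((c • T : X →L[ℂ] X) : X →ₗ[ℂ] X) x ∈ T.range :=
    fun x => T.range.smul_mem c (h1 x)
  rw [finiteTrace_eq_trace h1, finiteTrace_eq_trace h2, ← smul_eq_mul, ← map_smul]
  rfl

theorem finiteTrace_mul_comm {T : X →L[ℂ] X} (hT : IsFiniteRank T) (S : X →L[ℂ] X) :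
    finiteTrace (S * T) = finiteTrace (T * S) := by
  have : FiniteDimensional ℂ T.range := hT
  have h1 : ∀ x, ((T * S : X →L[ℂ] X) : X →ₗ[ℂ] X) x ∈ T.range := fun x => ⟨S x, rfl⟩
  have h2 : ∀ x, ((S * T : X →L[ℂ] X) : X →ₗ[ℂ] X) x ∈ T.range.map (S : X →ₗ[ℂ] X) :=
    fun x => ⟨T x, ⟨x, rfl⟩, rfl⟩
  rw [finiteTrace_eq_trace h1, finiteTrace_eq_trace h2]
  exact LinearMap.trace_comp_comm' ((T : X →ₗ[ℂ] X).rangeRestrict ∘ₗ Submodule.subtype _)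
    ((S : X →ₗ[ℂ] X).submoduleMap T.range)

theorem finiteTrace_eq_zero_of_isNilpotent {T : X →L[ℂ] X} (hT : IsFiniteRank T)
    (h : IsNilpotent T) : finiteTrace T = 0 := by
  have : FiniteDimensional ℂ T.range := hT
  obtain ⟨n, hn⟩ := h
  refine (LinearMap.isNilpotent_trace_of_isNilpotent ⟨n, ?_⟩).eq_zero
  have key : ∀ k (y : T.range), ((((T : X →ₗ[ℂ] X).rangeRestrict ∘ₗ T.range.subtype) ^ k) y : X) =
      (T ^ k) y := by
    intro k
    induction k with
    | zero => intro y; rfl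
    | succ k ih => intro y; rw [pow_succ, pow_succ, Module.End.mul_apply, ih]; rfl
  ext y
  rw [key, hn]
  rfl

theorem finiteTrace_ne_zero_of_idempotent {e : X →L[ℂ] X} (he : IsFiniteRank e) (h : e * e = e)
    (h0 : e ≠ 0) : finiteTrace e ≠ 0 := by
  have : FiniteDimensional ℂ e.range := he
  have h1 : (e : X →ₗ[ℂ] X).rangeRestrict ∘ₗ e.range.subtype = LinearMap.id := by
    ext ⟨_, x, rfl⟩
    exact congrArg (fun T => T x) h
  rw [finiteTrace, h1, LinearMap.trace_id, Nat.cast_ne_zero]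
  intro h2
  rw [Submodule.finrank_eq_zero] at h2
  refine h0 (ContinuousLinearMap.ext fun x => ?_)
  have : e x ∈ e.range := ⟨x, rfl⟩
  rw [h2] at this
  simpa using this

end FiniteTrace

section Nilpotent

variable {X : Type*} [NormedAddCommGroup X] [NormedSpace ℂ X]

theorem isNilpotent_or_exists_idempotent {T : X →L[ℂ] X} (hT : IsFiniteRank T) :
    IsNilpotent T ∨ ∃ v : Polynomial ℂ, T * Polynomial.aeval T v ≠ 0 ∧
      (T * Polynomial.aeval T v) * (T * Polynomial.aeval T v) = T * Polynomial.aeval T v := by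
  obtain ⟨P, hP0, hP⟩ := exists_aeval_mul_eq_zero (Commute.refl T) hT
  obtain ⟨χ, hχ, hχd⟩ := Polynomial.exists_eq_pow_rootMultiplicity_mul_and_not_dvd P hP0 0
  obtain ⟨k, hk⟩ : ∃ k, k = P.rootMultiplicity 0 := ⟨_, rfl⟩
  rw [← hk, map_zero, sub_zero] at hχ
  rw [map_zero, sub_zero] at hχd
  have hco : IsCoprime ((Polynomial.X : Polynomial ℂ) ^ (k + 1)) χ :=
    (((Polynomial.prime_X.irreducible).coprime_iff_not_dvd).mpr hχd).pow_left
  obtain ⟨u, w, huw⟩ := hco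
  have hann : T ^ (k + 1) * Polynomial.aeval T χ = 0 := by
    rw [pow_succ', mul_assoc, ← Polynomial.aeval_X_pow (R := ℂ) T, ← map_mul, ← hχ,
      ((commute_aeval (Commute.refl T) P).eq).symm, hP]
  have hsum := congrArg (Polynomial.aeval T) huw
  rw [map_add, map_mul, map_mul, Polynomial.aeval_X_pow, map_one] at hsum
  obtain ⟨v, hv⟩ : ∃ v, v = u * Polynomial.X ^ k := ⟨_, rfl⟩
  have he : T * Polynomial.aeval T v = Polynomial.aeval T u * T ^ (k + 1) := by
    rw [← (commute_aeval (Commute.refl T) v).eq, hv, map_mul, Polynomial.aeval_X_pow, mul_assoc,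
      pow_succ]
  have hcc : Commute (Polynomial.aeval T w) (T ^ (k + 1)) :=
    (commute_aeval (Commute.refl T) w).pow_right _
  have hz : T ^ (k + 1) * (Polynomial.aeval T w * Polynomial.aeval T χ) = 0 := by
    rw [← mul_assoc, ← hcc.eq, mul_assoc, hann, mul_zero]
  by_cases h0 : T * Polynomial.aeval T v = 0
  · left
    refine ⟨k + 1, ?_⟩
    rw [← he, h0, zero_add] at hsum
    rw [hsum, mul_one] at hz
    exact hz
  · right
    refine ⟨v, h0, ?_⟩
    have h1 : T * Polynomial.aeval T v = 1 - Polynomial.aeval T w * Polynomial.aeval T χ := by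
      rw [he, ← hsum, add_sub_cancel_right]
    nth_rewrite 2 [h1]
    rw [mul_sub, mul_one, he, mul_assoc, hz, mul_zero, sub_zero]

theorem IsFiniteRank.mul_aeval {T : X →L[ℂ] X} (hT : IsFiniteRank T) (v : Polynomial ℂ) :
    IsFiniteRank (T * Polynomial.aeval T v) := hT.mul_right _

theorem isNilpotent_of_finiteTrace {T : X →L[ℂ] X} (hT : IsFiniteRank T)
    (h : ∀ k, finiteTrace (T * T ^ k) = 0) : IsNilpotent T := by
  refine (isNilpotent_or_exists_idempotent hT).resolve_right ?_
  rintro ⟨v, h0, hid⟩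
  refine finiteTrace_ne_zero_of_idempotent (hT.mul_aeval v) hid h0 ?_
  clear h0 hid
  induction v using Polynomial.induction_on' with
  | add p q hp hq =>
    rw [map_add, mul_add, finiteTrace_add (hT.mul_aeval p) (hT.mul_aeval q), hp, hq, add_zero]
  | monomial n c =>
    rw [Polynomial.aeval_monomial, ← Algebra.smul_def, mul_smul_comm,
      finiteTrace_smul (hT.mul_right _), h, mul_zero]

theorem spectrum_subset_of_isNilpotent {T : X →L[ℂ] X} (h : IsNilpotent T) :
    spectrum ℂ T ⊆ {0} := by
  intro z hz
  by_contra hz0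
  obtain ⟨n, hn⟩ := h
  rcases subsingleton_or_nontrivial (X →L[ℂ] X) with hs | hs
  · simp [spectrum.of_subsingleton] at hz
  · have := spectrum.pow_mem_pow T n hz
    rw [hn, spectrum.zero_eq] at this
    exact hz0 (eq_zero_of_pow_eq_zero this)

theorem isNilpotent_of_spectrum_subset [CompleteSpace X] {T : X →L[ℂ] X} (hT : IsFiniteRank T)
    (h : spectrum ℂ T ⊆ {0}) : IsNilpotent T := by
  refine (isNilpotent_or_exists_idempotent hT).resolve_right ?_
  rintro ⟨v, h0, hid⟩
  have h1 := one_mem_spectrum_of_idempotent hid h0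
  have : Nontrivial (X →L[ℂ] X) := ⟨_, _, h0⟩
  have h2 : T * Polynomial.aeval T v = Polynomial.aeval T (Polynomial.X * v) := by
    rw [map_mul, Polynomial.aeval_X]
  rw [h2, spectrum.map_polynomial_aeval] at h1
  obtain ⟨z, hz, hz1⟩ := h1
  have hz0 : z = 0 := h hz
  simp [hz0] at hz1

end Nilpotent

section Jacobson

variable {W : Type*} [AddCommGroup W] [Module ℂ W]

/-- The elements of a space of endomorphisms which vanish at `w`. -/
def annihilatorAt (J : Submodule ℂ (Module.End ℂ W)) (w : W) : Submodule ℂ (Module.End ℂ W) :=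
  J ⊓ (LinearMap.applyₗ w : Module.End ℂ W →ₗ[ℂ] W).ker

theorem mem_annihilatorAt {J : Submodule ℂ (Module.End ℂ W)} {w : W} {a : Module.End ℂ W} :
    a ∈ annihilatorAt J w ↔ a ∈ J ∧ a w = 0 := Iff.rfl

/-- Jacobson's version of Engel's theorem for Jordan algebras of nilpotent endomorphisms. -/
theorem exists_common_kernel_vector (J : Submodule ℂ (Module.End ℂ W)) [FiniteDimensional ℂ J]
    (hJ : ∀ a ∈ J, ∀ b ∈ J, a * b + b * a ∈ J) (hn : ∀ a ∈ J, IsNilpotent a) (V : Submodule ℂ W)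
    (hV : V ≠ ⊥) (hinv : ∀ a ∈ J, ∀ v ∈ V, a v ∈ V) : ∃ v ∈ V, v ≠ 0 ∧ ∀ a ∈ J, a v = 0 := by
  obtain ⟨n, hJn⟩ : ∃ n, Module.finrank ℂ J = n := ⟨_, rfl⟩
  induction n using Nat.strong_induction_on generalizing J V with
  | _ n ih =>
  obtain ⟨v₀, hv₀, hv₀0⟩ := V.ne_bot_iff.mp hV
  have hle : ∀ w, annihilatorAt J w ≤ J := fun w => inf_le_left
  have hfin : ∀ w, FiniteDimensional ℂ (annihilatorAt J w) := fun w =>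
    Submodule.finiteDimensional_of_le (hle w)
  obtain ⟨w, ⟨hw, hw0⟩, hmax⟩ : ∃ w, (w ∈ V ∧ w ≠ 0) ∧ ∀ y, (y ∈ V ∧ y ≠ 0) →
      Module.finrank ℂ (annihilatorAt J y) ≤ Module.finrank ℂ (annihilatorAt J w) := by
    obtain ⟨S, hS⟩ : ∃ S : Set ℕ, S = (fun w => Module.finrank ℂ (annihilatorAt J w)) ''
        {w | w ∈ V ∧ w ≠ 0} := ⟨_, rfl⟩
    have hb : BddAbove S := ⟨n, by
      rw [hS]
      rintro _ ⟨w, -, rfl⟩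
      exact hJn ▸ Submodule.finrank_mono (hle w)⟩
    have hmem := Nat.sSup_mem (hS ▸ ⟨_, v₀, ⟨hv₀, hv₀0⟩, rfl⟩) hb
    rw [hS] at hmem hb
    obtain ⟨w, hw, hws⟩ := hmem
    exact ⟨w, hw, fun y hy => (le_csSup hb ⟨y, hy, rfl⟩).trans hws.ge⟩
  by_cases hall : annihilatorAt J w = J
  · exact ⟨w, hw, hw0, fun a ha => (mem_annihilatorAt.mp (hall ▸ ha)).2⟩
  exfalso
  have hlt : annihilatorAt J w < J := lt_of_le_of_ne (hle w) hall
  have hKJ : ∀ a ∈ annihilatorAt J w, ∀ b ∈ annihilatorAt J w,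
      a * b + b * a ∈ annihilatorAt J w := by
    intro a ha b hb
    rw [mem_annihilatorAt] at *
    refine ⟨hJ a ha.1 b hb.1, ?_⟩
    rw [LinearMap.add_apply, Module.End.mul_apply, Module.End.mul_apply, ha.2, hb.2, map_zero,
      map_zero, add_zero]
  obtain ⟨a₀, ha₀, ha₀w⟩ := SetLike.exists_of_lt hlt
  obtain ⟨v, ⟨b, hb, rfl⟩, hv0, hv⟩ := ih _ (hJn ▸ Submodule.finrank_lt_finrank_of_lt hlt)
    (annihilatorAt J w) hKJ (fun a ha => hn a (hle w ha))
    (J.map (LinearMap.applyₗ w : Module.End ℂ W →ₗ[ℂ] W))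
    ((Submodule.ne_bot_iff _).mpr ⟨a₀ w, ⟨a₀, ha₀, rfl⟩, fun h => ha₀w ⟨ha₀, h⟩⟩)
    (by
      rintro k hk _ ⟨b, hb, rfl⟩
      refine ⟨k * b + b * k, hJ k (hle w hk) b hb, ?_⟩
      have : k w = 0 := hk.2
      simp [this]) rfl
  have hbw : b w ≠ 0 := hv0
  have hbK : ∀ k ∈ annihilatorAt J w, k * b + b * k ∈ annihilatorAt J w := by
    intro k hk
    have h1 : k w = 0 := hk.2
    have h2 : k (b w) = 0 := hv k hk
    refine mem_annihilatorAt.mpr ⟨hJ k hk.1 b hb, ?_⟩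
    simp [h1, h2]
  have hpow : ∀ m, (b ^ m) w ∈ V ∧ ∀ k ∈ annihilatorAt J w, k ((b ^ m) w) = 0 := by
    intro m
    induction m with
    | zero => exact ⟨hw, fun k hk => hk.2⟩
    | succ m ihm =>
      rw [pow_succ', Module.End.mul_apply]
      refine ⟨hinv b hb _ ihm.1, fun k hk => ?_⟩
      have h1 := ihm.2 _ (hbK k hk)
      rwa [LinearMap.add_apply, Module.End.mul_apply, Module.End.mul_apply, ihm.2 k hk, map_zero,
        add_zero] at h1
  have hex : ∃ m, (b ^ m) w = 0 := by
    obtain ⟨m, hm⟩ := hn b hb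
    exact ⟨m, by rw [hm]; rfl⟩
  classical
  obtain ⟨m, hm⟩ : ∃ m, Nat.find hex = m + 1 :=
    Nat.exists_eq_succ_of_ne_zero fun h => hw0 (by simpa [h] using Nat.find_spec hex)
  have hm0 : (b ^ m) w ≠ 0 := Nat.find_min hex (by omega)
  have hm1 : b ((b ^ m) w) = 0 := by
    rw [← Module.End.mul_apply, ← pow_succ', ← hm]
    exact Nat.find_spec hex
  have hlt' : annihilatorAt J w < annihilatorAt J ((b ^ m) w) :=
    SetLike.lt_iff_le_and_exists.mpr ⟨fun k hk => mem_annihilatorAt.mpr ⟨hk.1, (hpow m).2 k hk⟩,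
      b, mem_annihilatorAt.mpr ⟨hb, hm1⟩, fun h => hbw (mem_annihilatorAt.mp h).2⟩
  exact absurd (Submodule.finrank_lt_finrank_of_lt hlt')
    (not_lt.mpr (hmax _ ⟨(hpow m).1, hm0⟩))

theorem exists_common_kernel_functional [FiniteDimensional ℂ W] [Nontrivial W]
    (J : Submodule ℂ (Module.End ℂ W)) (hJ : ∀ a ∈ J, ∀ b ∈ J, a * b + b * a ∈ J)
    (hn : ∀ a ∈ J, IsNilpotent a) : ∃ φ : Module.Dual ℂ W, φ ≠ 0 ∧ ∀ a ∈ J, ∀ w, φ (a w) = 0 := by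
  obtain ⟨φ, -, hφ, h⟩ := exists_common_kernel_vector
    (J.map (Module.Dual.transpose (R := ℂ) (M := W) (M' := W))) (by
      rintro _ ⟨a, ha, rfl⟩ _ ⟨b, hb, rfl⟩
      refine ⟨b * a + a * b, hJ b hb a ha, ?_⟩
      rw [map_add]
      rfl) (by
      rintro _ ⟨a, ha, rfl⟩
      obtain ⟨n, hn⟩ := hn a ha
      refine ⟨n, ?_⟩
      have key : ∀ n (φ : Module.Dual ℂ W), ((Module.Dual.transpose (R := ℂ) a) ^ n) φ =
          φ ∘ₗ (a ^ n) := by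
        intro n
        induction n with
        | zero => intro φ; rfl
        | succ n ih => intro φ; rw [pow_succ, Module.End.mul_apply, ih, pow_succ']; rfl
      ext φ w
      rw [key, hn]
      simp) ⊤ (by simp) (fun _ _ _ _ => trivial)
  exact ⟨φ, hφ, fun a ha w => LinearMap.congr_fun (h _ ⟨a, ha, rfl⟩) w⟩

end Jacobson

section Orbit

variable {X : Type*} [NormedAddCommGroup X] [NormedSpace ℂ X]

/-- The smallest subspace which contains `y` and is invariant under `S`. -/
def operatorOrbit (S : Set (X →L[ℂ] X)) (y : X) : Submodule ℂ X :=
  sInf {M | y ∈ M ∧ ∀ a ∈ S, ∀ m ∈ M, a m ∈ M}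

theorem mem_operatorOrbit_self (S : Set (X →L[ℂ] X)) (y : X) : y ∈ operatorOrbit S y :=
  Submodule.mem_sInf.mpr fun _ hM => hM.1

theorem apply_mem_operatorOrbit {S : Set (X →L[ℂ] X)} {y m : X} {a : X →L[ℂ] X} (ha : a ∈ S)
    (hm : m ∈ operatorOrbit S y) : a m ∈ operatorOrbit S y :=
  Submodule.mem_sInf.mpr fun M hM => hM.2 a ha m (Submodule.mem_sInf.mp hm M hM)

theorem operatorOrbit_le {S : Set (X →L[ℂ] X)} {y : X} {M : Submodule ℂ X} (hy : y ∈ M)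
    (hM : ∀ a ∈ S, ∀ m ∈ M, a m ∈ M) : operatorOrbit S y ≤ M :=
  sInf_le ⟨hy, hM⟩

theorem operatorOrbit_mono {S T : Set (X →L[ℂ] X)} (h : S ⊆ T) (y : X) :
    operatorOrbit S y ≤ operatorOrbit T y :=
  operatorOrbit_le (mem_operatorOrbit_self T y) fun _ ha _ hm => apply_mem_operatorOrbit (h ha) hm

theorem exists_finite_mem_operatorOrbit {S : Set (X →L[ℂ] X)} {y v : X}
    (hv : v ∈ operatorOrbit S y) : ∃ F ⊆ S, F.Finite ∧ v ∈ operatorOrbit F y := by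
  obtain ⟨M, hM⟩ : ∃ M : Submodule ℂ X, ∀ v, v ∈ M ↔ ∃ F ⊆ S, F.Finite ∧ v ∈ operatorOrbit F y :=
    ⟨{ carrier := {v | ∃ F ⊆ S, F.Finite ∧ v ∈ operatorOrbit F y}
       add_mem' := by
        rintro v w ⟨F, hF, hFf, hv⟩ ⟨G, hG, hGf, hw⟩
        exact ⟨F ∪ G, Set.union_subset hF hG, hFf.union hGf, Submodule.add_mem _
          (operatorOrbit_mono Set.subset_union_left y hv)
          (operatorOrbit_mono Set.subset_union_right y hw)⟩
       zero_mem' := ⟨∅, Set.empty_subset _, Set.finite_empty, Submodule.zero_mem _⟩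
       smul_mem' := by
        rintro c v ⟨F, hF, hFf, hv⟩
        exact ⟨F, hF, hFf, Submodule.smul_mem _ c hv⟩ }, fun _ => Iff.rfl⟩
  refine (hM v).mp (operatorOrbit_le ?_ ?_ hv)
  · exact (hM y).mpr ⟨∅, Set.empty_subset _, Set.finite_empty, mem_operatorOrbit_self _ _⟩
  · intro a ha m hm
    obtain ⟨F, hF, hFf, hmF⟩ := (hM m).mp hm
    exact (hM _).mpr ⟨insert a F, Set.insert_subset ha hF, hFf.insert a,
      apply_mem_operatorOrbit (Set.mem_insert a F)
        (operatorOrbit_mono (Set.subset_insert a F) y hmF)⟩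

theorem finiteDimensional_operatorOrbit {S : Set (X →L[ℂ] X)} (hS : S.Finite)
    (hfr : ∀ a ∈ S, IsFiniteRank a) (y : X) : FiniteDimensional ℂ (operatorOrbit S y) := by
  have : Finite S := hS
  have : ∀ a : S, FiniteDimensional ℂ (a : X →L[ℂ] X).range := fun a => hfr a a.2
  refine Submodule.finiteDimensional_of_le
    (S₂ := Submodule.span ℂ {y} ⊔ ⨆ a : S, (a : X →L[ℂ] X).range) (operatorOrbit_le ?_ ?_)
  · exact Submodule.mem_sup_left (Submodule.mem_span_singleton_self y)
  · exact fun a ha m _ => Submodule.mem_sup_right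
      (Submodule.mem_iSup_of_mem (⟨a, ha⟩ : S) ⟨m, rfl⟩)

theorem notMem_operatorOrbit_apply {N : Submodule ℂ (X →L[ℂ] X)}
    (hN : ∀ a ∈ N, ∀ b ∈ N, a * b + b * a ∈ N) (hfr : ∀ a ∈ N, IsFiniteRank a)
    (hn : ∀ a ∈ N, IsNilpotent a) {L : X →L[ℂ] X} (hL : L ∈ N) {y : X} (hy0 : y ≠ 0) :
    y ∉ operatorOrbit (N : Set (X →L[ℂ] X)) (L y) := by
  intro hy
  obtain ⟨F, hF, hFf, hyF⟩ := exists_finite_mem_operatorOrbit hy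
  obtain ⟨M, hM⟩ : ∃ M, M = operatorOrbit (insert L F) y := ⟨_, rfl⟩
  have hyM : y ∈ M := hM ▸ mem_operatorOrbit_self _ _
  have hinv : ∀ a ∈ insert L F, ∀ m ∈ M, a m ∈ M := fun a ha m hm => by
    rw [hM] at hm ⊢
    exact apply_mem_operatorOrbit ha hm
  have hsub : insert L F ⊆ (N : Set (X →L[ℂ] X)) := Set.insert_subset hL hF
  have : FiniteDimensional ℂ M := hM ▸ finiteDimensional_operatorOrbit (hFf.insert L)
    (fun a ha => hfr a (hsub ha)) y
  have : Nontrivial M := ⟨⟨⟨y, hyM⟩, 0, fun h => hy0 (congrArg Subtype.val h)⟩⟩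
  obtain ⟨J, hJ⟩ : ∃ J : Submodule ℂ (Module.End ℂ M), ∀ f, f ∈ J ↔
      ∃ a ∈ N, ∀ m : M, (f m : X) = a m :=
    ⟨{ carrier := {f | ∃ a ∈ N, ∀ m : M, (f m : X) = a m}
       add_mem' := by
        rintro f g ⟨a, ha, hfa⟩ ⟨b, hb, hgb⟩
        exact ⟨a + b, N.add_mem ha hb, fun m => by
          rw [LinearMap.add_apply, Submodule.coe_add, hfa, hgb, add_apply]⟩
       zero_mem' := ⟨0, N.zero_mem, fun m => rfl⟩
       smul_mem' := by
        rintro c f ⟨a, ha, hfa⟩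
        exact ⟨c • a, N.smul_mem c ha, fun m => by
          rw [LinearMap.smul_apply, Submodule.coe_smul, hfa, smul_apply]⟩ }, fun _ => Iff.rfl⟩
  obtain ⟨φ, hφ0, hφ⟩ := exists_common_kernel_functional J (by
    intro f hf g hg
    obtain ⟨a, ha, hfa⟩ := (hJ f).mp hf
    obtain ⟨b, hb, hgb⟩ := (hJ g).mp hg
    exact (hJ _).mpr ⟨a * b + b * a, hN a ha b hb, fun m => by
      rw [LinearMap.add_apply, Submodule.coe_add, Module.End.mul_apply, Module.End.mul_apply, hfa,
        hgb, hgb, hfa, add_apply, mul_apply_eq_comp, mul_apply_eq_comp]⟩) (by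
    intro f hf
    obtain ⟨a, ha, hfa⟩ := (hJ f).mp hf
    obtain ⟨n, hn⟩ := hn a ha
    refine ⟨n, ?_⟩
    have key : ∀ n (m : M), ((f ^ n) m : X) = (a ^ n) m := by
      intro n
      induction n with
      | zero => exact fun m => rfl
      | succ n ih =>
        intro m
        rw [pow_succ, Module.End.mul_apply, ih, hfa, pow_succ, mul_apply_eq_comp]
    ext m
    rw [key, hn]
    rfl)
  have hker : ∀ a ∈ insert L F, ∀ m ∈ M, a m ∈ φ.ker.map M.subtype := fun a ha m hm => by
    refine ⟨⟨a m, hinv a ha m hm⟩, ?_, rfl⟩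
    exact hφ ((a : X →ₗ[ℂ] X).restrict (hinv a ha))
      ((hJ _).mpr ⟨a, hsub ha, fun m => rfl⟩) ⟨m, hm⟩
  have hle : φ.ker.map M.subtype ≤ M := Submodule.map_subtype_le M _
  have hyK : y ∈ φ.ker.map M.subtype :=
    operatorOrbit_le (hker L (Set.mem_insert L F) y hyM)
      (fun a ha m hm => hker a (Set.mem_insert_of_mem L ha) m (hle hm)) hyF
  have hMK : M ≤ φ.ker.map M.subtype := by
    conv_lhs => rw [hM]
    exact operatorOrbit_le hyK fun a ha m hm => hker a ha m (hle hm)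
  refine hφ0 (LinearMap.ext fun m => ?_)
  obtain ⟨m', hm', hmm⟩ := hMK m.2
  rw [← Subtype.ext hmm]
  exact hm'

theorem exists_mem_forall_apply_eq_zero {N : Submodule ℂ (X →L[ℂ] X)}
    (hN : ∀ a ∈ N, ∀ b ∈ N, a * b + b * a ∈ N) (hfr : ∀ a ∈ N, IsFiniteRank a)
    (hn : ∀ a ∈ N, IsNilpotent a) (Y : Submodule ℂ X) [FiniteDimensional ℂ Y] (hY : Y ≠ ⊥) :
    ∃ y ∈ Y, y ≠ 0 ∧ ∀ L ∈ N, L y ∈ Y → L y = 0 := by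
  by_contra! hcon
  have key : ∀ n : ℕ, ∀ y ∈ Y, y ≠ 0 →
      Module.finrank ℂ (operatorOrbit (N : Set (X →L[ℂ] X)) y ⊓ Y : Submodule ℂ X) ≠ n := by
    intro n
    induction n using Nat.strong_induction_on with
    | _ n ih =>
    intro y hy hy0 hyn
    obtain ⟨L, hL, hLY, hL0⟩ := hcon y hy hy0
    refine ih _ ?_ (L y) hLY hL0 rfl
    rw [← hyn]
    refine Submodule.finrank_lt_finrank_of_lt (SetLike.lt_iff_le_and_exists.mpr
      ⟨inf_le_inf_right Y ?_, y, Submodule.mem_inf.mpr ⟨mem_operatorOrbit_self _ _, hy⟩,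
        fun h => notMem_operatorOrbit_apply hN hfr hn hL hy0 (Submodule.mem_inf.mp h).1⟩)
    exact operatorOrbit_le (apply_mem_operatorOrbit hL (mem_operatorOrbit_self _ _))
      fun a ha m hm => apply_mem_operatorOrbit ha hm
  obtain ⟨y, hy, hy0⟩ := Y.ne_bot_iff.mp hY
  exact key _ y hy hy0 rfl

/-- The iterated Jordan products of `z` with the letters of a word. -/
def jordanWord (z : X →L[ℂ] X) : List (X →L[ℂ] X) → X →L[ℂ] X
  | [] => z
  | b :: t => jordanWord z t * b + b * jordanWord z t

theorem jordanWord_apply {z : X →L[ℂ] X} {J : Set (X →L[ℂ] X)} (t : List (X →L[ℂ] X))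
    (ht : ∀ a ∈ t, a ∈ J) (y : X)
    (h : ∀ s : List (X →L[ℂ] X), (∀ a ∈ s, a ∈ J) → s.length < t.length →
      z (s.foldl (fun v b => b v) y) = 0) :
    jordanWord z t y = z (t.foldl (fun v b => b v) y) := by
  induction t generalizing y with
  | nil => rfl
  | cons b t ih =>
    have hb := ht b List.mem_cons_self
    have ht' : ∀ a ∈ t, a ∈ J := fun a ha => ht a (List.mem_cons_of_mem b ha)
    have h1 := ih ht' (b y) fun s hs hlt => h (b :: s)
      (fun a ha => by
        rcases List.mem_cons.mp ha with rfl | ha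
        · exact hb
        · exact hs a ha) (by simpa using hlt)
    have h2 := ih ht' y fun s hs hlt => h s hs (hlt.trans (by simp))
    rw [h t ht' (by simp)] at h2
    rw [jordanWord, add_apply, mul_apply_eq_comp, mul_apply_eq_comp, h1, h2, map_zero, add_zero,
      List.foldl_cons]

theorem foldl_apply_eq (t : List (X →L[ℂ] X)) (y : X) :
    t.foldl (fun v b => b v) y = t.reverse.prod y := by
  induction t generalizing y with
  | nil => rfl
  | cons b t ih =>
    rw [List.foldl_cons, ih, List.reverse_cons, List.prod_append, List.prod_singleton,
      mul_apply_eq_comp]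

theorem jordanWord_mem {J N : Submodule ℂ (X →L[ℂ] X)}
    (hid : ∀ z ∈ N, ∀ a ∈ J, z * a + a * z ∈ N) {z : X →L[ℂ] X} (hz : z ∈ N)
    {t : List (X →L[ℂ] X)} (ht : ∀ a ∈ t, a ∈ J) : jordanWord z t ∈ N := by
  induction t with
  | nil => exact hz
  | cons b t ih =>
    exact hid _ (ih fun a ha => ht a (List.mem_cons_of_mem b ha)) b (ht b List.mem_cons_self)

theorem exists_invariant_of_nil_ideal {J N : Submodule ℂ (X →L[ℂ] X)} (hNJ : N ≤ J)
    (hid : ∀ z ∈ N, ∀ a ∈ J, z * a + a * z ∈ N) (hfr : ∀ a ∈ N, IsFiniteRank a)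
    (hn : ∀ a ∈ N, IsNilpotent a) (hN0 : N ≠ ⊥) :
    ∃ M : Submodule ℂ X, IsClosed (M : Set X) ∧ M ≠ ⊥ ∧ M ≠ ⊤ ∧ ∀ A ∈ J, ∀ x ∈ M, A x ∈ M := by
  obtain ⟨z, hz, hz0⟩ := N.ne_bot_iff.mp hN0
  have : FiniteDimensional ℂ z.range := hfr z hz
  obtain ⟨x₀, hx₀⟩ : ∃ x, z x ≠ 0 := by
    by_contra! h
    exact hz0 (ContinuousLinearMap.ext h)
  obtain ⟨y, -, hy0, hy⟩ := exists_mem_forall_apply_eq_zero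
    (fun a ha b hb => hid a ha b (hNJ hb)) hfr hn z.range
    ((Submodule.ne_bot_iff _).mpr ⟨z x₀, ⟨x₀, rfl⟩, hx₀⟩)
  have key : ∀ n : ℕ, ∀ t : List (X →L[ℂ] X), (∀ a ∈ t, a ∈ (J : Set (X →L[ℂ] X))) →
      t.length = n → z (t.foldl (fun v b => b v) y) = 0 := by
    intro n
    induction n using Nat.strong_induction_on with
    | _ n ih =>
    intro t ht htn
    have h1 := jordanWord_apply t ht y fun s hs hlt => ih _ (htn ▸ hlt) s hs rfl
    rw [← h1]
    refine hy _ (jordanWord_mem hid hz ht) ?_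
    rw [h1]
    exact ⟨_, rfl⟩
  refine ⟨⨅ t : {t : List (X →L[ℂ] X) // ∀ a ∈ t, a ∈ J},
    (z * (t : List (X →L[ℂ] X)).reverse.prod : X →L[ℂ] X).ker, ?_, ?_, ?_, ?_⟩
  · rw [Submodule.coe_iInf]
    exact isClosed_iInter fun t => ContinuousLinearMap.isClosed_ker _
  · refine (Submodule.ne_bot_iff _).mpr ⟨y, (Submodule.mem_iInf _).mpr fun t => ?_, hy0⟩
    rw [LinearMap.mem_ker]
    refine Eq.trans ?_ (key _ t t.2 rfl)
    rw [foldl_apply_eq]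
    rfl
  · intro h
    have h1 := (Submodule.mem_iInf _).mp (h ▸ Submodule.mem_top : x₀ ∈ _) ⟨[], by simp⟩
    exact hx₀ h1
  · intro A hA x hx
    refine (Submodule.mem_iInf _).mpr fun t => ?_
    have h1 := (Submodule.mem_iInf _).mp hx ⟨A :: t, fun a ha => by
      rcases List.mem_cons.mp ha with rfl | ha
      · exact hA
      · exact t.2 a ha⟩
    rw [LinearMap.mem_ker] at h1 ⊢
    refine Eq.trans ?_ h1
    simp only [List.reverse_cons, List.prod_append, List.prod_singleton]
    rfl

end Orbit

section NilIdeal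

theorem jordan_pow_succ_mem {R : Type*} [Ring R] [Algebra ℂ R] {J : Submodule ℂ R}
    (hJ : ∀ A ∈ J, ∀ B ∈ J, A * B + B * A ∈ J) {c : R} (hc : c ∈ J) (k : ℕ) : c ^ (k + 1) ∈ J := by
  induction k with
  | zero => simpa using hc
  | succ k ih =>
    have h1 := J.smul_mem (1 / 2 : ℂ) (hJ c hc _ ih)
    rwa [← pow_succ', ← pow_succ, ← two_smul ℂ, smul_smul, one_div,
      inv_mul_cancel₀ (two_ne_zero' ℂ), one_smul] at h1

theorem jordan_mul_aeval_mem {R : Type*} [Ring R] [Algebra ℂ R] {J : Submodule ℂ R}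
    (hJ : ∀ A ∈ J, ∀ B ∈ J, A * B + B * A ∈ J) {c : R} (hc : c ∈ J) (v : Polynomial ℂ) :
    c * Polynomial.aeval c v ∈ J := by
  induction v using Polynomial.induction_on' with
  | add p q hp hq => rw [map_add, mul_add]; exact J.add_mem hp hq
  | monomial n a =>
    rw [Polynomial.aeval_monomial, ← Algebra.smul_def, mul_smul_comm, ← pow_succ']
    exact J.smul_mem a (jordan_pow_succ_mem hJ hc n)

variable {X : Type*} [NormedAddCommGroup X] [NormedSpace ℂ X] [CompleteSpace X]

theorem isNilpotent_mul_of_submultiplicative {J : Submodule ℂ (X →L[ℂ] X)}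
    (hs : ∀ A ∈ J, ∀ B ∈ J, ∀ mu ∈ spectrum ℂ (A * B), mu ≠ 0 →
      ∃ α ∈ spectrum ℂ A, ∃ β ∈ spectrum ℂ B, mu = α * β)
    {z a : X →L[ℂ] X} (hz : z ∈ J) (hzf : IsFiniteRank z) (hzn : IsNilpotent z) (ha : a ∈ J) :
    IsNilpotent (z * a) := by
  refine isNilpotent_of_spectrum_subset (hzf.mul_right a) fun mu hmu => ?_
  by_contra h0
  obtain ⟨α, hα, β, -, rfl⟩ := hs z hz a ha mu hmu h0
  have := spectrum_subset_of_isNilpotent hzn hα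
  simp_all

theorem finiteTrace_mul_pow_of_submultiplicative {J : Submodule ℂ (X →L[ℂ] X)}
    (hJ : ∀ A ∈ J, ∀ B ∈ J, A * B + B * A ∈ J)
    (hs : ∀ A ∈ J, ∀ B ∈ J, ∀ mu ∈ spectrum ℂ (A * B), mu ≠ 0 →
      ∃ α ∈ spectrum ℂ A, ∃ β ∈ spectrum ℂ B, mu = α * β)
    {z c : X →L[ℂ] X} (hz : z ∈ J) (hzf : IsFiniteRank z) (hzn : IsNilpotent z) (hc : c ∈ J)
    (k : ℕ) : finiteTrace (z * c ^ k) = 0 := by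
  refine finiteTrace_eq_zero_of_isNilpotent (hzf.mul_right _) ?_
  cases k with
  | zero => simpa using hzn
  | succ k => exact isNilpotent_mul_of_submultiplicative hs hz hzf hzn (jordan_pow_succ_mem hJ hc k)

theorem isNilpotent_add_of_submultiplicative {J : Submodule ℂ (X →L[ℂ] X)}
    (hJ : ∀ A ∈ J, ∀ B ∈ J, A * B + B * A ∈ J)
    (hs : ∀ A ∈ J, ∀ B ∈ J, ∀ mu ∈ spectrum ℂ (A * B), mu ≠ 0 →
      ∃ α ∈ spectrum ℂ A, ∃ β ∈ spectrum ℂ B, mu = α * β)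
    {z w : X →L[ℂ] X} (hz : z ∈ J) (hzf : IsFiniteRank z) (hzn : IsNilpotent z)
    (hw : w ∈ J) (hwf : IsFiniteRank w) (hwn : IsNilpotent w) : IsNilpotent (z + w) := by
  refine isNilpotent_of_finiteTrace (hzf.add hwf) fun k => ?_
  have hc := J.add_mem hz hw
  rw [add_mul, finiteTrace_add (hzf.mul_right _) (hwf.mul_right _),
    finiteTrace_mul_pow_of_submultiplicative hJ hs hz hzf hzn hc,
    finiteTrace_mul_pow_of_submultiplicative hJ hs hw hwf hwn hc, add_zero]

theorem isNilpotent_jordan_of_submultiplicative {J : Submodule ℂ (X →L[ℂ] X)}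
    (hJ : ∀ A ∈ J, ∀ B ∈ J, A * B + B * A ∈ J)
    (hs : ∀ A ∈ J, ∀ B ∈ J, ∀ mu ∈ spectrum ℂ (A * B), mu ≠ 0 →
      ∃ α ∈ spectrum ℂ A, ∃ β ∈ spectrum ℂ B, mu = α * β)
    {z a : X →L[ℂ] X} (hz : z ∈ J) (hzf : IsFiniteRank z) (hzn : IsNilpotent z) (ha : a ∈ J) :
    IsNilpotent (z * a + a * z) := by
  refine isNilpotent_of_finiteTrace ((hzf.mul_right a).add (hzf.mul_left a)) fun k => ?_
  obtain ⟨s, hs'⟩ : ∃ s, s = (z * a + a * z) ^ k := ⟨_, rfl⟩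
  have hmem : a * s + s * a ∈ J := by
    cases k with
    | zero =>
      rw [hs', pow_zero, mul_one, one_mul]
      exact J.add_mem ha ha
    | succ k => exact hJ a ha s (hs' ▸ jordan_pow_succ_mem hJ (hJ z hz a ha) k)
  rw [← hs', add_mul, finiteTrace_add ((hzf.mul_right a).mul_right s)
    ((hzf.mul_left a).mul_right s), mul_assoc a, finiteTrace_mul_comm (hzf.mul_right s),
    mul_assoc, mul_assoc, ← finiteTrace_add (hzf.mul_right _) (hzf.mul_right _), ← mul_add]
  exact finiteTrace_eq_zero_of_isNilpotent (hzf.mul_right _)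
    (isNilpotent_mul_of_submultiplicative hs hz hzf hzn hmem)

theorem exists_invariant_of_nilpotent_mem {J : Submodule ℂ (X →L[ℂ] X)}
    (hJ : ∀ A ∈ J, ∀ B ∈ J, A * B + B * A ∈ J)
    (hs : ∀ A ∈ J, ∀ B ∈ J, ∀ mu ∈ spectrum ℂ (A * B), mu ≠ 0 →
      ∃ α ∈ spectrum ℂ A, ∃ β ∈ spectrum ℂ B, mu = α * β)
    {z : X →L[ℂ] X} (hz : z ∈ J) (hzf : IsFiniteRank z) (hzn : IsNilpotent z) (hz0 : z ≠ 0) :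
    ∃ M : Submodule ℂ X, IsClosed (M : Set X) ∧ M ≠ ⊥ ∧ M ≠ ⊤ ∧ ∀ A ∈ J, ∀ x ∈ M, A x ∈ M := by
  obtain ⟨N, hN⟩ : ∃ N : Submodule ℂ (X →L[ℂ] X),
      ∀ a, a ∈ N ↔ a ∈ J ∧ IsFiniteRank a ∧ IsNilpotent a :=
    ⟨{ carrier := {a | a ∈ J ∧ IsFiniteRank a ∧ IsNilpotent a}
       add_mem' := fun ha hb => ⟨J.add_mem ha.1 hb.1, ha.2.1.add hb.2.1,
        isNilpotent_add_of_submultiplicative hJ hs ha.1 ha.2.1 ha.2.2 hb.1 hb.2.1 hb.2.2⟩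
       zero_mem' := ⟨J.zero_mem, isFiniteRank_zero, IsNilpotent.zero⟩
       smul_mem' := fun c a ha => ⟨J.smul_mem c ha.1, ha.2.1.smul c, ha.2.2.smul c⟩ },
      fun _ => Iff.rfl⟩
  refine exists_invariant_of_nil_ideal (J := J) (N := N) (fun a ha => ((hN a).mp ha).1) ?_
    (fun a ha => ((hN a).mp ha).2.1) (fun a ha => ((hN a).mp ha).2.2)
    ((Submodule.ne_bot_iff _).mpr ⟨z, (hN z).mpr ⟨hz, hzf, hzn⟩, hz0⟩)
  intro w hw a ha
  obtain ⟨hwJ, hwf, hwn⟩ := (hN w).mp hw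
  exact (hN _).mpr ⟨hJ w hwJ a ha, (hwf.mul_right a).add (hwf.mul_left a),
    isNilpotent_jordan_of_submultiplicative hJ hs hwJ hwf hwn ha⟩

end NilIdeal

section MinimalIdempotent

variable {X : Type*} [NormedAddCommGroup X] [NormedSpace ℂ X]

theorem apply_eq_self_of_mem_range {P : X →L[ℂ] X} (hP : P * P = P) {x : X} (hx : x ∈ P.range) :
    P x = x := by
  obtain ⟨y, rfl⟩ := hx
  exact congrArg (fun T : X →L[ℂ] X => T y) hP

/-- An idempotent of finite rank in a Jordan algebra, of minimal nonzero rank. -/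
structure IsMinimalIdempotent (J : Submodule ℂ (X →L[ℂ] X)) (P : X →L[ℂ] X) : Prop where
  mem : P ∈ J
  finite : IsFiniteRank P
  idem : P * P = P
  ne_zero : P ≠ 0
  le : ∀ e ∈ J, IsFiniteRank e → e * e = e → e ≠ 0 →
    Module.finrank ℂ P.range ≤ Module.finrank ℂ e.range

theorem exists_isMinimalIdempotent {J : Submodule ℂ (X →L[ℂ] X)}
    (hJ : ∀ A ∈ J, ∀ B ∈ J, A * B + B * A ∈ J)
    (hnil : ∀ z ∈ J, IsFiniteRank z → IsNilpotent z → z = 0)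
    {z : X →L[ℂ] X} (hz : z ∈ J) (hzf : IsFiniteRank z) (hz0 : z ≠ 0) :
    ∃ P, IsMinimalIdempotent J P := by
  have hne : ∃ n, ∃ e ∈ J, IsFiniteRank e ∧ e * e = e ∧ e ≠ 0 ∧
      Module.finrank ℂ e.range = n := by
    rcases isNilpotent_or_exists_idempotent hzf with h | ⟨v, h0, hid⟩
    · exact absurd (hnil z hz hzf h) hz0
    · exact ⟨_, _, jordan_mul_aeval_mem hJ hz v, hzf.mul_aeval v, hid, h0, rfl⟩
  classical
  obtain ⟨P, hP, hPf, hPP, hP0, hn⟩ := Nat.find_spec hne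
  exact ⟨P, hP, hPf, hPP, hP0, fun e he hef hee he0 =>
    hn ▸ Nat.find_min' hne ⟨e, he, hef, hee, he0, rfl⟩⟩

theorem IsMinimalIdempotent.exists_mul_mul_eq_smul {J : Submodule ℂ (X →L[ℂ] X)}
    (hJ : ∀ A ∈ J, ∀ B ∈ J, A * B + B * A ∈ J)
    (hnil : ∀ z ∈ J, IsFiniteRank z → IsNilpotent z → z = 0)
    {P : X →L[ℂ] X} (hP : IsMinimalIdempotent J P) {a : X →L[ℂ] X} (ha : a ∈ J) :
    ∃ c : ℂ, P * a * P = c • P := by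
  have hfd : FiniteDimensional ℂ P.range := hP.finite
  obtain ⟨x₀, hx₀⟩ : ∃ x, P x ≠ 0 := by
    by_contra! h
    exact hP.ne_zero (ContinuousLinearMap.ext h)
  have : Nontrivial P.range := ⟨⟨⟨P x₀, x₀, rfl⟩, 0, fun h => hx₀ (congrArg Subtype.val h)⟩⟩
  have hinv : ∀ x ∈ P.range, ((P * a * P : X →L[ℂ] X) : X →ₗ[ℂ] X) x ∈ P.range :=
    fun x _ => ⟨a (P x), rfl⟩
  obtain ⟨c, hc⟩ := Module.End.exists_eigenvalue
    (((P * a * P : X →L[ℂ] X) : X →ₗ[ℂ] X).restrict hinv)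
  obtain ⟨⟨x, hxP⟩, hx⟩ := hc.exists_hasEigenvector
  have hx0 : x ≠ 0 := fun h => hx.2 (Subtype.ext h)
  have hxc : (P * a * P) x = c • x := congrArg Subtype.val hx.apply_eq_smul
  have hPx := apply_eq_self_of_mem_range hP.idem hxP
  refine ⟨c, sub_eq_zero.mp ?_⟩
  obtain ⟨k, hk⟩ : ∃ k, k = P * a * P - c • P := ⟨_, rfl⟩
  have hkJ : k ∈ J := hk ▸ J.sub_mem (jordan_mul_mul_mem hJ hP.mem ha) (J.smul_mem c hP.mem)
  have hkf : IsFiniteRank k := hk ▸ ((hP.finite.mul_right _).mul_right _).sub (hP.finite.smul c)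
  have hPk : P * k = k := by
    rw [hk, mul_sub, mul_smul_comm, hP.idem, ← mul_assoc, ← mul_assoc, hP.idem]
  have hkP : k * P = k := by
    rw [hk, sub_mul, smul_mul_assoc, hP.idem, mul_assoc, hP.idem]
  have hkx : k x = 0 := by
    rw [hk, sub_apply, smul_apply, hxc, hPx, sub_self]
  rw [← hk]
  refine hnil k hkJ hkf ((isNilpotent_or_exists_idempotent hkf).resolve_right ?_)
  rintro ⟨v, h0, hid⟩
  have hle : (k * Polynomial.aeval k v).range ≤ P.range := by
    rintro _ ⟨y, rfl⟩
    refine ⟨(k * Polynomial.aeval k v) y, ?_⟩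
    change (P * (k * Polynomial.aeval k v)) y = _
    rw [← mul_assoc, hPk]
    rfl
  have heq := Submodule.eq_of_le_of_finrank_le hle
    (hP.le _ (jordan_mul_aeval_mem hJ hkJ v) (hkf.mul_aeval v) hid h0)
  have h1 := apply_eq_self_of_mem_range hid (heq ▸ hxP)
  have h2 : Commute (Polynomial.aeval k v) k := commute_aeval (Commute.refl k) v
  rw [← h2.eq, mul_apply_eq_comp, hkx, map_zero] at h1
  exact hx0 h1.symm

theorem jordan_idempotent_aux {R : Type*} [Ring R] {P g : R} (hP : P * P = P)
    (hPgP : P * g * P = 0) (hg : g = P * g + g * P) (hgg : P * g * g * P = P) :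
    (g * g + g) * (g * g + g) = (g * g + g) + (g * g + g) := by
  have h1 : g * g = P + g * P * g := by
    calc g * g = (P * g + g * P) * (P * g + g * P) := by rw [← hg]
      _ = P * g * P * g + P * g * g * P + g * (P * P) * g + g * (P * g * P) := by noncomm_ring
      _ = _ := by rw [hPgP, hgg, hP]; noncomm_ring
  have h2 : g * P * g * g = g * P := by
    calc g * P * g * g = g * P * g * (P * g + g * P) := by rw [← hg]
      _ = g * (P * g * P) * g + g * (P * g * g * P) := by noncomm_ring
      _ = _ := by rw [hPgP, hgg]; noncomm_ring
  have h3 : g * (g * g) = g := by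
    rw [← mul_assoc]
    conv_lhs => rw [h1, add_mul, h2, ← hg]
  calc (g * g + g) * (g * g + g) = g * (g * (g * g)) + g * (g * g) + g * (g * g) + g * g := by
        noncomm_ring
    _ = _ := by rw [h3]; abel

theorem not_submultiplicative_of_mul_mul_eq {J : Submodule ℂ (X →L[ℂ] X)}
    (hJ : ∀ A ∈ J, ∀ B ∈ J, A * B + B * A ∈ J)
    (hs : ∀ A ∈ J, ∀ B ∈ J, ∀ mu ∈ spectrum ℂ (A * B), mu ≠ 0 →
      ∃ α ∈ spectrum ℂ A, ∃ β ∈ spectrum ℂ B, mu = α * β)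
    {P g : X →L[ℂ] X} (hPJ : P ∈ J) (hgJ : g ∈ J) (hP : P * P = P) (hP0 : P ≠ 0)
    (hPgP : P * g * P = 0) (hg : g = P * g + g * P) (hgg : P * g * g * P = P) : False := by
  obtain ⟨x₀, hx₀⟩ : ∃ x, P x ≠ 0 := by
    by_contra! h
    exact hP0 (ContinuousLinearMap.ext h)
  obtain ⟨E, hE⟩ : ∃ E, E = (1 / 2 : ℂ) • (g * g + g) := ⟨_, rfl⟩
  have hggJ : g * g ∈ J := by
    have h := jordan_pow_succ_mem hJ hgJ 1
    rwa [pow_succ, pow_one] at h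
  have hEJ : E ∈ J := hE ▸ J.smul_mem _ (J.add_mem hggJ hgJ)
  have hEE : E * E = E := by
    rw [hE, smul_mul_smul_comm, jordan_idempotent_aux hP hPgP hg hgg, ← two_smul ℂ, smul_smul]
    norm_num
  have hPEP : P * E * P = (1 / 2 : ℂ) • P := by
    rw [hE, mul_smul_comm, smul_mul_assoc, mul_add, add_mul, hPgP, add_zero, ← mul_assoc, hgg]
  have h1 : (P * E) (P x₀) = (1 / 2 : ℂ) • P x₀ :=
    congrArg (fun T : X →L[ℂ] X => T x₀) hPEP
  obtain ⟨α, hα, β, hβ, hab⟩ := hs P hPJ E hEJ _ (mem_spectrum_of_eigenvector hx₀ h1) (by norm_num)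
  rcases IsIdempotentElem.spectrum_subset ℂ hP hα with rfl | rfl <;>
  rcases IsIdempotentElem.spectrum_subset ℂ hEE hβ with rfl | rfl <;>
  norm_num at hab

theorem IsMinimalIdempotent.mul_eq_mul_mul {J : Submodule ℂ (X →L[ℂ] X)}
    (hJ : ∀ A ∈ J, ∀ B ∈ J, A * B + B * A ∈ J)
    (hs : ∀ A ∈ J, ∀ B ∈ J, ∀ mu ∈ spectrum ℂ (A * B), mu ≠ 0 →
      ∃ α ∈ spectrum ℂ A, ∃ β ∈ spectrum ℂ B, mu = α * β)
    (hnil : ∀ z ∈ J, IsFiniteRank z → IsNilpotent z → z = 0)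
    {P : X →L[ℂ] X} (hP : IsMinimalIdempotent J P) {a : X →L[ℂ] X} (ha : a ∈ J) :
    a * P = P * a * P := by
  have hPP := hP.idem
  obtain ⟨h, hh⟩ : ∃ h, h = P * a + a * P - (2 : ℂ) • (P * a * P) := ⟨_, rfl⟩
  have hhJ : h ∈ J := hh ▸ J.sub_mem (hJ P hP.mem a ha)
    (J.smul_mem _ (jordan_mul_mul_mem hJ hP.mem ha))
  have hhf : IsFiniteRank h := hh ▸ ((hP.finite.mul_right a).add (hP.finite.mul_left a)).sub
    (((hP.finite.mul_right a).mul_right P).smul _)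
  have hPh : P * h = P * a - P * a * P := by
    rw [hh, mul_sub, mul_add, mul_smul_comm, two_smul, ← mul_assoc, ← mul_assoc, ← mul_assoc,
      ← mul_assoc, hPP]
    abel
  have hhP : h * P = a * P - P * a * P := by
    rw [hh, sub_mul, add_mul, smul_mul_assoc, two_smul, mul_assoc a, mul_assoc (P * a), hPP]
    abel
  have hPhP : P * h * P = 0 := by
    rw [hPh, sub_mul, mul_assoc (P * a), hPP, sub_self]
  have hsum : h = P * h + h * P := by
    rw [hPh, hhP, hh, two_smul]
    abel
  have hhhJ : h * h ∈ J := by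
    have h := jordan_pow_succ_mem hJ hhJ 1
    rwa [pow_succ, pow_one] at h
  obtain ⟨c, hc⟩ := hP.exists_mul_mul_eq_smul hJ hnil hhhJ
  rw [← mul_assoc] at hc
  have h0 : h = 0 := by
    by_cases hc0 : c = 0
    · rw [hc0, zero_smul] at hc
      refine hnil h hhJ hhf ⟨3, ?_⟩
      have h1 : h * h = h * P * h := by
        calc h * h = (P * h + h * P) * (P * h + h * P) := by rw [← hsum]
          _ = P * h * P * h + P * h * h * P + h * (P * P) * h + h * (P * h * P) := by noncomm_ring
          _ = _ := by rw [hPhP, hc, hPP]; noncomm_ring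
      calc h ^ 3 = h * h * h := by noncomm_ring
        _ = h * P * h * (P * h + h * P) := by rw [← hsum, h1]
        _ = h * (P * h * P) * h + h * (P * h * h * P) := by noncomm_ring
        _ = 0 := by rw [hPhP, hc]; noncomm_ring
    · obtain ⟨t, ht⟩ := IsAlgClosed.exists_pow_nat_eq (c⁻¹) (n := 2) two_pos
      refine (not_submultiplicative_of_mul_mul_eq hJ hs hP.mem (J.smul_mem t hhJ) hPP hP.ne_zero
        ?_ ?_ ?_).elim
      · rw [mul_smul_comm, smul_mul_assoc, hPhP, smul_zero]
      · rw [mul_smul_comm, smul_mul_assoc, ← smul_add, ← hsum]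
      · rw [mul_assoc P, smul_mul_smul_comm, mul_smul_comm, smul_mul_assoc, ← mul_assoc, hc,
          smul_smul, ← sq, ht, inv_mul_cancel₀ hc0, one_smul]
  rw [h0, zero_mul] at hhP
  exact sub_eq_zero.mp hhP.symm

end MinimalIdempotent

section Assembly

variable {X : Type*} [NormedAddCommGroup X] [NormedSpace ℂ X]

theorem exists_isClosed_line (hdim : 2 ≤ Module.rank ℂ X) :
    ∃ x : X, IsClosed ((Submodule.span ℂ {x} : Submodule ℂ X) : Set X) ∧
      Submodule.span ℂ {x} ≠ ⊥ ∧ Submodule.span ℂ {x} ≠ ⊤ := by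
  have : Nontrivial X := rank_pos_iff_nontrivial.mp (two_pos.trans_le hdim)
  obtain ⟨x, hx⟩ := exists_ne (0 : X)
  refine ⟨x, Submodule.closed_of_finiteDimensional _, by simpa using hx, fun h => ?_⟩
  have h1 := rank_span_le (R := ℂ) ({x} : Set X)
  rw [h, rank_top, Cardinal.mk_singleton] at h1
  exact absurd (hdim.trans h1) (by norm_num)

theorem exists_invariant_of_smul (hdim : 2 ≤ Module.rank ℂ X) {J : Submodule ℂ (X →L[ℂ] X)}
    (hJ : ∀ A ∈ J, ∃ c : ℂ, A = c • 1) :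
    ∃ M : Submodule ℂ X, IsClosed (M : Set X) ∧ M ≠ ⊥ ∧ M ≠ ⊤ ∧ ∀ A ∈ J, ∀ x ∈ M, A x ∈ M := by
  obtain ⟨x, hcl, h0, h1⟩ := exists_isClosed_line hdim
  refine ⟨_, hcl, h0, h1, fun A hA y hy => ?_⟩
  obtain ⟨c, rfl⟩ := hJ A hA
  exact Submodule.smul_mem _ c hy

theorem exists_invariant_of_finiteRank (hdim : 2 ≤ Module.rank ℂ X)
    {J : Submodule ℂ (X →L[ℂ] X)} (hJ : ∀ A ∈ J, ∀ B ∈ J, A * B + B * A ∈ J)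
    (hs : ∀ A ∈ J, ∀ B ∈ J, ∀ mu ∈ spectrum ℂ (A * B), mu ≠ 0 →
      ∃ α ∈ spectrum ℂ A, ∃ β ∈ spectrum ℂ B, mu = α * β)
    (hnil : ∀ z ∈ J, IsFiniteRank z → IsNilpotent z → z = 0)
    {z : X →L[ℂ] X} (hz : z ∈ J) (hzf : IsFiniteRank z) (hz0 : z ≠ 0) :
    ∃ M : Submodule ℂ X, IsClosed (M : Set X) ∧ M ≠ ⊥ ∧ M ≠ ⊤ ∧ ∀ A ∈ J, ∀ x ∈ M, A x ∈ M := by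
  obtain ⟨P, hP⟩ := exists_isMinimalIdempotent hJ hnil hz hzf hz0
  have hfd : FiniteDimensional ℂ P.range := hP.finite
  by_cases hP1 : P.range = ⊤
  · have hPone : P = 1 := ContinuousLinearMap.ext fun x =>
      apply_eq_self_of_mem_range hP.idem (hP1 ▸ Submodule.mem_top)
    refine exists_invariant_of_smul hdim fun A hA => ?_
    obtain ⟨c, hc⟩ := hP.exists_mul_mul_eq_smul hJ hnil hA
    rw [hPone, one_mul, mul_one] at hc
    exact ⟨c, hc⟩
  · refine ⟨P.range, Submodule.closed_of_finiteDimensional _, fun h => ?_, hP1, ?_⟩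
    · refine hP.ne_zero (ContinuousLinearMap.ext fun x => ?_)
      have hx : P x ∈ P.range := ⟨x, rfl⟩
      rw [h] at hx
      exact hx
    · rintro A hA _ ⟨y, rfl⟩
      refine ⟨A (P y), ?_⟩
      exact (congrArg (fun T : X →L[ℂ] X => T y) (hP.mul_eq_mul_mul hJ hs hnil hA)).symm

end Assembly

/-- A Jordan algebra of compact operators (on a space of dimension at least 2) with
submultiplicative spectrum is reducible. -/
theorem jordan_algebra_submultiplicative_reducible
    {X : Type*} [NormedAddCommGroup X] [NormedSpace ℂ X] [CompleteSpace X]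
    (hdim : 2 ≤ Module.rank ℂ X)
    (J : Submodule ℂ (X →L[ℂ] X))
    (hJordan : ∀ A ∈ J, ∀ B ∈ J, A * B + B * A ∈ J)
    (hcompact : ∀ A ∈ J, IsCompactOperator A)
    (hsubmul : ∀ A ∈ J, ∀ B ∈ J, ∀ mu ∈ spectrum ℂ (A * B),
      ∃ α ∈ spectrum ℂ A, ∃ β ∈ spectrum ℂ B, mu = α * β) :
    ∃ M : Submodule ℂ X, IsClosed (M : Set X) ∧ M ≠ ⊥ ∧ M ≠ ⊤ ∧
      ∀ A ∈ J, ∀ x ∈ M, A x ∈ M := by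
  have hcl : IsClosed (J.topologicalClosure : Set (X →L[ℂ] X)) := J.isClosed_topologicalClosure
  have hJ : ∀ A ∈ J.topologicalClosure, ∀ B ∈ J.topologicalClosure,
      A * B + B * A ∈ J.topologicalClosure := fun A hA B hB =>
    map_mem_closure₂ (f := fun A B : X →L[ℂ] X => A * B + B * A) (by fun_prop) hA hB hJordan
  have hc : ∀ A ∈ J.topologicalClosure, IsCompactOperator A := fun A hA =>
    closure_minimal (t := {A : X →L[ℂ] X | IsCompactOperator A}) hcompact
      isClosed_setOfPred_isCompactOperator hA
  have hs : ∀ A ∈ J.topologicalClosure, ∀ B ∈ J.topologicalClosure, ∀ mu ∈ spectrum ℂ (A * B),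
      mu ≠ 0 → ∃ α ∈ spectrum ℂ A, ∃ β ∈ spectrum ℂ B, mu = α * β := fun A hA B hB mu hmu h0 =>
    spectrum_mul_of_mem_closure hcompact hsubmul hA hB hmu h0
  suffices h : ∃ M : Submodule ℂ X, IsClosed (M : Set X) ∧ M ≠ ⊥ ∧ M ≠ ⊤ ∧
      ∀ A ∈ J.topologicalClosure, ∀ x ∈ M, A x ∈ M by
    obtain ⟨M, h1, h2, h3, h4⟩ := h
    exact ⟨M, h1, h2, h3, fun A hA => h4 A (J.le_topologicalClosure hA)⟩
  by_cases hJ0 : J.topologicalClosure = ⊥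
  · refine exists_invariant_of_smul hdim fun A hA => ⟨0, ?_⟩
    rw [hJ0, Submodule.mem_bot] at hA
    rw [hA, zero_smul]
  by_cases hfr : ∀ T ∈ J.topologicalClosure, IsFiniteRank T → T = 0
  · exact exists_invariant_of_no_finiteRank hcl hJ hc hfr hJ0
  push Not at hfr
  obtain ⟨z, hz, hzf, hz0⟩ := hfr
  by_cases hnil : ∀ w ∈ J.topologicalClosure, IsFiniteRank w → IsNilpotent w → w = 0
  · exact exists_invariant_of_finiteRank hdim hJ hs hnil hz hzf hz0
  push Not at hnil
  obtain ⟨w, hw, hwf, hwn, hw0⟩ := hnil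
  exact exists_invariant_of_nilpotent_mem hJ hs hw hwf hwn hw0
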